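/- arXiv:math/0207297 — 12 statements merged into one kernel-verified Lean document; each statement's English description precedes it below -/
import Mathlib

section
/- Let n ≥ 1 and let G be a finite set of maps ℂⁿ → ℂⁿ, each analytic on a common neighborhood U of 0 with F(0) = 0 and DF(0) invertible, such that the germ at 0 of the identity belongs to G and G is closed under composition of germs at 0 (for all F, H ∈ G there is K ∈ G with K = F∘H on some neighborhood of 0). Then there exists a map g analytic on a neighborhood of 0 with g(0) = 0 and Dg(0) invertible such that for every F ∈ G one has g∘F = DF(0)·g on some neighborhood of 0; i.e., the finite group G of germs is simultaneously analytically linearizable. -/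
open Filter Topology

/-- A finite group of germs at `0` of analytic diffeomorphisms of `ℂⁿ`
(closed under composition of germs and containing the identity germ) is
simultaneously analytically linearizable. -/
theorem finite_group_of_germs_linearizable (n : ℕ) (hn : 1 ≤ n)
    (G : Set ((Fin n → ℂ) → (Fin n → ℂ))) (hGfin : G.Finite)
    (U : Set (Fin n → ℂ)) (hU : U ∈ 𝓝 (0 : Fin n → ℂ))
    (hana : ∀ F ∈ G, AnalyticOnNhd ℂ F U)
    (hfix : ∀ F ∈ G, F 0 = 0)
    (hinv : ∀ F ∈ G, Function.Bijective (fderiv ℂ F 0))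
    (hid : ∃ F ∈ G, F =ᶠ[𝓝 (0 : Fin n → ℂ)] id)
    (hcomp : ∀ F ∈ G, ∀ H ∈ G, ∃ K ∈ G, K =ᶠ[𝓝 (0 : Fin n → ℂ)] (F ∘ H)) :
    ∃ g : (Fin n → ℂ) → (Fin n → ℂ), AnalyticAt ℂ g 0 ∧ g 0 = 0 ∧
      Function.Bijective (fderiv ℂ g 0) ∧
      ∀ F ∈ G, (g ∘ F) =ᶠ[𝓝 (0 : Fin n → ℂ)] (fun x => fderiv ℂ F 0 (g x)) := by
  classical
  have hAn : ∀ F ∈ G, AnalyticAt ℂ F 0 := fun F hF => hana F hF 0 (mem_of_mem_nhds hU)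
  have hdiff : ∀ F ∈ G, DifferentiableAt ℂ F 0 := fun F hF => (hAn F hF).differentiableAt
  have hB : ∀ F ∈ G, ∃ e : (Fin n → ℂ) ≃L[ℂ] (Fin n → ℂ),
      (e : (Fin n → ℂ) →L[ℂ] (Fin n → ℂ)) = fderiv ℂ F 0 := by
    intro F hF
    refine ⟨ContinuousLinearEquiv.ofBijective (fderiv ℂ F 0)
      (LinearMap.ker_eq_bot.2 (hinv F hF).1) (LinearMap.range_eq_top.2 (hinv F hF).2), ?_⟩
    ext1 x
    simp
  have hmap : ∀ F ∈ G, Filter.map F (𝓝 0) = 𝓝 0 := by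
    intro F hF
    obtain ⟨e, he⟩ := hB F hF
    have h1 : HasStrictFDerivAt F (e : (Fin n → ℂ) →L[ℂ] (Fin n → ℂ)) 0 := by
      rw [he]; exact (hAn F hF).hasStrictFDerivAt
    have := h1.map_nhds_eq_of_equiv
    rwa [hfix F hF] at this
  choose! e he using hB
  let T : Finset (Germ (𝓝 (0 : Fin n → ℂ)) (Fin n → ℂ)) :=
    hGfin.toFinset.image (fun F : (Fin n → ℂ) → (Fin n → ℂ) => (F : Germ (𝓝 (0 : Fin n → ℂ)) (Fin n → ℂ)))
  have hT : ∀ s ∈ T, ∃ F ∈ G, (F : Germ (𝓝 (0 : Fin n → ℂ)) (Fin n → ℂ)) = s := by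
    intro s hs
    simpa [T] using hs
  have hT' : ∀ F ∈ G, (F : Germ (𝓝 (0 : Fin n → ℂ)) (Fin n → ℂ)) ∈ T := by
    intro F hF
    exact Finset.mem_image_of_mem _ (hGfin.mem_toFinset.2 hF)
  choose! r hrG hr using hT
  have hTne : T.card ≠ 0 := by
    obtain ⟨F, hF, -⟩ := hid
    exact Finset.card_ne_zero_of_mem (hT' F hF)
  have hterm : ∀ s ∈ T, AnalyticAt ℂ (fun x => (e (r s)).symm (r s x)) 0 := by
    intro s hs
    exact (((e (r s)).symm : (Fin n → ℂ) →L[ℂ] (Fin n → ℂ)).analyticAt _).comp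
      (hAn _ (hrG s hs))
  have hderiv : HasFDerivAt (fun x => ∑ s ∈ T, (e (r s)).symm (r s x))
      (∑ s ∈ T, ContinuousLinearMap.id ℂ (Fin n → ℂ)) 0 := by
    refine HasFDerivAt.fun_sum fun s hs => ?_
    have h1 := (hdiff _ (hrG s hs)).hasFDerivAt
    rw [← he _ (hrG s hs)] at h1
    have h2 := ((e (r s)).symm : (Fin n → ℂ) →L[ℂ] (Fin n → ℂ)).hasFDerivAt.comp (0 : Fin n → ℂ) h1
    have h3 : ((e (r s)).symm : (Fin n → ℂ) →L[ℂ] (Fin n → ℂ)).comp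
        (e (r s) : (Fin n → ℂ) →L[ℂ] (Fin n → ℂ)) = ContinuousLinearMap.id ℂ (Fin n → ℂ) :=
      ContinuousLinearMap.ext fun x => by simp
    rw [h3] at h2
    exact h2
  refine ⟨fun x => ∑ s ∈ T, (e (r s)).symm (r s x), ?_, ?_, ?_, ?_⟩
  · exact Finset.analyticAt_fun_sum T hterm
  · exact Finset.sum_eq_zero fun s hs => by rw [hfix _ (hrG s hs), map_zero]
  · rw [hderiv.fderiv]
    have hc : (T.card : ℂ) ≠ 0 := by exact_mod_cast hTne
    have : ⇑(∑ s ∈ T, ContinuousLinearMap.id ℂ (Fin n → ℂ)) = fun x => (T.card : ℂ) • x := by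
      ext x i
      simp
    rw [this]
    exact MulAction.bijective (β := Fin n → ℂ) (Units.mk0 _ hc)
  · intro F hF
    let σ : Germ (𝓝 (0 : Fin n → ℂ)) (Fin n → ℂ) → Germ (𝓝 (0 : Fin n → ℂ)) (Fin n → ℂ) :=
      fun s => ((r s ∘ F : (Fin n → ℂ) → (Fin n → ℂ)) : Germ (𝓝 (0 : Fin n → ℂ)) (Fin n → ℂ))
    have hσ : ∀ s ∈ T, σ s ∈ T := by
      intro s hs
      obtain ⟨K, hK, hKe⟩ := hcomp _ (hrG s hs) F hF
      have : σ s = (K : Germ (𝓝 (0 : Fin n → ℂ)) (Fin n → ℂ)) := (Germ.coe_eq.2 hKe).symm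
      rw [this]
      exact hT' K hK
    have hinj : Set.InjOn σ T := by
      intro s hs t ht hst
      have h1 : (r s ∘ F) =ᶠ[𝓝 0] (r t ∘ F) := Germ.coe_eq.1 hst
      have h2 : r s =ᶠ[Filter.map F (𝓝 0)] r t := h1
      rw [hmap F hF] at h2
      rw [← hr s hs, ← hr t ht]
      exact Germ.coe_eq.2 h2
    have himg : T.image σ = T :=
      Finset.eq_of_subset_of_card_le (Finset.image_subset_iff.2 hσ)
        (Finset.card_image_of_injOn hinj).ge
    have hev : ∀ s ∈ T, r (σ s) =ᶠ[𝓝 0] (r s ∘ F) := fun s hs => Germ.coe_eq.1 (hr _ (hσ s hs))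
    have hall : ∀ᶠ x in 𝓝 (0 : Fin n → ℂ), ∀ s ∈ T, r (σ s) x = r s (F x) :=
      (Filter.eventually_all_finset T).2 hev
    filter_upwards [hall] with x hx
    have hre : ∑ s ∈ T, (e (r s)).symm (r s x) = ∑ s ∈ T, (e (r (σ s))).symm (r (σ s) x) := by
      conv_lhs => rw [← himg]
      exact Finset.sum_image hinj
    simp only [Function.comp]
    rw [hre, map_sum]
    refine Finset.sum_congr rfl fun s hs => ?_
    rw [hx s hs]
    have hd : fderiv ℂ (r (σ s)) 0 = (fderiv ℂ (r s) 0).comp (fderiv ℂ F 0) := by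
      rw [(hev s hs).fderiv_eq]
      have h3 : DifferentiableAt ℂ (r s) (F 0) := by
        rw [hfix F hF]; exact hdiff _ (hrG s hs)
      rw [fderiv_comp _ h3 (hdiff F hF), hfix F hF]
    apply (e (r s)).injective
    have h4 : ∀ v, e (r s) (fderiv ℂ F 0 v) = e (r (σ s)) v := by
      intro v
      have := congrArg (fun L => L v) hd
      simp only [ContinuousLinearMap.comp_apply] at this
      rw [← he _ (hrG s hs), ← he _ (hrG _ (hσ s hs))] at this
      exact this.symm
    rw [h4]
    simp
end

section
/- Let n ≥ 1, k ≥ 2, and let F : ℂⁿ → ℂⁿ be analytic at 0 with F(x) = x + P(x) + O(‖x‖^{k+1}) as x → 0, where P is a homogeneous polynomial map of degree k with P ≠ 0. Then for every integer r ≥ 1 the r-fold iterate satisfies F^{[r]}(x) = x + r·P(x) + O(‖x‖^{k+1}) as x → 0; in particular, F^{[r]} does not agree with the identity on any neighborhood of 0, so the germ of F at 0 has infinite order. -/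
open Filter Topology Asymptotics

/-- `P : ℂⁿ → ℂⁿ` is a homogeneous polynomial map of degree `d`:
each component is (the evaluation of) a homogeneous polynomial of degree `d`. -/
def IsHomogPolyMap (n d : ℕ) (P : (Fin n → ℂ) → (Fin n → ℂ)) : Prop :=
  ∀ i, ∃ q : MvPolynomial (Fin n) ℂ, q.IsHomogeneous d ∧ ∀ x, P x i = MvPolynomial.eval x q

theorem IsHomogPolyMap.smul_apply {n d : ℕ} {P : (Fin n → ℂ) → (Fin n → ℂ)}
    (hP : IsHomogPolyMap n d P) (c : ℂ) (x : Fin n → ℂ) : P (c • x) = c ^ d • P x := by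
  funext i
  obtain ⟨q, hq, h⟩ := hP i
  rw [h, Pi.smul_apply, h, MvPolynomial.eval_eq', MvPolynomial.eval_eq', Finset.smul_sum]
  refine Finset.sum_congr rfl fun m hm => ?_
  have hd : ∑ j, m j = d := by
    have := hq (MvPolynomial.mem_support_iff.1 hm)
    rw [Finsupp.weight_apply, Finsupp.sum_fintype _ _ (by simp)] at this
    simpa using this
  simp only [Pi.smul_apply, smul_eq_mul, mul_pow, Finset.prod_mul_distrib,
    Finset.prod_pow_eq_pow_sum, hd]
  ring

theorem IsHomogPolyMap.exists_lip {n d : ℕ} {P : (Fin n → ℂ) → (Fin n → ℂ)}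
    (hP : IsHomogPolyMap n d P) :
    ∃ L : ℝ, 0 ≤ L ∧ ∀ x y : Fin n → ℂ, ‖x‖ ≤ 2 → ‖y‖ ≤ 2 → ‖P y - P x‖ ≤ L * ‖y - x‖ := by
  have hc : ContDiff ℝ 1 P := by
    rw [contDiff_pi]
    intro i
    obtain ⟨q, hq, h⟩ := hP i
    have : (fun x => P x i) = fun x => MvPolynomial.eval x q := funext h
    rw [this]
    clear this h hq
    induction q using MvPolynomial.induction_on with
    | C a => simpa using contDiff_const
    | add p q hp hq => simpa using hp.add hq
    | mul_X p j hp => simpa using hp.mul (contDiff_apply ℝ ℂ j)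
  have hl : LocallyLipschitz P := hc.locallyLipschitz
  obtain ⟨K, hK⟩ := (hl.locallyLipschitzOn (s := Metric.closedBall 0 2)).exists_lipschitzOnWith_of_compact
    (isCompact_closedBall 0 2)
  refine ⟨K, K.2, fun x y hx hy => ?_⟩
  have := hK.dist_le_mul y (by simpa using hy) x (by simpa using hx)
  simpa [dist_eq_norm] using this

theorem IsHomogPolyMap.exists_lip' {n d : ℕ} {P : (Fin n → ℂ) → (Fin n → ℂ)}
    (hP : IsHomogPolyMap n d P) :
    ∃ L : ℝ, 0 ≤ L ∧ ∀ x y : Fin n → ℂ, x ≠ 0 → ‖y‖ ≤ 2 * ‖x‖ →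
      ‖P y - P x‖ * ‖x‖ ≤ L * ‖x‖ ^ d * ‖y - x‖ := by
  obtain ⟨L, hL, h⟩ := hP.exists_lip
  refine ⟨L, hL, fun x y hx hy => ?_⟩
  have hx' : 0 < ‖x‖ := norm_pos_iff.2 hx
  set c : ℂ := (‖x‖ : ℂ) with hc
  have hcn : ‖c‖ = ‖x‖ := by simp [hc]
  have hc0 : c ≠ 0 := by rw [← norm_pos_iff, hcn]; exact hx'
  have e : ∀ z, P z = c ^ d • P (c⁻¹ • z) := fun z => by
    rw [← hP.smul_apply, smul_inv_smul₀ hc0]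
  have h1 := h (c⁻¹ • x) (c⁻¹ • y)
    (by rw [norm_smul, norm_inv, hcn, inv_mul_cancel₀ hx'.ne']; norm_num)
    (by rw [norm_smul, norm_inv, hcn, inv_mul_le_iff₀ hx']; linarith)
  rw [← smul_sub, norm_smul, norm_inv, hcn] at h1
  rw [e y, e x, ← smul_sub, norm_smul, norm_pow, hcn]
  calc _ ≤ ‖x‖ ^ d * (L * (‖x‖⁻¹ * ‖y - x‖)) * ‖x‖ := by gcongr
    _ = _ := by field_simp

theorem IsHomogPolyMap.isBigO {n d : ℕ} {P : (Fin n → ℂ) → (Fin n → ℂ)}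
    (hP : IsHomogPolyMap n d P) (hd : d ≠ 0) :
    P =O[𝓝 (0 : Fin n → ℂ)] fun x => ‖x‖ ^ d := by
  have hP0 : P 0 = 0 := by
    have := hP.smul_apply 0 0
    simpa [hd] using this
  obtain ⟨L, hL, h⟩ := hP.exists_lip'
  refine IsBigO.of_bound L (Eventually.of_forall fun x => ?_)
  by_cases hx : x = 0
  · subst hx; simp [hP0, hd]
  have hx' : 0 < ‖x‖ := norm_pos_iff.2 hx
  have := h x 0 hx (by simp)
  simp only [hP0, zero_sub, norm_neg] at this
  simpa using le_of_mul_le_mul_right this hx'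

theorem isBigO_norm_pow_pow {n a b : ℕ} (hab : a ≤ b) :
    (fun x : Fin n → ℂ => ‖x‖ ^ b) =O[𝓝 (0 : Fin n → ℂ)] fun x => ‖x‖ ^ a := by
  refine IsBigO.of_bound 1 ?_
  filter_upwards [Metric.closedBall_mem_nhds (0 : Fin n → ℂ) one_pos] with x hx
  have hx : ‖x‖ ≤ 1 := by simpa using hx
  simpa using pow_le_pow_of_le_one (norm_nonneg x) hx hab

theorem IsHomogPolyMap.comp_sub {n d : ℕ} {P G : (Fin n → ℂ) → (Fin n → ℂ)}
    (hP : IsHomogPolyMap n d P) 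
    (hG : (fun x => G x - x) =O[𝓝 (0 : Fin n → ℂ)] fun x => ‖x‖ ^ 2) :
    (fun x => P (G x) - P x) =O[𝓝 (0 : Fin n → ℂ)] fun x => ‖x‖ ^ (d + 1) := by
  obtain ⟨L, hL, h⟩ := hP.exists_lip'
  obtain ⟨C, hC0, hC⟩ := hG.exists_pos
  have hG0 : G 0 = 0 := by
    have := hC.bound.self_of_nhds
    simpa using this
  refine IsBigO.of_bound (L * C) ?_
  filter_upwards [hC.bound, Metric.closedBall_mem_nhds (0 : Fin n → ℂ) (inv_pos.2 hC0)] with x h1 hx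
  have hx : ‖x‖ ≤ C⁻¹ := by simpa using hx
  by_cases hx0 : x = 0
  · subst hx0; simp [hG0]
  have hx' : 0 < ‖x‖ := norm_pos_iff.2 hx0
  simp only [norm_pow, norm_norm] at h1 ⊢
  have hCx : C * ‖x‖ ≤ 1 := by
    calc _ ≤ C * C⁻¹ := by gcongr
      _ = 1 := mul_inv_cancel₀ hC0.ne'
  have h2 : ‖G x‖ ≤ 2 * ‖x‖ := by
    have := norm_le_norm_add_norm_sub' (G x) x
    nlinarith
  have h3 := h x (G x) hx0 h2
  refine le_of_mul_le_mul_right (h3.trans ?_) hx'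
  calc _ ≤ L * ‖x‖ ^ d * (C * ‖x‖ ^ 2) := by gcongr
    _ = _ := by ring

/-- If `F(x) = x + P(x) + O(‖x‖^{k+1})` with `P` a nonzero homogeneous polynomial map of
degree `k ≥ 2`, then `F^[r](x) = x + r·P(x) + O(‖x‖^{k+1})`, and in particular `F^[r]`
is not the identity germ at `0`, so the germ of `F` has infinite order. -/
theorem iterate_of_tangent_to_identity (n k : ℕ) (hn : 1 ≤ n) (hk : 2 ≤ k)
    (F P : (Fin n → ℂ) → (Fin n → ℂ))
    (hF : AnalyticAt ℂ F 0)
    (hP : IsHomogPolyMap n k P) (hPne : P ≠ 0)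
    (hexp : (fun x => F x - x - P x) =O[𝓝 (0 : Fin n → ℂ)] fun x => ‖x‖ ^ (k + 1)) :
    ∀ r : ℕ, 1 ≤ r →
      ((fun x => F^[r] x - x - (r : ℂ) • P x) =O[𝓝 (0 : Fin n → ℂ)] fun x => ‖x‖ ^ (k + 1)) ∧
      ¬ (F^[r] =ᶠ[𝓝 (0 : Fin n → ℂ)] id) := by
  have hPO := hP.isBigO (by omega)
  have main : ∀ r : ℕ,
      (fun x => F^[r] x - x - (r : ℂ) • P x) =O[𝓝 (0 : Fin n → ℂ)] fun x => ‖x‖ ^ (k + 1) := by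
    intro r
    induction r with
    | zero => exact (isBigO_zero (E' := Fin n → ℂ) _ _).congr_left fun x => by simp
    | succ r ih =>
      have hG : (fun x => F^[r] x - x) =O[𝓝 (0 : Fin n → ℂ)] fun x => ‖x‖ ^ 2 := by
        have h1 := (ih.trans (isBigO_norm_pow_pow (show 2 ≤ k + 1 by omega))).add
          ((hPO.const_smul_left (r : ℂ)).trans (isBigO_norm_pow_pow hk))
        refine h1.congr_left fun x => ?_
        simp
      have hG1 : (F^[r]) =O[𝓝 (0 : Fin n → ℂ)] fun x => ‖x‖ := by
        have h1 : (fun x => F^[r] x - x) =O[𝓝 (0 : Fin n → ℂ)] fun x => ‖x‖ := by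
          simpa using hG.trans (isBigO_norm_pow_pow (show 1 ≤ 2 by omega))
        have h2 : (fun x : Fin n → ℂ => x) =O[𝓝 (0 : Fin n → ℂ)] fun x => ‖x‖ :=
          (isBigO_refl _ _).norm_right
        refine (h1.add h2).congr_left fun x => ?_
        simp
      have hT : Tendsto (F^[r]) (𝓝 0) (𝓝 0) := hG1.trans_tendsto tendsto_norm_zero
      have h1 := (hexp.comp_tendsto hT).trans (hG1.norm_left.pow (k + 1))
      refine ((h1.add (hP.comp_sub hG)).add ih).congr_left fun x => ?_
      simp only [Function.comp_apply, Function.iterate_succ_apply', Nat.cast_succ, add_smul,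
        one_smul]
      abel
  intro r hr
  refine ⟨main r, fun hid => hPne ?_⟩
  funext v
  obtain ⟨C, hC⟩ := (main r).bound
  have hT : Tendsto (fun t : ℝ => (t : ℂ) • v) (𝓝[>] 0) (𝓝 0) := by
    have : Continuous (fun t : ℝ => (t : ℂ) • v) := by fun_prop
    have h := this.tendsto 0
    simp only [Complex.ofReal_zero, zero_smul] at h
    exact h.mono_left nhdsWithin_le_nhds
  have hb : ∀ᶠ t : ℝ in 𝓝[>] 0, ‖(r : ℂ) • P v‖ ≤ C * (t * ‖v‖ ^ (k + 1)) := by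
    filter_upwards [hT.eventually hC, hT.eventually hid, self_mem_nhdsWithin] with t h1 h2 h3
    have h3 : 0 < t := h3
    rw [h2, hP.smul_apply] at h1
    simp only [id, sub_self, zero_sub, norm_neg, norm_smul, norm_pow,
      Complex.norm_real, Real.norm_eq_abs, abs_of_pos h3] at h1
    rw [norm_smul]
    refine le_of_mul_le_mul_left ?_ (pow_pos h3 k)
    calc _ = _ := by ring
      _ ≤ _ := h1
      _ = _ := by simp [abs_of_pos h3]; ring
  have hl : Tendsto (fun t : ℝ => C * (t * ‖v‖ ^ (k + 1))) (𝓝[>] 0) (𝓝 0) := by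
    have : Continuous (fun t : ℝ => C * (t * ‖v‖ ^ (k + 1))) := by fun_prop
    have h := this.tendsto 0
    simp only [zero_mul, mul_zero] at h
    exact h.mono_left nhdsWithin_le_nhds
  have h0 := ge_of_tendsto hl hb
  have h1 : (r : ℂ) • P v = 0 := norm_le_zero_iff.1 h0
  have hr0 : (r : ℂ) ≠ 0 := by exact_mod_cast (by omega : r ≠ 0)
  exact (smul_eq_zero.1 h1).resolve_left hr0
end

section
/- Let n ≥ 1 and λ, μ ∈ ℝⁿ. Suppose h is a homeomorphism of the n-torus Tⁿ = ℝⁿ/ℤⁿ onto itself satisfying h(x + [λ]) = h(x) + [μ] for all x ∈ Tⁿ, where [v] denotes the class of v ∈ ℝⁿ modulo ℤⁿ. Then there exists an integer n×n matrix M with det M = 1 or det M = −1 such that Mλ − μ ∈ ℤⁿ. -/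
open Filter Topology

/-- A continuous integer-valued function on `ℝⁿ` is constant. -/
lemma torusAux_const {n : ℕ} (g : (Fin n → ℝ) → ℝ) (hg : Continuous g)
    (h0 : ∀ x, ((g x : ℝ) : AddCircle (1 : ℝ)) = 0) : ∃ k : ℤ, ∀ x, g x = k := by
  have h1 : ∀ x, ∃ k : ℤ, (k : ℝ) = g x := by
    intro x
    obtain ⟨k, hk⟩ := (AddCircle.coe_eq_zero_iff (1 : ℝ)).1 (h0 x)
    exact ⟨k, by simpa using hk⟩
  choose k hk using h1
  have hkc : Continuous k := by
    rw [Int.isClosedEmbedding_coe_real.isInducing.continuous_iff]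
    exact hg.congr fun x => (hk x).symm
  refine ⟨k 0, fun x => ?_⟩
  rw [← hk x, PreconnectedSpace.constant inferInstance hkc (x := x) (y := 0)]

/-- Lifting a continuous function on the torus to `ℝⁿ`. -/
lemma torusAux_lift {n : ℕ} (f : (Fin n → AddCircle (1 : ℝ)) → AddCircle (1 : ℝ))
    (hf : Continuous f) :
    ∃ (F : (Fin n → ℝ) → ℝ) (a : Fin n → ℤ), Continuous F ∧
      (∀ x, ((F x : ℝ) : AddCircle (1 : ℝ)) = f fun i => ((x i : ℝ) : AddCircle (1 : ℝ))) ∧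
      ∀ (x : Fin n → ℝ) (z : Fin n → ℤ),
        F (x + fun i => (z i : ℝ)) = F x + ((∑ j, a j * z j : ℤ) : ℝ) := by
  have hc : Continuous fun x : Fin n → ℝ => f fun i => ((x i : ℝ) : AddCircle (1 : ℝ)) := by
    refine hf.comp (continuous_pi fun i => ?_)
    exact (AddCircle.continuous_mk' (1 : ℝ)).comp (continuous_apply i)
  obtain ⟨e, he⟩ := QuotientAddGroup.mk_surjective
    (f fun i => (((0 : Fin n → ℝ) i : ℝ) : AddCircle (1 : ℝ)))
  obtain ⟨F, ⟨-, hF⟩, -⟩ := (AddCircle.isCoveringMap_coe (1 : ℝ)).existsUnique_continuousMap_lifts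
    ⟨_, hc⟩ 0 e he
  have hF' : ∀ x, ((F x : ℝ) : AddCircle (1 : ℝ))
      = f fun i => ((x i : ℝ) : AddCircle (1 : ℝ)) := fun x => congrFun hF x
  have hz : ∀ z : Fin n → ℤ, ∃ k : ℤ, ∀ x, F (x + fun i => (z i : ℝ)) - F x = k := by
    intro z
    apply torusAux_const (fun x => F (x + fun i => (z i : ℝ)) - F x) (by fun_prop)
    intro x
    have : (fun i => (((x + fun i => (z i : ℝ)) i : ℝ) : AddCircle (1 : ℝ)))
        = fun i => ((x i : ℝ) : AddCircle (1 : ℝ)) := by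
      funext i
      have h0 : (((z i : ℤ) : ℝ) : AddCircle (1 : ℝ)) = 0 :=
        (AddCircle.coe_eq_zero_iff (1 : ℝ)).2 ⟨z i, by simp⟩
      rw [Pi.add_apply, AddCircle.coe_add, h0, add_zero]
    rw [AddCircle.coe_sub, hF', hF', this, sub_self]
  choose c hc' using hz
  have hadd : ∀ z w, c (z + w) = c z + c w := by
    intro z w
    have h1 := hc' (z + w) 0
    have h2 := hc' z 0
    have h3 := hc' w (0 + fun i => (z i : ℝ))
    have h4 : (0 + fun i => (((z + w) i : ℤ) : ℝ) : Fin n → ℝ)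
        = (0 + fun i => (z i : ℝ)) + fun i => (w i : ℝ) := by
      funext i; simp
    rw [h4] at h1
    have : ((c (z + w) : ℤ) : ℝ) = c z + c w := by linarith
    exact_mod_cast this
  let L : (Fin n → ℤ) →ₗ[ℤ] ℤ := (AddMonoidHom.mk' c hadd).toIntLinearMap
  refine ⟨F, fun j => L (Pi.single j 1), F.continuous, hF', fun x z => ?_⟩
  have h5 : c z = ∑ j, L (Pi.single j 1) * z j := by
    have := LinearMap.pi_apply_eq_sum_univ L z
    change L z = _
    rw [this]
    refine Finset.sum_congr rfl fun j _ => ?_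
    rw [smul_eq_mul, mul_comm]
    congr 2
    funext i
    simp [Pi.single_apply, eq_comm]
  rw [← h5, ← hc' z x]
  ring

lemma torusAux_bounded {n : ℕ} (F : (Fin n → ℝ) → ℝ) (a : Fin n → ℤ) (hF : Continuous F)
    (hper : ∀ (x : Fin n → ℝ) (z : Fin n → ℤ),
        F (x + fun i => (z i : ℝ)) = F x + ((∑ j, a j * z j : ℤ) : ℝ)) :
    ∃ C, ∀ x, |F x - ∑ j, (a j : ℝ) * x j| ≤ C := by
  have hc : Continuous fun x : Fin n → ℝ => F x - ∑ j, (a j : ℝ) * x j := by fun_prop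
  obtain ⟨C, hC⟩ := (isCompact_Icc (a := (0 : Fin n → ℝ)) (b := 1)).exists_bound_of_continuousOn
    hc.continuousOn
  refine ⟨C, fun x => ?_⟩
  have h1 := hC (fun i => Int.fract (x i))
    ⟨fun i => Int.fract_nonneg _, fun i => (Int.fract_lt_one _).le⟩
  have h2 := hper (fun i => Int.fract (x i)) (fun i => ⌊x i⌋)
  have h3 : ((fun i => Int.fract (x i)) + fun i => ((⌊x i⌋ : ℤ) : ℝ)) = x := by
    funext i; simp
  rw [h3] at h2
  have h4 : ∑ j, (a j : ℝ) * x j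
      = ∑ j, (a j : ℝ) * Int.fract (x j) + ((∑ j, a j * ⌊x j⌋ : ℤ) : ℝ) := by
    push_cast
    rw [← Finset.sum_add_distrib]
    refine Finset.sum_congr rfl fun j _ => ?_
    rw [← mul_add, Int.fract_add_floor]
  rw [h2, h4, add_sub_add_right_eq_sub]
  exact h1

lemma torusAux_rot {n : ℕ} (F : (Fin n → ℝ) → ℝ) (a : Fin n → ℤ) (hF : Continuous F)
    (hper : ∀ (x : Fin n → ℝ) (z : Fin n → ℤ),
        F (x + fun i => (z i : ℝ)) = F x + ((∑ j, a j * z j : ℤ) : ℝ))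
    (lam : Fin n → ℝ) (m : ℝ) (hm : ∀ x, F (x + lam) = F x + m) :
    ∑ j, (a j : ℝ) * lam j = m := by
  obtain ⟨C, hC⟩ := torusAux_bounded F a hF hper
  have hit : ∀ N : ℕ, F ((N : ℝ) • lam) = F 0 + N * m := by
    intro N
    induction N with
    | zero => simp
    | succ k ih =>
      have : ((k + 1 : ℕ) : ℝ) • lam = (k : ℝ) • lam + lam := by
        push_cast; rw [add_smul, one_smul]
      rw [this, hm, ih]; push_cast; ring
  set s := ∑ j, (a j : ℝ) * lam j with hs
  by_contra hne
  have hpos : 0 < |m - s| := abs_pos.2 (sub_ne_zero.2 (Ne.symm hne))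
  obtain ⟨N, hN⟩ := exists_nat_gt ((C + |F 0|) / |m - s|)
  rw [div_lt_iff₀ hpos] at hN
  have h1 := hC ((N : ℝ) • lam)
  have h2 : ∑ j, (a j : ℝ) * ((N : ℝ) • lam) j = N * s := by
    rw [hs, Finset.mul_sum]
    refine Finset.sum_congr rfl fun j _ => ?_
    simp only [Pi.smul_apply, smul_eq_mul]; ring
  rw [hit, h2] at h1
  have h3 : (N : ℝ) * |m - s| = |(F 0 + N * m - N * s) - F 0| := by
    rw [show F 0 + N * m - N * s - F 0 = N * (m - s) by ring, abs_mul, Nat.abs_cast]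
  have h4 := abs_sub (F 0 + N * m - N * s) (F 0)
  linarith

/-- If a self-homeomorphism `h` of the `n`-torus `Tⁿ = ℝⁿ/ℤⁿ` intertwines the translation
by `[λ]` with the translation by `[μ]`, then there is an integer matrix `M` with
`det M = ±1` such that `Mλ − μ ∈ ℤⁿ`. -/
theorem exists_integer_matrix_of_torus_conjugation
    (n : ℕ) (hn : 1 ≤ n) (lam mu : Fin n → ℝ)
    (h : (Fin n → AddCircle (1 : ℝ)) ≃ₜ (Fin n → AddCircle (1 : ℝ)))
    (hcomm : ∀ x : Fin n → AddCircle (1 : ℝ),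
      h (x + fun i => ((lam i : ℝ) : AddCircle (1 : ℝ)))
        = h x + fun i => ((mu i : ℝ) : AddCircle (1 : ℝ))) :
    ∃ M : Matrix (Fin n) (Fin n) ℤ, (M.det = 1 ∨ M.det = -1) ∧
      ∀ i, ∃ z : ℤ, (∑ j, (M i j : ℝ) * lam j) - mu i = z := by
  choose F A hFc hFl hFp using fun i => torusAux_lift (fun x => h x i)
    ((continuous_apply i).comp h.continuous)
  choose G B hGc hGl hGp using fun i => torusAux_lift (fun x => h.symm x i)
    ((continuous_apply i).comp h.symm.continuous)
  refine ⟨Matrix.of A, ?_, fun i => ?_⟩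
  · have hmul : Matrix.of B * Matrix.of A = 1 := by
      apply Matrix.ext_of_mulVec_single
      intro j
      rw [← Matrix.mulVec_mulVec, Matrix.one_mulVec]
      generalize (Pi.single j 1 : Fin n → ℤ) = z
      funext i
      obtain ⟨k, hk⟩ := torusAux_const (fun x => G i (fun l => F l x) - x i)
        (((hGc i).comp (continuous_pi hFc)).sub (continuous_apply i)) (by
          intro x
          rw [AddCircle.coe_sub, hGl]
          simp only [hFl]
          simp)
      have h1 := hk 0
      have h2 := hk (0 + fun i => (z i : ℝ))
      simp only [hFp] at h2
      have h3 := hGp i (fun l => F l 0) (fun l => ∑ j, A l j * z j)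
      have h4 : ((fun l => F l 0) + fun l => ((∑ j, A l j * z j : ℤ) : ℝ))
        = fun l => F l 0 + ((∑ j, A l j * z j : ℤ) : ℝ) := rfl
      rw [h4] at h3
      rw [h3] at h2
      simp only [Pi.add_apply, Pi.zero_apply] at h1 h2
      have h5 : ((∑ l, B i l * ∑ j, A l j * z j : ℤ) : ℝ) = z i := by linarith
      have h6 : (∑ l, B i l * ∑ j, A l j * z j : ℤ) = z i := by exact_mod_cast h5
      exact h6
    have hdet := congrArg Matrix.det hmul
    rw [Matrix.det_mul, Matrix.det_one] at hdet
    exact Int.isUnit_iff.1 (IsUnit.of_mul_eq_one_right _ hdet)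
  · obtain ⟨k, hk⟩ := torusAux_const (fun x => F i (x + lam) - F i x - mu i)
      ((((hFc i).comp (continuous_id.add continuous_const)).sub (hFc i)).sub continuous_const) (by
        intro x
        rw [AddCircle.coe_sub, AddCircle.coe_sub, hFl, hFl]
        have := congrFun (hcomm fun i => ((x i : ℝ) : AddCircle (1 : ℝ))) i
        have h2 : (fun i => (((x + lam) i : ℝ) : AddCircle (1 : ℝ)))
          = (fun i => ((x i : ℝ) : AddCircle (1 : ℝ)))
            + fun i => ((lam i : ℝ) : AddCircle (1 : ℝ)) := rfl
        rw [h2, this]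
        simp)
    refine ⟨k, ?_⟩
    have := torusAux_rot (F i) (A i) (hFc i) (hFp i) lam (mu i + k)
      (fun x => by have := hk x; linarith)
    simp only [Matrix.of_apply]
    linarith
end

section
/- Let n ≥ 1, M = (m_{ij}) an integer n×n matrix with det M = 1 or det M = −1, λ ∈ ℝⁿ, and μ ∈ ℝⁿ with μ − Mλ ∈ ℤⁿ. Define the linear maps A, B : ℂⁿ → ℂⁿ by A(x)_j = e^{2πiλ_j} x_j and B(x)_j = e^{2πiμ_j} x_j, and define H : (ℂ*)ⁿ → (ℂ*)ⁿ by H(x)_i = |x_i| · exp( i · Σ_j m_{ij} arg(x_j) ). Then H is a well-defined bijection of (ℂ*)ⁿ onto itself, H and its inverse are infinitely differentiable (as maps between open subsets of ℂⁿ ≅ ℝ^{2n}), H satisfies H(A x) = B(H x) for all x ∈ (ℂ*)ⁿ, and ‖H(x)‖ → 0 as x → 0. In particular the linear maps A and B are conjugate by a map which is a C^∞ diffeomorphism off the coordinate hyperplanes. -/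
open Filter Topology

noncomputable section

/-- The algebraic form of the map `H`. -/
def torMap {n : ℕ} (M : Matrix (Fin n) (Fin n) ℤ) (x : Fin n → ℂ) : Fin n → ℂ :=
  fun i => (‖x i‖ : ℂ) * ∏ j, (x j / (‖x j‖ : ℂ)) ^ (M i j)

end

theorem norm_torMap {n : ℕ} (M : Matrix (Fin n) (Fin n) ℤ) (x : Fin n → ℂ)
    (hx : ∀ i, x i ≠ 0) (i : Fin n) : ‖torMap M x i‖ = ‖x i‖ := by
  have h : ∀ j, ‖x j‖ ≠ 0 := fun j => norm_ne_zero_iff.mpr (hx j)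
  simp [torMap, norm_mul, norm_prod, norm_zpow, h]

theorem torMap_ne {n : ℕ} (M : Matrix (Fin n) (Fin n) ℤ) (x : Fin n → ℂ)
    (hx : ∀ i, x i ≠ 0) (i : Fin n) : torMap M x i ≠ 0 := by
  rw [← norm_ne_zero_iff, norm_torMap M x hx]
  exact norm_ne_zero_iff.mpr (hx i)

theorem torMap_div {n : ℕ} (M : Matrix (Fin n) (Fin n) ℤ) (x : Fin n → ℂ)
    (hx : ∀ i, x i ≠ 0) (i : Fin n) :
    torMap M x i / (‖torMap M x i‖ : ℂ) = ∏ j, (x j / (‖x j‖ : ℂ)) ^ (M i j) := by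
  have h : (‖x i‖ : ℂ) ≠ 0 := by exact_mod_cast norm_ne_zero_iff.mpr (hx i)
  rw [norm_torMap M x hx, torMap]
  field_simp

theorem zpow_sum_aux {n : ℕ} (a : ℂ) (ha : a ≠ 0) (f : Fin n → ℤ) (s : Finset (Fin n)) :
    a ^ (∑ j ∈ s, f j) = ∏ j ∈ s, a ^ f j := by
  classical
  induction s using Finset.induction_on with
  | empty => simp
  | insert b s hb ih => rw [Finset.sum_insert hb, Finset.prod_insert hb, zpow_add₀ ha, ih]

theorem torMap_comp {n : ℕ} (M N : Matrix (Fin n) (Fin n) ℤ) (x : Fin n → ℂ)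
    (hx : ∀ i, x i ≠ 0) : torMap M (torMap N x) = torMap (M * N) x := by
  funext i
  have h : ∀ j, x j / (‖x j‖ : ℂ) ≠ 0 := fun j =>
    div_ne_zero (hx j) (by exact_mod_cast norm_ne_zero_iff.mpr (hx j))
  have e1 : torMap M (torMap N x) i = (‖torMap N x i‖ : ℂ) *
      ∏ j, (torMap N x j / (‖torMap N x j‖ : ℂ)) ^ (M i j) := rfl
  rw [e1, norm_torMap N x hx]
  simp only [torMap_div N x hx]
  rw [torMap]
  congr 1
  simp only [Matrix.mul_apply, zpow_sum_aux _ (h _), ← Finset.prod_zpow]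
  rw [Finset.prod_comm]
  refine Finset.prod_congr rfl fun k _ => Finset.prod_congr rfl fun j _ => ?_
  rw [← zpow_mul, mul_comm]

theorem torMap_one {n : ℕ} (x : Fin n → ℂ)
    (hx : ∀ i, x i ≠ 0) : torMap 1 x = x := by
  funext i
  have h : (‖x i‖ : ℂ) ≠ 0 := by exact_mod_cast norm_ne_zero_iff.mpr (hx i)
  rw [torMap, Finset.prod_eq_single i]
  · simp only [Matrix.one_apply_eq, zpow_one]
    field_simp
  · intro j _ hj
    simp [Matrix.one_apply_ne hj.symm]
  · simp

theorem contDiffAt_zpow_aux {E : Type*} [NormedAddCommGroup E] [NormedSpace ℝ E]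
    (f : E → ℂ) (x : E) (hf : ContDiffAt ℝ (⊤ : ℕ∞) f x) (h : f x ≠ 0) (m : ℤ) :
    ContDiffAt ℝ (⊤ : ℕ∞) (fun y => f y ^ m) x := by
  cases m with
  | ofNat k => simpa using hf.pow k
  | negSucc k =>
    simp only [zpow_negSucc]
    exact (hf.pow (k + 1)).inv (pow_ne_zero _ h)

theorem contDiffOn_torMap {n : ℕ} (M : Matrix (Fin n) (Fin n) ℤ) :
    ContDiffOn ℝ (⊤ : ℕ∞) (torMap M) {x | ∀ i, x i ≠ 0} := by
  intro x hx
  apply ContDiffAt.contDiffWithinAt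
  rw [contDiffAt_pi]
  intro i
  have hc : ∀ j, ContDiffAt ℝ (⊤ : ℕ∞) (fun y : Fin n → ℂ => y j) x := fun j =>
    (contDiff_apply ℝ ℂ j).contDiffAt
  have hn : ∀ j, ContDiffAt ℝ (⊤ : ℕ∞) (fun y : Fin n → ℂ => (‖y j‖ : ℂ)) x := fun j =>
    Complex.ofRealCLM.contDiff.contDiffAt.comp x ((hc j).norm ℝ (hx j))
  have h0 : ∀ j, (‖x j‖ : ℂ) ≠ 0 := fun j => by exact_mod_cast norm_ne_zero_iff.mpr (hx j)
  unfold torMap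
  refine (hn i).mul (contDiffAt_prod fun j _ => ?_)
  refine contDiffAt_zpow_aux _ x ?_ (div_ne_zero (hx j) (h0 j)) _
  simp only [div_eq_mul_inv]
  exact (hc j).mul ((hn j).inv (h0 j))

theorem exp_sum_aux {n : ℕ} (m : Fin n → ℤ) (t : Fin n → ℂ) :
    Complex.exp (∑ j, (m j : ℂ) * t j) = ∏ j, Complex.exp (t j) ^ m j := by
  rw [Complex.exp_sum]
  exact Finset.prod_congr rfl fun j _ => Complex.exp_int_mul _ _

theorem torMap_eq {n : ℕ} (M : Matrix (Fin n) (Fin n) ℤ) (x : Fin n → ℂ)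
    (hx : ∀ i, x i ≠ 0) (i : Fin n) :
    (‖x i‖ : ℂ) * Complex.exp (Complex.I * ∑ j, (M i j : ℂ) * ((x j).arg : ℂ))
      = torMap M x i := by
  have e : Complex.I * ∑ j, (M i j : ℂ) * ((x j).arg : ℂ)
      = ∑ j, (M i j : ℂ) * (((x j).arg : ℂ) * Complex.I) := by
    rw [Finset.mul_sum]
    exact Finset.sum_congr rfl fun j _ => by ring
  rw [e, exp_sum_aux, torMap]
  congr 1
  refine Finset.prod_congr rfl fun j _ => ?_
  have h0 : (‖x j‖ : ℂ) ≠ 0 := by exact_mod_cast norm_ne_zero_iff.mpr (hx j)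
  congr 1
  rw [eq_div_iff h0, mul_comm]
  exact Complex.norm_mul_exp_arg_mul_I (x j)

/-- Given an integer matrix `M` with `det M = ±1` and `μ − Mλ ∈ ℤⁿ`, the map
`H(x)_i = |x_i|·exp(i·Σ_j m_{ij} arg x_j)` is a well-defined bijection of `(ℂ*)ⁿ`,
it and its inverse are `C^∞` (as maps of real manifolds), it conjugates the diagonal
linear maps `A(x)_j = e^{2πiλ_j}x_j` and `B(x)_j = e^{2πiμ_j}x_j`, and `‖H(x)‖ → 0`
as `x → 0`. -/
theorem smooth_conjugation_of_diagonal_unitary_linear_maps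
    (n : ℕ) (hn : 1 ≤ n) (M : Matrix (Fin n) (Fin n) ℤ)
    (hdet : M.det = 1 ∨ M.det = -1)
    (lam mu : Fin n → ℝ)
    (hres : ∀ i, ∃ z : ℤ, mu i - (∑ j, (M i j : ℝ) * lam j) = z)
    (A B H : (Fin n → ℂ) → (Fin n → ℂ))
    (hA : ∀ x j, A x j = Complex.exp (2 * Real.pi * Complex.I * (lam j : ℂ)) * x j)
    (hB : ∀ x j, B x j = Complex.exp (2 * Real.pi * Complex.I * (mu j : ℂ)) * x j)
    (hH : ∀ x i, H x i = (‖x i‖ : ℂ) *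
      Complex.exp (Complex.I * ∑ j, (M i j : ℂ) * ((x j).arg : ℂ))) :
    Set.BijOn H {x | ∀ i, x i ≠ 0} {x | ∀ i, x i ≠ 0} ∧
    ContDiffOn ℝ (⊤ : ℕ∞) H {x | ∀ i, x i ≠ 0} ∧
    (∃ H' : (Fin n → ℂ) → (Fin n → ℂ), ContDiffOn ℝ (⊤ : ℕ∞) H' {x | ∀ i, x i ≠ 0} ∧
      Set.InvOn H' H {x | ∀ i, x i ≠ 0} {x | ∀ i, x i ≠ 0}) ∧
    (∀ x : Fin n → ℂ, (∀ i, x i ≠ 0) → H (A x) = B (H x)) ∧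
    Filter.Tendsto H (𝓝 0) (𝓝 0) := by
  have hHS : ∀ x : Fin n → ℂ, (∀ i, x i ≠ 0) → H x = torMap M x := fun x hx => by
    funext i
    rw [hH, torMap_eq M x hx]
  have hu : IsUnit M.det := by
    rcases hdet with h | h <;> simp [h]
  have h1 : M⁻¹ * M = 1 := Matrix.nonsing_inv_mul M hu
  have h2 : M * M⁻¹ = 1 := Matrix.mul_nonsing_inv M hu
  have hmaps : Set.MapsTo H {x | ∀ i, x i ≠ 0} {x | ∀ i, x i ≠ 0} := fun x hx => by
    rw [hHS x hx]
    exact torMap_ne M x hx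
  have hmaps' : Set.MapsTo (torMap M⁻¹) {x : Fin n → ℂ | ∀ i, x i ≠ 0} {x | ∀ i, x i ≠ 0} :=
    fun x hx => torMap_ne _ x hx
  have hinv : Set.InvOn (torMap M⁻¹) H {x | ∀ i, x i ≠ 0} {x | ∀ i, x i ≠ 0} := by
    constructor
    · intro x hx
      rw [hHS x hx, torMap_comp _ _ x hx, h1, torMap_one x hx]
    · intro x hx
      rw [hHS _ (hmaps' hx), torMap_comp _ _ x hx, h2, torMap_one x hx]
  refine ⟨hinv.bijOn hmaps hmaps', (contDiffOn_torMap M).congr hHS,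
    ⟨torMap M⁻¹, contDiffOn_torMap _, hinv⟩, ?_, ?_⟩
  · intro x hx
    have hAx : ∀ i, A x i ≠ 0 := fun i => by
      rw [hA]
      exact mul_ne_zero (Complex.exp_ne_zero _) (hx i)
    have hnorm : ∀ j, ‖A x j‖ = ‖x j‖ := fun j => by
      have e : 2 * Real.pi * Complex.I * (lam j : ℂ)
          = ((2 * Real.pi * lam j : ℝ) : ℂ) * Complex.I := by
        push_cast
        ring
      rw [hA, norm_mul, e, Complex.norm_exp_ofReal_mul_I, one_mul]
    rw [hHS _ hAx, hHS x hx]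
    funext i
    rw [hB, torMap, torMap]
    simp only [hnorm]
    have e3 : ∀ j, (A x j / (‖x j‖ : ℂ)) ^ (M i j) =
        Complex.exp (2 * Real.pi * Complex.I * (lam j : ℂ)) ^ (M i j) *
          (x j / (‖x j‖ : ℂ)) ^ (M i j) := fun j => by
      rw [hA, mul_div_assoc, mul_zpow]
    simp only [e3]
    rw [Finset.prod_mul_distrib, ← exp_sum_aux]
    obtain ⟨z, hz⟩ := hres i
    have hmu : (mu i : ℂ) = (∑ j, (M i j : ℂ) * (lam j : ℂ)) + z := by
      have : mu i = (∑ j, (M i j : ℝ) * lam j) + z := by linarith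
      rw [this]
      push_cast
      rfl
    have e4 : Complex.exp (2 * Real.pi * Complex.I * (mu i : ℂ)) =
        Complex.exp (∑ j, (M i j : ℂ) * (2 * Real.pi * Complex.I * (lam j : ℂ))) := by
      rw [Complex.exp_eq_exp_iff_exists_int]
      refine ⟨z, ?_⟩
      rw [hmu, mul_add, Finset.mul_sum]
      congr 1
      · exact Finset.sum_congr rfl fun j _ => by ring
      · ring
    rw [e4]
    ring
  · rw [tendsto_pi_nhds]
    intro i
    have hn' : ∀ x, ‖H x i‖ = ‖x i‖ := fun x => by
      have e : Complex.I * ∑ j, (M i j : ℂ) * ((x j).arg : ℂ)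
          = ((∑ j, (M i j : ℝ) * (x j).arg : ℝ) : ℂ) * Complex.I := by
        push_cast
        ring
      rw [hH, norm_mul, e, Complex.norm_exp_ofReal_mul_I]
      simp
    rw [Pi.zero_apply, tendsto_zero_iff_norm_tendsto_zero]
    simp only [hn']
    have hc : Continuous fun x : Fin n → ℂ => ‖x i‖ := by fun_prop
    simpa using hc.tendsto 0
end

section
/- Let n ≥ 1 and let S be a set of maps ℂⁿ → ℂⁿ, each analytic at 0 with F(0) = 0 and DF(0) invertible. Then the following are equivalent: (i) S is simultaneously analytically linearizable, i.e. there exists g analytic at 0 with g(0) = 0 and Dg(0) invertible such that for every F ∈ S, g∘F = DF(0)·g on some neighborhood of 0; (ii) there exists a map X : ℂⁿ → ℂⁿ analytic at 0 with X(x) = x + O(‖x‖²) as x → 0 (i.e. X(0) = 0 and DX(0) = id, so the vector field X has radial first jet) such that X is invariant under every F ∈ S, meaning DF(x)·X(x) = X(F(x)) for all x in some neighborhood of 0 (depending on F). -/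
open Filter Topology Asymptotics

section Aux

variable {E : Type*} [NormedAddCommGroup E] [NormedSpace ℂ E]

/-- The formal solution `q = id + ...` of `Dq(y) y - q(y) = p(q(y))`. -/
noncomputable def radialSeries (p : FormalMultilinearSeries ℂ E E) :
    FormalMultilinearSeries ℂ E E
  | 0 => 0
  | 1 => (continuousMultilinearCurryFin1 ℂ E E).symm (ContinuousLinearMap.id ℂ E)
  | n + 2 =>
    let q : FormalMultilinearSeries ℂ E E := fun k => if k < n + 2 then radialSeries p k else 0;
    ((n : ℂ) + 1)⁻¹ • ∑ c ∈ ({c | 1 < Composition.length c}.toFinset : Finset (Composition (n+2))),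
      p.compAlongComposition q c

theorem radialSeries_coeff (p : FormalMultilinearSeries ℂ E E) (n : ℕ) :
    radialSeries p (n + 2) = ((n : ℂ) + 1)⁻¹ •
      ∑ c ∈ ({c | 1 < Composition.length c}.toFinset : Finset (Composition (n+2))),
        p.compAlongComposition (radialSeries p) c := by
  rw [radialSeries]
  congr 1
  refine Finset.sum_congr rfl fun c hc => ?_
  ext1 v
  simp only [FormalMultilinearSeries.compAlongComposition_apply]
  refine p.congr rfl fun j hj1 hj2 => ?_
  have N : 0 < n + 2 := by simp
  have : ∀ k, c.blocksFun k < n + 2 := by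
    simp only [Set.mem_toFinset (s := {c : Composition (n + 2) | 1 < c.length}),
      Set.mem_ofPred_eq] at hc
    simp [← Composition.ne_single_iff N, Composition.eq_single_iff_length, ne_of_gt hc]
  simp [FormalMultilinearSeries.applyComposition, this]

theorem radialSeries_comp (p : FormalMultilinearSeries ℂ E E) (hp : p 1 = 0) (n : ℕ)
    (v : Fin (n + 1) → E) :
    p.comp (radialSeries p) (n + 1) v = (n : ℂ) • radialSeries p (n + 1) v := by
  rw [FormalMultilinearSeries.comp_rightInv_aux1 (Nat.succ_pos n), hp]
  cases n with
  | zero =>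
    have : ∀ c : Composition 1, ¬ (1 < c.length) := fun c => not_lt.2 c.length_le
    simp [this]
  | succ n =>
    rw [radialSeries_coeff]
    have : ((n : ℂ) + 1) ≠ 0 := by exact_mod_cast Nat.succ_ne_zero n
    simp only [_root_.smul_apply, smul_smul]
    push_cast
    rw [mul_inv_cancel₀ this]
    simp [FormalMultilinearSeries.compAlongComposition_apply, -Set.toFinset_ofPred]

open Finset in
theorem radialSeries_aux2 {n : ℕ} (hn : 2 ≤ n + 1)
    (p : FormalMultilinearSeries ℂ E E) {r a C : ℝ} (hr : 0 ≤ r) (ha : 0 ≤ a)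
    (hC : 0 ≤ C) (hp : ∀ n, ‖p n‖ ≤ C * r ^ n) :
    ∑ k ∈ Ico 1 (n + 1), a ^ k * ‖radialSeries p k‖ ≤
      a + C * ∑ k ∈ Ico 2 (n + 1), (r * ∑ j ∈ Ico 1 n, a ^ j * ‖radialSeries p j‖) ^ k := 
  calc
    ∑ k ∈ Ico 1 (n + 1), a ^ k * ‖radialSeries p k‖ =
        a * ‖radialSeries p 1‖ + ∑ k ∈ Ico 2 (n + 1), a ^ k * ‖radialSeries p k‖ := by
      simp only [pow_one,
        show Ico (1 : ℕ) 2 = {1} from Nat.Ico_succ_singleton 1,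
        sum_singleton, ← sum_Ico_consecutive _ one_le_two hn]
    _ ≤ a * 1 +
          ∑ k ∈ Ico 2 (n + 1),
            a ^ k *
                ∑ c ∈ ({c | 1 < Composition.length c}.toFinset : Finset (Composition k)),
                  C * r ^ c.length * ∏ j, ‖radialSeries p (c.blocksFun j)‖ := by
      gcongr with j hj
      · rw [radialSeries, LinearIsometryEquiv.norm_map]
        exact ContinuousLinearMap.norm_id_le
      obtain ⟨m, rfl⟩ : ∃ m, j = m + 2 := ⟨j - 2, by have := (mem_Ico.1 hj).1; omega⟩
      rw [radialSeries_coeff, norm_smul]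
      have h1 : ‖((m : ℂ) + 1)⁻¹‖ ≤ 1 := by
        rw [norm_inv]
        apply inv_le_one_of_one_le₀
        have : ((m : ℂ) + 1) = ((m + 1 : ℕ) : ℂ) := by push_cast; rfl
        rw [this, Complex.norm_natCast]
        simp
      refine (mul_le_of_le_one_left (norm_nonneg _) h1).trans ?_
      apply (norm_sum_le _ _).trans
      gcongr
      apply (FormalMultilinearSeries.compAlongComposition_norm _ _ _).trans
      gcongr
      apply hp
    _ = a + C * ∑ k ∈ Ico 2 (n + 1), a ^ k *
          ∑ c ∈ ({c | 1 < Composition.length c}.toFinset : Finset (Composition k)),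
            r ^ c.length * ∏ j, ‖radialSeries p (c.blocksFun j)‖ := by
      rw [mul_one, mul_sum]
      congr 1
      refine sum_congr rfl fun k _ => ?_
      rw [mul_left_comm, mul_sum _ _ C]
      simp only [mul_assoc]
    _ ≤ a + C *
        ∑ k ∈ Ico 2 (n + 1), (r * ∑ j ∈ Ico 1 n, a ^ j * ‖radialSeries p j‖) ^ k := by
      gcongr _ + _ * ?_
      simp_rw [mul_pow]
      apply
        FormalMultilinearSeries.radius_right_inv_pos_of_radius_pos_aux1 n
          (fun k => ‖radialSeries p k‖) (fun k => norm_nonneg _) hr ha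

open Finset in
theorem radialSeries_radius_pos {p : FormalMultilinearSeries ℂ E E}
    (hp : 0 < p.radius) : 0 < (radialSeries p).radius := by
  obtain ⟨C, r, Cpos, rpos, ple⟩ :
    ∃ (C r : _) (_ : 0 < C) (_ : 0 < r), ∀ n : ℕ, ‖p n‖ ≤ C * r ^ n :=
    p.le_mul_pow_of_radius_pos hp
  obtain ⟨a, apos, ha1, ha2⟩ :
    ∃ (a : ℝ) (apos : 0 < a),
      8 * C * r ^ 2 * a ≤ 1 ∧ r * 2 * a ≤ 1 / 2 := by
    refine ⟨min (1 / (8 * C * r ^ 2)) (1 / (4 * r)), by positivity, ?_, ?_⟩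
    · calc _ ≤ 8 * C * r ^ 2 * (1 / (8 * C * r ^ 2)) := by gcongr; exact min_le_left _ _
        _ = 1 := by field_simp
        _ ≤ 1 := le_rfl
    · calc _ ≤ r * 2 * (1 / (4 * r)) := by gcongr; exact min_le_right _ _
        _ = 1 / 2 := by field_simp; norm_num
        _ ≤ _ := le_rfl
  let S n := ∑ k ∈ Ico 1 n, a ^ k * ‖radialSeries p k‖
  have IRec : ∀ n, 1 ≤ n → S n ≤ 2 * a := by
    apply Nat.le_induction
    · simp only [S]
      rw [Ico_eq_empty_of_le (le_refl 1), sum_empty]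
      positivity
    · intro n one_le_n hn
      have In : 2 ≤ n + 1 := by lia
      have Spos : 0 ≤ S n := by positivity
      have rSn : r * S n ≤ 1 / 2 :=
        calc
          r * S n ≤ r * (2 * a) := by gcongr
          _ ≤ 1 / 2 := by rwa [← mul_assoc]
      calc
        S (n + 1) ≤ a + C * ∑ k ∈ Ico 2 (n + 1), (r * S n) ^ k :=
          radialSeries_aux2 In p rpos.le apos.le Cpos.le ple
        _ = a + C * (((r * S n) ^ 2 - (r * S n) ^ (n + 1)) / (1 - r * S n)) := by
          rw [geom_sum_Ico' _ In]; exact ne_of_lt (rSn.trans_lt (by norm_num))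
        _ ≤ a + C * ((r * S n) ^ 2 / (1 / 2)) := by
          gcongr
          · simp only [sub_le_self_iff]
            positivity
          · linarith only [rSn]
        _ = a + 2 * C * (r * S n) ^ 2 := by ring
        _ ≤ a + 2 * C * (r * (2 * a)) ^ 2 := by gcongr
        _ = (1 + 8 * C * r ^ 2 * a) * a := by ring
        _ ≤ (1 + 1) * a := by gcongr
        _ = 2 * a := by ring
  let a' : NNReal := ⟨a, apos.le⟩
  suffices H : (a' : ENNReal) ≤ (radialSeries p).radius by
    apply lt_of_lt_of_le _ H
    simpa only [ENNReal.coe_pos]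
  apply FormalMultilinearSeries.le_radius_of_eventually_le _ (2 * a)
  filter_upwards [Ici_mem_atTop 1] with n (hn : 1 ≤ n)
  calc
    ‖radialSeries p n‖ * (a' : ℝ) ^ n = a ^ n * ‖radialSeries p n‖ := mul_comm _ _
    _ ≤ ∑ k ∈ Ico 1 (n + 1), a ^ k * ‖radialSeries p k‖ :=
      (haveI : ∀ k ∈ Ico 1 (n + 1), 0 ≤ a ^ k * ‖radialSeries p k‖ := fun k _ => by positivity
      single_le_sum this (by simp [hn]))
    _ ≤ 2 * a := IRec (n + 1) (by simp)

/-- Existence of the linearizing parametrization. -/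
theorem exists_radial_param [CompleteSpace E] {R : E → E} {p : FormalMultilinearSeries ℂ E E}
    (hR : HasFPowerSeriesAt R p 0) (h0 : R 0 = 0) (h1 : p 1 = 0) :
    ∃ h : E → E, AnalyticAt ℂ h 0 ∧ h 0 = 0 ∧
      HasStrictFDerivAt h (ContinuousLinearMap.id ℂ E) 0 ∧
      ∀ᶠ y in 𝓝 (0 : E), fderiv ℂ h y y = h y + R (h y) := by
  have hq := (radialSeries p).hasFPowerSeriesOnBall (radialSeries_radius_pos hR.radius_pos)
  set q := radialSeries p with hqdef
  have hq0 : q 0 = 0 := by rw [hqdef, radialSeries]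
  have hh0 : q.sum 0 = 0 := by
    rw [← hq.coeff_zero (fun _ => 0), hq0]; rfl
  have hq1 : continuousMultilinearCurryFin1 ℂ E E (q 1) = ContinuousLinearMap.id ℂ E := by
    rw [hqdef, radialSeries]; simp
  refine ⟨q.sum, hq.analyticAt, hh0, ?_, ?_⟩
  · have := hq.hasFPowerSeriesAt.hasStrictFDerivAt
    rwa [hq1] at this
  have hcomp : HasFPowerSeriesAt (R ∘ q.sum) (p.comp q) 0 := by
    apply HasFPowerSeriesAt.comp _ hq.hasFPowerSeriesAt
    rwa [hh0]
  filter_upwards [hcomp.eventually_hasSum, hq.hasFPowerSeriesAt.eventually_hasSum,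
    hq.fderiv.hasFPowerSeriesAt.eventually_hasSum] with y h1' h2 h3
  rw [zero_add] at h1' h2 h3
  have h3' := h3.mapL (ContinuousLinearMap.apply ℂ E y)
  simp only [ContinuousLinearMap.apply_apply, FormalMultilinearSeries.derivSeries_apply_diag] at h3'
  have hp0 : p 0 = 0 := by
    ext v; rw [hR.coeff_zero v, h0]; rfl
  rw [← hasSum_nat_add_iff' 1] at h1' h2
  simp only [Finset.sum_range_one, FormalMultilinearSeries.comp_coeff_zero', hp0, hq0,
    _root_.zero_apply, sub_zero] at h1' h2
  refine h3'.unique ?_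
  have hc : (R ∘ q.sum) y = R (q.sum y) := rfl
  rw [← hc]
  convert h2.add h1' using 2 with n
  rw [hqdef, radialSeries_comp p h1, add_comm, ← Nat.cast_smul_eq_nsmul ℂ]
  push_cast
  rw [add_smul, one_smul]

/-- A solution of the Euler equation is linear. -/
theorem euler_linear {k : E → E} (hk : AnalyticAt ℂ k 0) (h0 : k 0 = 0) [CompleteSpace E]
    (he : ∀ᶠ y in 𝓝 (0 : E), fderiv ℂ k y y = k y) :
    ∀ᶠ y in 𝓝 (0 : E), k y = fderiv ℂ k 0 y := by
  obtain ⟨ρ, hρ, hB⟩ := Metric.eventually_nhds_iff_ball.1 (he.and hk.eventually_analyticAt)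
  filter_upwards [Metric.ball_mem_nhds 0 hρ] with y hy
  have hmem : ∀ t ∈ Set.Icc (0 : ℝ) 1, t • y ∈ Metric.ball (0 : E) ρ := by
    intro t ht
    rw [mem_ball_zero_iff] at hy ⊢
    rw [norm_smul, Real.norm_of_nonneg ht.1]
    exact (mul_le_of_le_one_left (norm_nonneg _) ht.2).trans_lt hy
  have hd : ∀ t ∈ Set.Icc (0 : ℝ) 1,
      HasDerivAt (fun t : ℝ => k (t • y)) (fderiv ℂ k (t • y) y) t := by
    intro t ht
    have h1 : HasFDerivAt k ((fderiv ℂ k (t • y)).restrictScalars ℝ) (t • y) :=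
      ((hB _ (hmem t ht)).2.differentiableAt.hasFDerivAt).restrictScalars ℝ
    have h2 : HasDerivAt (fun t : ℝ => t • y) y t := by
      simpa using (hasDerivAt_id t).smul_const y
    exact h1.comp_hasDerivAt t h2
  have hconst : ∀ ε ∈ Set.Ioc (0 : ℝ) 1, ε⁻¹ • k (ε • y) = k y := by
    intro ε hε
    have hφ : ∀ t ∈ Set.Icc ε 1, HasDerivAt (fun t : ℝ => t⁻¹ • k (t • y)) 0 t := by
      intro t ht
      have ht0 : 0 < t := hε.1.trans_le ht.1
      have htm : t ∈ Set.Icc (0 : ℝ) 1 := ⟨ht0.le, ht.2⟩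
      have h3 : HasDerivAt (fun t : ℝ => t⁻¹ • k (t • y))
          (t⁻¹ • (fderiv ℂ k (t • y)) y + -(t ^ 2)⁻¹ • k (t • y)) t :=
        (hasDerivAt_inv ht0.ne').smul (hd t htm)
      refine h3.congr_deriv ?_
      have h4 := (hB _ (hmem t htm)).1
      rw [← h4, ← Complex.coe_smul t y, map_smul, Complex.coe_smul,
        Complex.coe_smul t ((fderiv ℂ k (t • y)) y), smul_smul, ← add_smul]
      have : t⁻¹ + -(t ^ 2)⁻¹ * t = 0 := by field_simp; norm_num
      rw [this, zero_smul]
    have := constant_of_has_deriv_right_zero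
      (fun t ht => (hφ t ht).continuousAt.continuousWithinAt)
      (fun t ht => (hφ t ⟨ht.1, ht.2.le⟩).hasDerivWithinAt) 1 ⟨hε.2, le_rfl⟩
    simpa using this.symm
  have hs := (hd 0 ⟨le_rfl, zero_le_one⟩).tendsto_slope_zero_right
  simp only [zero_add, zero_smul, h0, sub_zero] at hs
  refine tendsto_nhds_unique (Tendsto.congr' ?_ tendsto_const_nhds) hs
  filter_upwards [Ioc_mem_nhdsGT (zero_lt_one' ℝ)] with ε hε
  exact (hconst ε hε).symm

theorem linearizable_of_radial [CompleteSpace E] {X : E → E} (hX : AnalyticAt ℂ X 0)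
    (hO : (fun x => X x - x) =O[𝓝 (0 : E)] fun x => ‖x‖ ^ 2) :
    ∃ g : E → E, AnalyticAt ℂ g 0 ∧ g 0 = 0 ∧ fderiv ℂ g 0 = ContinuousLinearMap.id ℂ E ∧
      ∀ F : E → E, AnalyticAt ℂ F 0 → F 0 = 0 →
        (∀ᶠ x in 𝓝 (0 : E), fderiv ℂ F x (X x) = X (F x)) →
        (g ∘ F) =ᶠ[𝓝 (0 : E)] fun x => fderiv ℂ F 0 (g x) := by
  have hR : AnalyticAt ℂ (fun x => X x - x) 0 := hX.sub analyticAt_id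
  have hO' : (fun x => X x - x) =O[𝓝 (0 : E)] fun x => ‖x - 0‖ ^ 2 := by simpa using hO
  have hR0 : X 0 - 0 = 0 := hO'.eq_zero_of_norm_pow two_ne_zero
  obtain ⟨p, hp⟩ := hR
  have hp1 : p 1 = 0 := by
    have h1 := hp.fderiv_eq
    rw [(hO'.hasFDerivAt one_lt_two).fderiv] at h1
    exact (continuousMultilinearCurryFin1 ℂ E E).injective (by rw [← h1, map_zero])
  obtain ⟨h, hh, hh0, hhd, hhX⟩ := exists_radial_param hp hR0 hp1
  have hhX' : ∀ᶠ y in 𝓝 (0 : E), fderiv ℂ h y y = X (h y) := by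
    filter_upwards [hhX] with y hy
    rw [hy]; abel
  have hhd' : HasStrictFDerivAt h ((ContinuousLinearEquiv.refl ℂ E : E ≃L[ℂ] E) : E →L[ℂ] E) 0 :=
    hhd
  set g := hhd'.localInverse with hg
  have hga : AnalyticAt ℂ g 0 := by
    have := (hhd'.toOpenPartialHomeomorph h).analyticAt_symm'
      hhd'.mem_toOpenPartialHomeomorph_source hh hhd'.hasFDerivAt.fderiv
    change AnalyticAt ℂ g (h 0) at this
    rwa [hh0] at this
  have hg0 : g 0 = 0 := by
    have := hhd'.localInverse_apply_image
    rwa [hh0] at this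
  have hgd : HasFDerivAt g (ContinuousLinearMap.id ℂ E) 0 := by
    have := hhd'.to_localInverse.hasFDerivAt
    rwa [hh0] at this
  have hgh : ∀ᶠ y in 𝓝 (0 : E), g (h y) = y := hhd'.eventually_left_inverse
  have hhg : ∀ᶠ y in 𝓝 (0 : E), h (g y) = y := by
    have := hhd'.eventually_right_inverse
    rwa [hh0] at this
  have hgt : Tendsto g (𝓝 0) (𝓝 0) := by
    have := hga.continuousAt.tendsto; rwa [hg0] at this
  have hht : Tendsto h (𝓝 0) (𝓝 0) := by
    have := hh.continuousAt.tendsto; rwa [hh0] at this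
  have hht' : ∀ᶠ y in 𝓝 (0 : E), AnalyticAt ℂ g (h y) := hht.eventually hga.eventually_analyticAt
  -- `Dg X = g`
  have hgX1 : ∀ᶠ y in 𝓝 (0 : E), fderiv ℂ g (h y) (X (h y)) = g (h y) := by
    filter_upwards [hhX', hgh.eventually_nhds, hh.eventually_analyticAt, hht'] with y h1 h2 h3 h4
    have h5 : HasFDerivAt (fun y => g (h y)) (ContinuousLinearMap.id ℂ E) y :=
      (hasFDerivAt_id y).congr_of_eventuallyEq h2
    have h6 := (h4.differentiableAt.hasFDerivAt.comp y h3.differentiableAt.hasFDerivAt).unique h5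
    have h7 := DFunLike.congr_fun h6 y
    rw [← h1, h2.self_of_nhds]
    simpa using h7
  have hgX : ∀ᶠ x in 𝓝 (0 : E), fderiv ℂ g x (X x) = g x := by
    filter_upwards [hgt.eventually hgX1, hhg] with x h1 h2
    rwa [h2] at h1
  refine ⟨g, hga, hg0, hgd.fderiv, fun F hF hF0 hFX => ?_⟩
  have hFt : Tendsto F (𝓝 0) (𝓝 0) := by
    have := hF.continuousAt.tendsto; rwa [hF0] at this
  have hFh : AnalyticAt ℂ (fun y => F (h y)) 0 := by
    apply AnalyticAt.fun_comp _ hh; rwa [hh0]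
  have hk : AnalyticAt ℂ (fun y => g (F (h y))) 0 := by
    apply AnalyticAt.fun_comp (g := g) (f := fun y => F (h y)) _ hFh
    simpa [hh0, hF0] using hga
  have hk0 : g (F (h 0)) = 0 := by rw [hh0, hF0, hg0]
  have hkd : fderiv ℂ (fun y => g (F (h y))) 0 = fderiv ℂ F 0 := by
    have h1 : HasFDerivAt F (fderiv ℂ F 0) (h 0) := by
      rw [hh0]; exact hF.differentiableAt.hasFDerivAt
    have h2 : HasFDerivAt g (ContinuousLinearMap.id ℂ E) (F (h 0)) := by rwa [hh0, hF0]
    have h3 : HasFDerivAt (fun y => g (F (h y))) _ 0 := h2.comp 0 (h1.comp 0 hhd.hasFDerivAt)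
    simpa using h3.fderiv
  have hE := euler_linear hk hk0 (by
    filter_upwards [hhX', hh.eventually_analyticAt, hht.eventually hF.eventually_analyticAt,
      hht.eventually (hFt.eventually hga.eventually_analyticAt), hht.eventually hFX,
      hht.eventually (hFt.eventually hgX)] with y h1 h2 h3 h4 h5 h6
    have := (h4.differentiableAt.hasFDerivAt.comp y
      (h3.differentiableAt.hasFDerivAt.comp y h2.differentiableAt.hasFDerivAt)).fderiv
    have h7 : fderiv ℂ (fun y => g (F (h y))) y = _ := this
    rw [h7]
    simp only [ContinuousLinearMap.comp_apply]
    rw [h1, h5, h6])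
  rw [hkd] at hE
  filter_upwards [hgt.eventually hE, hhg] with x h1 h2
  rw [h2] at h1
  exact h1

theorem radial_of_linearizable [CompleteSpace E] {g : E → E} (hga : AnalyticAt ℂ g 0)
    (hg0 : g 0 = 0) (hgu : IsUnit (fderiv ℂ g 0)) :
    ∃ X : E → E, AnalyticAt ℂ X 0 ∧
      ((fun x => X x - x) =O[𝓝 (0 : E)] fun x => ‖x‖ ^ 2) ∧
      ∀ F : E → E, AnalyticAt ℂ F 0 → F 0 = 0 →
        ((g ∘ F) =ᶠ[𝓝 (0 : E)] fun x => fderiv ℂ F 0 (g x)) →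
        ∀ᶠ x in 𝓝 (0 : E), fderiv ℂ F x (X x) = X (F x) := by
  set J : E → (E →L[ℂ] E) := fun x => Ring.inverse (fderiv ℂ g x) with hJdef
  have hJ : AnalyticAt ℂ J 0 := by
    apply AnalyticAt.fun_comp (g := Ring.inverse) (f := fun x => fderiv ℂ g x) _ hga.fderiv
    exact analyticAt_inverse hgu.unit
  have hX : AnalyticAt ℂ (fun x => J x (g x)) 0 :=
    ((ContinuousLinearMap.id ℂ (E →L[ℂ] E)).analyticAt_bilinear (J 0, g 0)).comp₂ hJ hga
  have hR : AnalyticAt ℂ (fun x => J x (g x) - x) 0 := hX.sub analyticAt_id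
  have hunit : ∀ᶠ x in 𝓝 (0 : E), IsUnit (fderiv ℂ g x) :=
    hga.fderiv.continuousAt.eventually (Units.isOpen.mem_nhds hgu)
  refine ⟨fun x => J x (g x), hX, ?_, fun F hF hF0 hFg => ?_⟩
  · have hd : HasFDerivAt (fun x => J x (g x) - x) (0 : E →L[ℂ] E) 0 := by
      have h1 : HasFDerivAt (fun x => J x (g x) - x) _ 0 :=
        (hJ.differentiableAt.hasFDerivAt.clm_apply
          hga.differentiableAt.hasFDerivAt).sub (hasFDerivAt_id (0 : E))
      refine h1.congr_fderiv ?_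
      have h2 : J 0 * fderiv ℂ g 0 = 1 := Ring.inverse_mul_cancel _ hgu
      ext v
      have h3 := DFunLike.congr_fun h2 v
      have h4 : J 0 (fderiv ℂ g 0 v) = v := h3
      simp [hg0, h4]
    obtain ⟨p, hp⟩ := hR
    have h := hp.isBigO_sub_partialSum_pow 2
    have hp1 : p 1 = 0 := by
      have h1 := hp.fderiv_eq
      rw [hd.fderiv] at h1
      exact (continuousMultilinearCurryFin1 ℂ E E).injective (by rw [← h1, map_zero])
    have hp0 : ∀ v, p 0 v = 0 := by
      intro v; rw [hp.coeff_zero v]; simp [hg0]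
    simpa [FormalMultilinearSeries.partialSum, Finset.sum_range_succ, hp1, hp0] using h
  · have hFt : Tendsto F (𝓝 0) (𝓝 0) := by
      have := hF.continuousAt.tendsto; rwa [hF0] at this
    filter_upwards [hFg.eventually_nhds, hF.eventually_analyticAt, hga.eventually_analyticAt,
      hFt.eventually hga.eventually_analyticAt, hunit, hFt.eventually hunit]
      with x h1 h2 h3 h4 h5 h6
    have e1 : HasFDerivAt (g ∘ F) ((fderiv ℂ F 0).comp (fderiv ℂ g x)) x :=
      ((fderiv ℂ F 0).hasFDerivAt.comp x h3.differentiableAt.hasFDerivAt).congr_of_eventuallyEq h1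
    have e2 := (h4.differentiableAt.hasFDerivAt.comp x h2.differentiableAt.hasFDerivAt).unique e1
    have e3 : fderiv ℂ g (F x) (fderiv ℂ F x (J x (g x))) =
        fderiv ℂ F 0 (fderiv ℂ g x (J x (g x))) := DFunLike.congr_fun e2 (J x (g x))
    have e4 : fderiv ℂ g x (J x (g x)) = g x :=
      DFunLike.congr_fun (Ring.mul_inverse_cancel _ h5) (g x)
    have e5 : g (F x) = fderiv ℂ F 0 (g x) := h1.self_of_nhds
    rw [e4, ← e5] at e3
    have e6 : J (F x) (fderiv ℂ g (F x) (fderiv ℂ F x (J x (g x)))) = fderiv ℂ F x (J x (g x)) :=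
      DFunLike.congr_fun (Ring.inverse_mul_cancel _ h6) _
    rw [← e6, e3]

end Aux

/-- A set of germs of holomorphic diffeomorphisms of `(ℂⁿ,0)` is simultaneously
analytically linearizable iff there is an analytic vector field `X` with radial
first jet (`X(x) = x + O(‖x‖²)`) invariant under every element of the set
(`DF(x)·X(x) = X(F(x))` near `0`). -/
theorem linearizable_iff_invariant_radial_vector_field
    (n : ℕ) (hn : 1 ≤ n)
    (S : Set ((Fin n → ℂ) → (Fin n → ℂ)))
    (hana : ∀ F ∈ S, AnalyticAt ℂ F 0)
    (hfix : ∀ F ∈ S, F 0 = 0)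
    (hinv : ∀ F ∈ S, Function.Bijective (fderiv ℂ F 0)) :
    (∃ g : (Fin n → ℂ) → (Fin n → ℂ), AnalyticAt ℂ g 0 ∧ g 0 = 0 ∧
        Function.Bijective (fderiv ℂ g 0) ∧
        ∀ F ∈ S, (g ∘ F) =ᶠ[𝓝 (0 : Fin n → ℂ)] fun x => fderiv ℂ F 0 (g x)) ↔
    (∃ X : (Fin n → ℂ) → (Fin n → ℂ), AnalyticAt ℂ X 0 ∧
        ((fun x => X x - x) =O[𝓝 (0 : Fin n → ℂ)] fun x => ‖x‖ ^ 2) ∧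
        ∀ F ∈ S, ∀ᶠ x in 𝓝 (0 : Fin n → ℂ), fderiv ℂ F x (X x) = X (F x)) := by
  constructor
  · rintro ⟨g, hga, hg0, hgb, hg⟩
    have hgu : IsUnit (fderiv ℂ g 0) := by
      rw [ContinuousLinearMap.isUnit_iff_bijective]
      exact hgb
    obtain ⟨X, hX, hO, hXF⟩ := radial_of_linearizable hga hg0 hgu
    exact ⟨X, hX, hO, fun F hF => hXF F (hana F hF) (hfix F hF) (hg F hF)⟩
  · rintro ⟨X, hX, hO, hXF⟩
    obtain ⟨g, hga, hg0, hgd, hg⟩ := linearizable_of_radial hX hO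
    refine ⟨g, hga, hg0, ?_, fun F hF => hg F (hana F hF) (hfix F hF) (hXF F hF)⟩
    rw [hgd]
    exact Function.bijective_id
end

section
/- Let n ≥ 1, let f ∈ ℂ[x₁,…,xₙ] be a homogeneous polynomial of degree r ≥ 0, and let s ∈ ℂ. Consider the n×n matrix with polynomial entries whose (i,j) entry is x_i·(∂f/∂x_j). Then det( −s·f·Iₙ + (x_i ∂f/∂x_j)_{i,j} ) = (−s)^{n−1} (r − s) fⁿ in ℂ[x₁,…,xₙ], where r is interpreted as the complex number r·1 in the factor (r − s). -/
open MvPolynomial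

/-- For `f` homogeneous of degree `r` in `n` variables and `s ∈ ℂ`:
`det(−s·f·Iₙ + (x_i ∂f/∂x_j)) = (−s)^{n−1}(r − s)·fⁿ`. -/
theorem det_dicritic_matrix (n : ℕ) (hn : 1 ≤ n) (r : ℕ)
    (f : MvPolynomial (Fin n) ℂ) (hf : f.IsHomogeneous r) (s : ℂ) :
    Matrix.det
      ((-(C s * f)) • (1 : Matrix (Fin n) (Fin n) (MvPolynomial (Fin n) ℂ)) +
        Matrix.of (fun i j => X i * pderiv j f))
      = C ((-s) ^ (n - 1) * ((r : ℂ) - s)) * f ^ n := by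
  have key := congrArg (Polynomial.eval (-(C s * f)))
    (Matrix.charpoly_vecMulVec (fun i : Fin n => -(X i : MvPolynomial (Fin n) ℂ))
      (fun j => pderiv j f))
  rw [Matrix.eval_charpoly] at key
  have hE : (fun i : Fin n => -(X i : MvPolynomial (Fin n) ℂ)) ⬝ᵥ (fun j => pderiv j f)
      = -(C (r : ℂ) * f) := by
    have h := hf.sum_X_mul_pderiv
    simp only [dotProduct, neg_mul, Finset.sum_neg_distrib, h]
    simp [nsmul_eq_mul]
  have hM : (-(C s * f)) • (1 : Matrix (Fin n) (Fin n) (MvPolynomial (Fin n) ℂ)) +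
        Matrix.of (fun i j => X i * pderiv j f) = Matrix.scalar (Fin n) (-(C s * f)) -
        Matrix.vecMulVec (fun i : Fin n => -(X i : MvPolynomial (Fin n) ℂ))
          (fun j => pderiv j f) := by
    ext1 i j
    simp [Matrix.vecMulVec_apply, Matrix.one_apply, Matrix.diagonal_apply]
    split_ifs <;> simp
  rw [hM, key, hE]
  obtain ⟨m, rfl⟩ : ∃ m, n = m + 1 := ⟨n - 1, by omega⟩
  simp only [Fintype.card_fin, Nat.add_sub_cancel, Polynomial.eval_sub, Polynomial.eval_smul,
    Polynomial.eval_pow, Polynomial.eval_X, smul_eq_mul, C_mul, C_pow, C_sub, C_neg]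
  rw [← neg_mul, mul_pow, mul_pow]
  ring
end

section
/- Let n ≥ 1, r ≥ 1, s ≥ 1, and let F, G : ℂⁿ → ℂⁿ be analytic at 0 with F(x) = x + F_{r+1}(x) + O(‖x‖^{r+2}) and G(x) = x + G_{s+1}(x) + O(‖x‖^{s+2}) as x → 0, where F_{r+1} and G_{s+1} are homogeneous polynomial maps of degrees r+1 and s+1. Suppose F is dicritic, i.e. F_{r+1}(x) = f(x)·x for some nonzero homogeneous polynomial f of degree r, suppose G_{s+1} ≠ 0, and suppose F(G(x)) = G(F(x)) for all x in some neighborhood of 0. Then r = s and G is also dicritic: there exists a homogeneous polynomial g of degree s with G_{s+1}(x) = g(x)·x. -/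
open Filter Topology Asymptotics

lemma cauchy_diff {E : Type*} [NormedAddCommGroup E] [NormedSpace ℂ E] [CompleteSpace E]
    (a : E → E) (m : ℕ) (ha : AnalyticAt ℂ a 0)
    (hO : a =O[𝓝 (0 : E)] fun x => ‖x‖ ^ (m + 1)) :
    ∃ C : ℝ, ∀ᶠ y in 𝓝 (0 : E), ∀ v : E, ‖v‖ < ‖y‖ →
      ‖a (y + v) - a y‖ ≤ C * ‖y‖ ^ m * ‖v‖ := by
  obtain ⟨C, hC⟩ := hO.bound
  obtain ⟨ε, hε, hball⟩ := Metric.eventually_nhds_iff_ball.1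
    (hC.and ha.eventually_analyticAt)
  have hbd : ∀ z : E, ‖z‖ < ε → ‖a z‖ ≤ |C| * ‖z‖ ^ (m + 1) := by
    intro z hz
    have h := (hball z (by simpa using hz)).1
    rw [norm_pow, norm_norm] at h
    exact h.trans (by gcongr; exact le_abs_self C)
  refine ⟨2 * |C| * 2 ^ (m + 1), ?_⟩
  filter_upwards [Metric.ball_mem_nhds (0 : E) (half_pos hε)] with y hy v hv
  have hy' : ‖y‖ < ε / 2 := by simpa using hy
  have hy0 : 0 < ‖y‖ := (norm_nonneg v).trans_lt hv
  have hin : ∀ z ∈ Metric.ball y ‖y‖, ‖z‖ < 2 * ‖y‖ := by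
    intro z hz
    rw [Metric.mem_ball, dist_eq_norm] at hz
    calc ‖z‖ = ‖(z - y) + y‖ := by simp
      _ ≤ ‖z - y‖ + ‖y‖ := norm_add_le _ _
      _ < 2 * ‖y‖ := by linarith
  have hb2 : ∀ z ∈ Metric.ball y ‖y‖, ‖a z‖ ≤ |C| * (2 * ‖y‖) ^ (m + 1) := by
    intro z hz
    have h1 := hin z hz
    refine (hbd z (by linarith)).trans ?_
    gcongr
  have hself : y ∈ Metric.ball y ‖y‖ := Metric.mem_ball_self hy0
  have key := Complex.dist_le_div_mul_dist_of_mapsTo_ball (f := a) (c := y) (z := y + v)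
    (R₁ := ‖y‖) (R₂ := 2 * (|C| * (2 * ‖y‖) ^ (m + 1))) ?_ ?_ ?_
  · rw [dist_eq_norm, dist_eq_norm, add_sub_cancel_left] at key
    refine key.trans (le_of_eq ?_)
    field_simp
    ring
  · intro z hz
    have h1 := hin z hz
    exact (hball z (by simp; linarith)).2.differentiableAt.differentiableWithinAt
  · intro z hz
    rw [Metric.mem_closedBall, dist_eq_norm]
    have h1 := hb2 z hz
    have h2 := hb2 y hself
    have h3 := norm_sub_le (a z) (a y)
    linarith
  · rw [Metric.mem_ball, dist_eq_norm, add_sub_cancel_left]; exact hv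

lemma key_limit {E : Type*} [NormedAddCommGroup E] [NormedSpace ℂ E] [CompleteSpace E]
    (P a B : E → E) (p s : ℕ) (hs : 1 ≤ s) (x w : E) (hx : x ≠ 0) (P' : E →L[ℂ] E)
    (hP : HasFDerivAt P P' x) (hhom : ∀ (t : ℂ) y, P (t • y) = t ^ (p + 1) • P y)
    (ha : AnalyticAt ℂ a 0) (hO : a =O[𝓝 (0 : E)] fun x => ‖x‖ ^ (p + 2))
    (hB : Tendsto (fun t : ℂ => (t ^ (s + 1))⁻¹ • B (t • x)) (𝓝[≠] 0) (𝓝 w)) :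
    Tendsto (fun t : ℂ => (t ^ (p + s + 1))⁻¹ •
      ((P (t • x + B (t • x)) + a (t • x + B (t • x))) - (P (t • x) + a (t • x))))
      (𝓝[≠] 0) (𝓝 (P' w)) := by
  set u : ℂ → E := fun t : ℂ => (t ^ (s + 1))⁻¹ • B (t • x) with hu
  have ht0 : Tendsto (fun t : ℂ => t) (𝓝[≠] 0) (𝓝 0) := tendsto_id.mono_left inf_le_left
  have hts : Tendsto (fun t : ℂ => t ^ s) (𝓝[≠] 0) (𝓝 0) := by
    have := ht0.pow s
    rwa [zero_pow (by omega)] at this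
  have hd0 : Tendsto (fun t : ℂ => t ^ s • u t) (𝓝[≠] 0) (𝓝 0) := by
    simpa using hts.smul hB
  have hne : ∀ᶠ t : ℂ in 𝓝[≠] 0, t ≠ 0 := self_mem_nhdsWithin
  have h1 : Tendsto (fun t : ℂ => (t ^ s)⁻¹ • (P (x + t ^ s • u t) - P x)) (𝓝[≠] 0)
      (𝓝 (P' w)) := by
    refine hP.hasFDerivWithinAt (s := Set.univ) |>.lim hd0 (by simp) ?_
    refine hB.congr' ?_
    filter_upwards [hne] with t ht
    rw [smul_smul, inv_mul_cancel₀ (pow_ne_zero _ ht), one_smul]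
  have hBu : ∀ t : ℂ, t ≠ 0 → B (t • x) = t ^ (s + 1) • u t := by
    intro t ht
    rw [hu, smul_smul, mul_inv_cancel₀ (pow_ne_zero _ ht), one_smul]
  have h2 : Tendsto (fun t : ℂ => (t ^ (p + s + 1))⁻¹ •
      (a (t • x + B (t • x)) - a (t • x))) (𝓝[≠] 0) (𝓝 0) := by
    obtain ⟨C, hC⟩ := cauchy_diff a (p + 1) ha hO
    have htx : Tendsto (fun t : ℂ => t • x) (𝓝[≠] 0) (𝓝 0) := by
      simpa using ht0.smul_const x
    have hlt : ∀ᶠ t : ℂ in 𝓝[≠] 0, ‖t ^ s • u t‖ < ‖x‖ := by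
      have := hd0.norm
      rw [norm_zero] at this
      exact this.eventually_lt_const (norm_pos_iff.2 hx)
    have hlim : Tendsto (fun t : ℂ => C * ‖x‖ ^ (p + 1) * (‖t‖ * ‖u t‖)) (𝓝[≠] 0) (𝓝 0) := by
      have := (ht0.norm.mul hB.norm).const_mul (C * ‖x‖ ^ (p + 1))
      simpa using this
    refine squeeze_zero_norm' ?_ hlim
    filter_upwards [hne, hlt, htx.eventually hC] with t ht hl hc
    have hB' := hBu t ht
    have htn : 0 < ‖t‖ := norm_pos_iff.2 ht
    have h3 := hc (B (t • x)) (by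
      rw [hB', pow_succ', mul_smul, norm_smul t (t ^ s • u t), norm_smul t x]
      exact mul_lt_mul_of_pos_left hl htn)
    rw [norm_smul, norm_inv, norm_pow, inv_mul_le_iff₀ (by positivity)]
    refine h3.trans (le_of_eq ?_)
    rw [hB', norm_smul, norm_smul, norm_pow]
    ring
  have h3 := h1.add h2
  rw [add_zero] at h3
  refine h3.congr' ?_
  filter_upwards [hne] with t ht
  have e : t • x + B (t • x) = t • (x + t ^ s • u t) := by
    rw [hBu t ht, smul_add, smul_smul t (t ^ s) (u t), pow_succ']
  have e2 : (t ^ s)⁻¹ = (t ^ (p + s + 1))⁻¹ * t ^ (p + 1) := by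
    field_simp
    ring
  have e3 : P (t • x + B (t • x)) = t ^ (p + 1) • P (x + t ^ s • u t) := by rw [e, hhom]
  rw [e3, hhom t x, e2, mul_smul, ← smul_add, smul_sub]
  congr 1
  abel

lemma limit_of_exp {E : Type*} [NormedAddCommGroup E] [NormedSpace ℂ E]
    (Q b : E → E) (s : ℕ) (x : E)
    (hhom : ∀ (t : ℂ) y, Q (t • y) = t ^ (s + 1) • Q y)
    (hO : b =O[𝓝 (0 : E)] fun x => ‖x‖ ^ (s + 2)) :
    Tendsto (fun t : ℂ => (t ^ (s + 1))⁻¹ • (Q (t • x) + b (t • x))) (𝓝[≠] 0) (𝓝 (Q x)) := by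
  have ht0 : Tendsto (fun t : ℂ => t) (𝓝[≠] 0) (𝓝 0) := tendsto_id.mono_left inf_le_left
  have hne : ∀ᶠ t : ℂ in 𝓝[≠] 0, t ≠ 0 := self_mem_nhdsWithin
  have htx : Tendsto (fun t : ℂ => t • x) (𝓝[≠] 0) (𝓝 0) := by
    simpa using ht0.smul_const x
  have h2 : Tendsto (fun t : ℂ => (t ^ (s + 1))⁻¹ • b (t • x)) (𝓝[≠] 0) (𝓝 0) := by
    obtain ⟨C, hC⟩ := hO.bound
    have hlim : Tendsto (fun t : ℂ => C * ‖x‖ ^ (s + 2) * ‖t‖) (𝓝[≠] 0) (𝓝 0) := by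
      have := ht0.norm.const_mul (C * ‖x‖ ^ (s + 2))
      simpa using this
    refine squeeze_zero_norm' ?_ hlim
    filter_upwards [hne, htx.eventually hC] with t ht hc
    have htn : 0 < ‖t‖ := norm_pos_iff.2 ht
    rw [norm_smul, norm_inv, norm_pow, inv_mul_le_iff₀ (by positivity)]
    refine hc.trans (le_of_eq ?_)
    rw [norm_pow, norm_norm, norm_smul]
    ring
  have h3 := (tendsto_const_nhds (x := Q x)).add h2
  rw [add_zero] at h3
  refine h3.congr' ?_
  filter_upwards [hne] with t ht
  rw [smul_add, hhom, smul_smul, inv_mul_cancel₀ (pow_ne_zero _ ht), one_smul]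

/-- The leading homogeneous parts of commuting maps commute as vector fields. -/
lemma bracket_eq {E : Type*} [NormedAddCommGroup E] [NormedSpace ℂ E] [CompleteSpace E]
    (F G P Q : E → E) (r s : ℕ) (hr : 1 ≤ r) (hs : 1 ≤ s)
    (hFa : AnalyticAt ℂ F 0) (hGa : AnalyticAt ℂ G 0)
    (hP : ∀ x, AnalyticAt ℂ P x) (hQ : ∀ x, AnalyticAt ℂ Q x)
    (hPh : ∀ (t : ℂ) y, P (t • y) = t ^ (r + 1) • P y)
    (hQh : ∀ (t : ℂ) y, Q (t • y) = t ^ (s + 1) • Q y)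
    (hFexp : (fun x => F x - x - P x) =O[𝓝 (0 : E)] fun x => ‖x‖ ^ (r + 2))
    (hGexp : (fun x => G x - x - Q x) =O[𝓝 (0 : E)] fun x => ‖x‖ ^ (s + 2))
    (hcomm : F ∘ G =ᶠ[𝓝 (0 : E)] G ∘ F) (x : E) (hx : x ≠ 0) :
    fderiv ℂ P x (Q x) = fderiv ℂ Q x (P x) := by
  have haF : AnalyticAt ℂ (fun x => F x - x - P x) 0 := (hFa.sub analyticAt_id).sub (hP 0)
  have haG : AnalyticAt ℂ (fun x => G x - x - Q x) 0 := (hGa.sub analyticAt_id).sub (hQ 0)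
  have lF := limit_of_exp P _ r x hPh hFexp
  have lG := limit_of_exp Q _ s x hQh hGexp
  have k1 := key_limit P _ (fun x => Q x + (G x - x - Q x)) r s hs x (Q x) hx _
    (hP x).differentiableAt.hasFDerivAt hPh haF hFexp lG
  have k2 := key_limit Q _ (fun x => P x + (F x - x - P x)) s r hr x (P x) hx _
    (hQ x).differentiableAt.hasFDerivAt hQh haG hGexp lF
  refine tendsto_nhds_unique k1 (k2.congr' ?_)
  have htx : Tendsto (fun t : ℂ => t • x) (𝓝[≠] 0) (𝓝 0) := by
    have ht0 : Tendsto (fun t : ℂ => t) (𝓝[≠] 0) (𝓝 0) := tendsto_id.mono_left inf_le_left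
    simpa using ht0.smul_const x
  filter_upwards [htx.eventually hcomm] with t ht
  simp only [Function.comp_apply] at ht
  rw [show s + r + 1 = r + s + 1 by ring]
  congr 1
  simp only [add_sub_cancel]
  rw [ht]
  abel

/-- Euler identity. -/
lemma euler_id {E V : Type*} [NormedAddCommGroup E] [NormedSpace ℂ E]
    [NormedAddCommGroup V] [NormedSpace ℂ V]
    (Q : E → V) (d : ℕ) (hQh : ∀ (t : ℂ) y, Q (t • y) = t ^ d • Q y) (x : E)
    (hQ : DifferentiableAt ℂ Q x) : fderiv ℂ Q x x = (d : ℂ) • Q x := by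
  have h1 : HasDerivAt (fun t : ℂ => t • x) x 1 := by
    simpa using (hasDerivAt_id (1 : ℂ)).smul_const x
  have h2 : HasDerivAt (fun t : ℂ => Q (t • x)) (fderiv ℂ Q x x) 1 := by
    have h0 : HasFDerivAt Q (fderiv ℂ Q x) ((1 : ℂ) • x) := by
      rw [one_smul]; exact hQ.hasFDerivAt
    exact h0.comp_hasDerivAt (1 : ℂ) h1
  have h3 : HasDerivAt (fun t : ℂ => Q (t • x)) ((d : ℂ) • Q x) 1 := by
    simp only [hQh]
    simpa using (hasDerivAt_pow d (1 : ℂ)).smul_const (Q x)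
  exact h2.unique h3

lemma eval_hom {n d : ℕ} (q : MvPolynomial (Fin n) ℂ) (hq : q.IsHomogeneous d) (t : ℂ)
    (y : Fin n → ℂ) : MvPolynomial.eval (t • y) q = t ^ d * MvPolynomial.eval y q := by
  rw [MvPolynomial.eval_eq, MvPolynomial.eval_eq, Finset.mul_sum]
  refine Finset.sum_congr rfl fun m hm => ?_
  have hd : ∑ i ∈ m.support, m i = d := by
    have := hq (MvPolynomial.mem_support_iff.1 hm)
    simpa [Finsupp.weight_apply, Finsupp.sum] using this
  simp only [Pi.smul_apply, smul_eq_mul, mul_pow, Finset.prod_mul_distrib,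
    Finset.prod_pow_eq_pow_sum, hd]
  ring

lemma eval_analytic {n : ℕ} (q : MvPolynomial (Fin n) ℂ) (x : Fin n → ℂ) :
    AnalyticAt ℂ (fun y : Fin n → ℂ => MvPolynomial.eval y q) x := by
  have := AnalyticAt.aeval_mvPolynomial (𝕜 := ℂ) (f := fun y : Fin n → ℂ => y) (z := x)
    (fun i => (ContinuousLinearMap.proj (R := ℂ) (φ := fun _ : Fin n => ℂ) i).analyticAt x) q
  simpa [MvPolynomial.coe_aeval_eq_eval] using this

/-- A homogeneous vector of polynomials proportional to `x` is a polynomial multiple of `x`. -/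
lemma exists_factor {n s : ℕ} (hn : 1 ≤ n) (q : Fin n → MvPolynomial (Fin n) ℂ)
    (hq : ∀ i, (q i).IsHomogeneous (s + 1))
    (h : ∀ i j, MvPolynomial.X j * q i = MvPolynomial.X i * q j) :
    ∃ g : MvPolynomial (Fin n) ℂ, g.IsHomogeneous s ∧ ∀ i, q i = MvPolynomial.X i * g := by
  have hX : ∀ i : Fin n, (MvPolynomial.X i : MvPolynomial (Fin n) ℂ) ≠ 0 :=
    fun i => MvPolynomial.X_ne_zero i
  let i0 : Fin n := ⟨0, hn⟩
  have hdvd : (MvPolynomial.X i0 : MvPolynomial (Fin n) ℂ) ∣ q i0 := by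
    by_cases hj : ∃ j, j ≠ i0
    · obtain ⟨j, hj⟩ := hj
      have h1 : (MvPolynomial.X i0 : MvPolynomial (Fin n) ℂ) ∣ MvPolynomial.X j * q i0 :=
        ⟨q j, h i0 j⟩
      rcases MvPolynomial.X_dvd_mul_iff.1 h1 with h2 | h2
      · exact absurd (MvPolynomial.X_dvd_X.1 h2).symm hj
      · exact h2
    · push Not at hj
      rw [(q i0).as_sum]
      refine Finset.dvd_sum fun m hm => MvPolynomial.X_dvd_monomial.2 (Or.inr fun h0 => ?_)
      have hm0 : m = 0 := by
        ext j
        rw [hj j, h0]; rfl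
      have := hq i0 (MvPolynomial.mem_support_iff.1 hm)
      rw [hm0] at this
      simp at this
  obtain ⟨g, hg⟩ := hdvd
  refine ⟨g, ?_, fun i => ?_⟩
  · intro m hm
    have h1 := hq i0 (d := Finsupp.single i0 1 + m) (by
      rw [hg, MvPolynomial.coeff_X_mul]; exact hm)
    rw [map_add, Finsupp.weight_single] at h1
    simp at h1
    simpa using (by omega : _ = s)
  · refine mul_left_cancel₀ (hX i0) ?_
    rw [h i i0, hg]; ring

/-- If a dicritic diffeomorphism `F(x) = x + f(x)·x + O(‖x‖^{r+2})` (with `f` a nonzero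
homogeneous polynomial of degree `r`) commutes with `G(x) = x + G_{s+1}(x) + O(‖x‖^{s+2})`
(with `G_{s+1} ≠ 0` homogeneous of degree `s+1`), then `r = s` and `G` is dicritic as well. -/
theorem commuting_with_dicritic (n r s : ℕ) (hn : 1 ≤ n) (hr : 1 ≤ r) (hs : 1 ≤ s)
    (F G Gs : (Fin n → ℂ) → (Fin n → ℂ))
    (f : MvPolynomial (Fin n) ℂ) (hf : f.IsHomogeneous r) (hfne : f ≠ 0)
    (hFa : AnalyticAt ℂ F 0) (hGa : AnalyticAt ℂ G 0)
    (hGs : IsHomogPolyMap n (s + 1) Gs) (hGsne : Gs ≠ 0)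
    (hFexp : (fun x => F x - x - MvPolynomial.eval x f • x)
        =O[𝓝 (0 : Fin n → ℂ)] fun x => ‖x‖ ^ (r + 2))
    (hGexp : (fun x => G x - x - Gs x) =O[𝓝 (0 : Fin n → ℂ)] fun x => ‖x‖ ^ (s + 2))
    (hcomm : F ∘ G =ᶠ[𝓝 (0 : Fin n → ℂ)] G ∘ F) :
    r = s ∧ ∃ g : MvPolynomial (Fin n) ℂ, g.IsHomogeneous s ∧
      ∀ x, Gs x = MvPolynomial.eval x g • x := by
  choose q hqh hqe using hGs
  let P : (Fin n → ℂ) → (Fin n → ℂ) := fun x => MvPolynomial.eval x f • x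
  have hPa : ∀ x, AnalyticAt ℂ P x := fun x => (eval_analytic f x).smul analyticAt_id
  have hGsa : ∀ x, AnalyticAt ℂ Gs x := by
    intro x
    rw [analyticAt_pi_iff]
    intro i
    simp only [hqe]
    exact eval_analytic (q i) x
  have hPh : ∀ (t : ℂ) y, P (t • y) = t ^ (r + 1) • P y := by
    intro t y
    simp only [P, eval_hom f hf, smul_smul]
    congr 1
    ring
  have hQh : ∀ (t : ℂ) y, Gs (t • y) = t ^ (s + 1) • Gs y := by
    intro t y
    ext i
    simp only [hqe, Pi.smul_apply, smul_eq_mul, eval_hom (q i) (hqh i)]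
  -- The fundamental identity.
  have hmain : ∀ x, x ≠ 0 → fderiv ℂ (fun y => MvPolynomial.eval y f) x (Gs x) • x
      = ((s : ℂ) * MvPolynomial.eval x f) • Gs x := by
    intro x hx
    have hb := bracket_eq F G P Gs r s hr hs hFa hGa hPa hGsa hPh hQh hFexp hGexp hcomm x hx
    have hE := euler_id Gs (s + 1) hQh x (hGsa x).differentiableAt
    have hPd : HasFDerivAt P _ x :=
      (eval_analytic f x).differentiableAt.hasFDerivAt.smul (hasFDerivAt_id x)
    rw [hPd.fderiv] at hb
    simp only [P, map_smul, hE] at hb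
    simp at hb
    have : ∀ a b c : Fin n → ℂ, a + b = c → b = c - a := by
      intro a b c h; rw [← h]; abel
    rw [this _ _ _ hb]
    module
  have hsne : (s : ℂ) ≠ 0 := by exact_mod_cast (by omega : s ≠ 0)
  have hX : ∀ i j, MvPolynomial.X j * q i = MvPolynomial.X i * q j := by
    intro i j
    refine mul_left_cancel₀ hfne (MvPolynomial.funext fun x => ?_)
    simp only [map_mul, MvPolynomial.eval_X, ← hqe]
    by_cases hx : x = 0
    · simp [hx]
    · have h := hmain x hx
      have hi := congrFun h i
      have hj := congrFun h j
      simp only [Pi.smul_apply, smul_eq_mul] at hi hj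
      refine mul_left_cancel₀ hsne ?_
      linear_combination x i * hj - x j * hi
  obtain ⟨g, hgh, hg⟩ := exists_factor hn q hqh hX
  have hGg : ∀ x, Gs x = MvPolynomial.eval x g • x := by
    intro x
    ext i
    simp [hqe, hg, mul_comm]
  refine ⟨?_, g, hgh, hGg⟩
  have hgne : g ≠ 0 := by
    rintro rfl
    apply hGsne
    ext x
    simp [hGg]
  let i0 : Fin n := ⟨0, hn⟩
  have hprod : f * g * MvPolynomial.X i0 ≠ 0 :=
    mul_ne_zero (mul_ne_zero hfne hgne) (MvPolynomial.X_ne_zero i0)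
  obtain ⟨x, hx⟩ : ∃ x, MvPolynomial.eval x (f * g * MvPolynomial.X i0) ≠ 0 := by
    by_contra! hcon
    exact hprod (MvPolynomial.funext fun x => by simpa using hcon x)
  have hx0 : x ≠ 0 := by
    rintro rfl
    simp at hx
  have h := hmain x hx0
  have hE := euler_id (fun y => MvPolynomial.eval y f) r
    (fun t y => by simpa using eval_hom f hf t y) x (eval_analytic f x).differentiableAt
  rw [hGg, map_smul, hE] at h
  have h0 := congrFun h i0
  simp only [Pi.smul_apply, smul_eq_mul] at h0
  simp only [map_mul, MvPolynomial.eval_X] at hx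
  have : (r : ℂ) = s := by
    refine mul_right_cancel₀ hx ?_
    linear_combination h0
  exact_mod_cast this
end

section
/- Let k ≥ 1 and let F : ℂ² → ℂ² be analytic at 0 with F(x,y) = (x + p_{k+1}(x,y) + O(‖(x,y)‖^{k+2}), y + q_{k+1}(x,y) + O(‖(x,y)‖^{k+2})) as (x,y) → 0, where p_{k+1}, q_{k+1} are homogeneous polynomials of degree k+1. Let (x₀,y₀) be a point such that all forward iterates (xₙ,yₙ) = F^{[n]}(x₀,y₀) are defined, xₙ ≠ 0 for all n, (xₙ,yₙ) → (0,0) as n → ∞, and yₙ/xₙ → v for some v ∈ ℂ. Then lim_{n→∞} 1/(n·xₙᵏ) = −k·p_{k+1}(1,v). -/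
open Filter Topology Asymptotics

lemma hom_eval_aux {m : ℕ} (p : MvPolynomial (Fin 2) ℂ) (hp : p.IsHomogeneous m) (x s : ℂ) :
    MvPolynomial.eval ![x, x * s] p = x ^ m * MvPolynomial.eval ![1, s] p := by
  rw [MvPolynomial.eval_eq', MvPolynomial.eval_eq', Finset.mul_sum]
  refine Finset.sum_congr rfl fun d hd => ?_
  have h := hp (MvPolynomial.mem_support_iff.mp hd)
  have h2 : d 0 + d 1 = m := by
    rw [← h, Finsupp.weight_apply, Finsupp.sum_fintype _ _ (by simp)]
    simp [Fin.sum_univ_two]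
  simp only [Fin.prod_univ_two, Matrix.cons_val_zero, Matrix.cons_val_one]
  rw [← h2]
  ring

/-- If `F(x,y) = (x + p_{k+1}(x,y), y + q_{k+1}(x,y)) + O(‖(x,y)‖^{k+2})` and the orbit
`(xₙ,yₙ) = F^[n](x₀,y₀)` tends to `0` with `xₙ ≠ 0` and `yₙ/xₙ → v`, then
`1/(n·xₙᵏ) → −k·p_{k+1}(1,v)`. -/
theorem orbit_asymptotics (k : ℕ) (hk : 1 ≤ k)
    (F : ℂ × ℂ → ℂ × ℂ) (p q : MvPolynomial (Fin 2) ℂ)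
    (hp : p.IsHomogeneous (k + 1)) (hq : q.IsHomogeneous (k + 1))
    (hFa : AnalyticAt ℂ F 0)
    (hexp : (fun z => F z - (z.1 + MvPolynomial.eval ![z.1, z.2] p,
                             z.2 + MvPolynomial.eval ![z.1, z.2] q))
        =O[𝓝 (0 : ℂ × ℂ)] fun z => ‖z‖ ^ (k + 2))
    (z₀ : ℂ × ℂ) (v : ℂ)
    (hx : ∀ n : ℕ, (F^[n] z₀).1 ≠ 0)
    (hlim : Tendsto (fun n : ℕ => F^[n] z₀) atTop (𝓝 0))
    (hv : Tendsto (fun n : ℕ => (F^[n] z₀).2 / (F^[n] z₀).1) atTop (𝓝 v)) :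
    Tendsto (fun n : ℕ => 1 / ((n : ℂ) * (F^[n] z₀).1 ^ k)) atTop
      (𝓝 (-(k : ℂ) * MvPolynomial.eval ![1, v] p)) := by
  set x : ℕ → ℂ := fun n => (F^[n] z₀).1 with hxdef
  set y : ℕ → ℂ := fun n => (F^[n] z₀).2 with hydef
  have hx0 : ∀ n, x n ≠ 0 := hx
  have hxl : Tendsto x atTop (𝓝 0) := (continuous_fst.tendsto (0 : ℂ × ℂ)).comp hlim
  have hv' : Tendsto (fun n => y n / x n) atTop (𝓝 v) := hv
  set r : ℕ → ℂ := fun n => x (n + 1) - (x n + MvPolynomial.eval ![x n, y n] p) with hr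
  -- the orbit is controlled by its first coordinate
  have hyx : y =O[atTop] x := by
    have h1 : (fun n => y n / x n) =O[atTop] (fun _ => (1 : ℂ)) := hv'.isBigO_one ℂ
    have h2 := h1.mul (isBigO_refl x atTop)
    refine h2.congr (fun n => ?_) (fun n => ?_)
    · exact div_mul_cancel₀ _ (hx0 n)
    · simp
  have hzx : (fun n => F^[n] z₀) =O[atTop] x :=
    ((isBigO_refl x atTop).prod_left hyx)
  have hrO : r =O[atTop] fun n => x n ^ (k + 2) := by
    have h1 := (isBigO_fst_prod'.trans (hexp.comp_tendsto hlim))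
    have h2 : (fun n => ‖F^[n] z₀‖ ^ (k + 2)) =O[atTop] fun n => x n ^ (k + 2) :=
      (hzx.norm_left).pow (k + 2)
    refine (h1.trans h2).congr_left fun n => ?_
    simp [hr, hxdef, hydef, Function.iterate_succ_apply']
  have hr0 : Tendsto (fun n => r n / x n ^ (k + 1)) atTop (𝓝 0) := by
    have h1 : (fun n => r n * (x n ^ (k + 1))⁻¹) =O[atTop]
        fun n => x n ^ (k + 2) * (x n ^ (k + 1))⁻¹ := hrO.mul (isBigO_refl _ _)
    refine h1.trans_tendsto (hxl.congr fun n => ?_)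
    have := hx0 n
    field_simp
    ring
  set w : ℕ → ℂ := fun n => MvPolynomial.eval ![1, y n / x n] p + r n / x n ^ (k + 1) with hw
  have hwl : Tendsto w atTop (𝓝 (MvPolynomial.eval ![1, v] p)) := by
    have hc : Continuous fun s : ℂ => MvPolynomial.eval ![1, s] p := by
      refine (MvPolynomial.continuous_eval p).comp ?_
      refine continuous_pi fun i => ?_
      fin_cases i
      · exact continuous_const
      · exact continuous_id
    simpa using ((hc.tendsto v).comp hv').add hr0
  set t : ℕ → ℂ := fun n => 1 + x n ^ k * w n with ht
  have htl : Tendsto t atTop (𝓝 1) := by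
    have := ((hxl.pow k).mul hwl).const_add 1
    simpa [zero_pow (by omega : k ≠ 0)] using this
  have hstep : ∀ n, x (n + 1) = x n * t n := by
    intro n
    have hn := hx0 n
    have h1 := hom_eval_aux p hp (x n) (y n / x n)
    rw [mul_div_cancel₀ _ hn] at h1
    have h2 : x (n + 1) = r n + (x n + MvPolynomial.eval ![x n, y n] p) := by simp [hr]
    rw [h2, h1]
    simp only [ht, hw]
    field_simp
    ring
  have ht0 : ∀ n, t n ≠ 0 := fun n h => hx0 (n + 1) (by rw [hstep, h, mul_zero])
  set u : ℕ → ℂ := fun n => 1 / x n ^ k with hu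
  have hdiff : ∀ n, u (n + 1) - u n = -(w n * ∑ i ∈ Finset.range k, t n ^ i) / t n ^ k := by
    intro n
    have hn := hx0 n
    have hn2 := ht0 n
    have hg := geom_sum_mul (t n) k
    have h3 : t n - 1 = x n ^ k * w n := by simp [ht]
    rw [h3] at hg
    simp only [hu]
    rw [hstep, mul_pow]
    generalize (∑ i ∈ Finset.range k, t n ^ i) = S at *
    field_simp
    linear_combination hg
  have hdl : Tendsto (fun n => u (n + 1) - u n) atTop
      (𝓝 (-(k : ℂ) * MvPolynomial.eval ![1, v] p)) := by
    have hS : Tendsto (fun n => ∑ i ∈ Finset.range k, t n ^ i) atTop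
        (𝓝 (∑ i ∈ Finset.range k, (1 : ℂ) ^ i)) :=
      tendsto_finsetSum _ fun i _ => htl.pow i
    have h := ((hwl.mul hS).neg).div (htl.pow k) (by simp)
    have h' := h.congr (fun n => (hdiff n).symm)
    convert h' using 2
    simp
    ring
  have hces := hdl.cesaro_smul
  have hinv : Tendsto (fun n : ℕ => ((n : ℂ))⁻¹ * u 0) atTop (𝓝 0) := by
    simpa using (tendsto_inv_atTop_nhds_zero_nat (𝕜 := ℂ)).mul_const (u 0)
  have hfin := hces.add hinv
  rw [add_zero] at hfin
  refine hfin.congr fun n => ?_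
  rw [Finset.sum_range_sub, Complex.real_smul]
  push_cast
  change _ = 1 / ((n : ℂ) * x n ^ k)
  rw [one_div, mul_inv]
  simp only [hu, one_div]
  ring
end

section
/- Let k ≥ 1 and let F : ℂ² → ℂ² be analytic at 0 with F(x,y) = (x + p_{k+1}(x,y) + O(‖(x,y)‖^{k+2}), y + q_{k+1}(x,y) + O(‖(x,y)‖^{k+2})) as (x,y) → 0, where p_{k+1}, q_{k+1} are homogeneous polynomials of degree k+1. Let (x₀,y₀) be a point such that all forward iterates (xₙ,yₙ) = F^{[n]}(x₀,y₀) are defined, xₙ ≠ 0 and yₙ ≠ 0 for all n, (xₙ,yₙ) → (0,0) as n → ∞, and yₙ/xₙ → v for some v ∈ ℂ with v ≠ 0. Then r(v) = 0, where r(v) := q_{k+1}(1,v) − v·p_{k+1}(1,v); that is, the limit direction is a characteristic direction of F. -/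
open Filter Topology Asymptotics

/-- Scaling of a homogeneous polynomial in two variables. -/
lemma aux_hom_eval (m : ℕ) (p : MvPolynomial (Fin 2) ℂ) (hp : p.IsHomogeneous m)
    (x y : ℂ) (hx : x ≠ 0) :
    MvPolynomial.eval ![x, y] p = x ^ m * MvPolynomial.eval ![1, y / x] p := by
  rw [MvPolynomial.eval_eq', MvPolynomial.eval_eq', Finset.mul_sum]
  refine Finset.sum_congr rfl fun d hd => ?_
  have h : d 0 + d 1 = m := by
    have := hp (MvPolynomial.mem_support_iff.mp hd)
    rw [← this, Finsupp.weight_apply, Finsupp.sum_fintype _ _ (by simp)]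
    simp
  simp only [Fin.prod_univ_two, Matrix.cons_val_zero, Matrix.cons_val_one, one_pow, one_mul]
  rw [← h, pow_add, div_pow]
  field_simp

/-- The summation-by-parts argument. -/
lemma aux_cesaro (w u d : ℕ → ℂ) (v r : ℂ)
    (hd : d =O[atTop] (fun _ => (1 : ℝ))) (hw : ∀ n, w (n + 1) - w n = d n)
    (hu : Tendsto u atTop (𝓝 v))
    (hr : Tendsto (fun n => w n * (u (n + 1) - u n)) atTop (𝓝 r)) : r = 0 := by
  have hu0 : Tendsto (fun n => u n - v) atTop (𝓝 0) := tendsto_sub_nhds_zero_iff.2 hu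
  have hu1 : Tendsto (fun n => u (n + 1) - v) atTop (𝓝 0) :=
    hu0.comp (tendsto_add_atTop_nat 1)
  have hdu : Tendsto (fun n => d n * (u (n + 1) - v)) atTop (𝓝 0) := by
    rw [← isLittleO_one_iff ℝ] at hu1 ⊢
    simpa using hd.mul_isLittleO hu1
  have hs : Tendsto (fun n => w (n + 1) * (u (n + 1) - v) - w n * (u n - v)) atTop (𝓝 r) := by
    have := hr.add hdu
    rw [add_zero] at this
    refine this.congr fun n => ?_
    rw [← hw n]; ring
  have h1 := hs.cesaro_smul
  obtain ⟨M, hM⟩ := isBigO_one_nat_atTop_iff.1 hd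
  have hwn : ∀ n : ℕ, ‖w n - w 0‖ ≤ M * n := by
    intro n
    induction n with
    | zero => simp
    | succ n ih =>
      have : w (n + 1) - w 0 = d n + (w n - w 0) := by rw [← hw n]; ring
      rw [this]
      push_cast
      linarith [norm_add_le (d n) (w n - w 0), hM n]
  have hwO : (fun n : ℕ => (n⁻¹ : ℝ) • (w n - w 0)) =O[atTop] (fun _ => (1 : ℝ)) := by
    refine IsBigO.of_bound M ?_
    filter_upwards [eventually_gt_atTop 0] with n hn
    have hn' : (0 : ℝ) < n := by exact_mod_cast hn
    rw [norm_smul, norm_inv, Real.norm_natCast, norm_one, mul_one, inv_mul_le_iff₀ hn']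
    linarith [hwn n]
  have h2 : Tendsto (fun n : ℕ => ((n⁻¹ : ℝ) • (w n - w 0)) * (u n - v)) atTop (𝓝 0) := by
    rw [← isLittleO_one_iff ℝ] at hu0 ⊢
    simpa using hwO.mul_isLittleO hu0
  have hinv : Tendsto (fun n : ℕ => (n⁻¹ : ℝ)) atTop (𝓝 0) :=
    tendsto_inv_atTop_nhds_zero_nat
  have h3 : Tendsto (fun n : ℕ => (n⁻¹ : ℝ) • (w 0 * (u n - v) - w 0 * (u 0 - v)))
      atTop (𝓝 0) := by
    have := hinv.smul ((hu0.const_mul (w 0)).sub_const (w 0 * (u 0 - v)))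
    simpa using this
  have h4 := h2.add h3
  rw [add_zero] at h4
  refine tendsto_nhds_unique h1 (h4.congr fun n => ?_)
  rw [Finset.sum_range_sub (fun n => w n * (u n - v)), smul_mul_assoc, ← smul_add]
  congr 1
  ring

/-- Increments of `x ^ (-k)` along the orbit are bounded. -/
lemma aux_incr (k : ℕ) (x a : ℕ → ℂ) (A : ℂ) (hx : ∀ n, x n ≠ 0)
    (ha : Tendsto a atTop (𝓝 A)) (ht : Tendsto (fun n => x n ^ k * a n) atTop (𝓝 0))
    (hrec : ∀ n, x (n + 1) = x n * (1 + x n ^ k * a n)) :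
    (fun n => (x (n + 1) ^ k)⁻¹ - (x n ^ k)⁻¹) =O[atTop] (fun _ => (1 : ℝ)) := by
  have hdiff : DifferentiableAt ℂ (fun t : ℂ => ((1 + t) ^ k)⁻¹) 0 := by
    apply DifferentiableAt.inv
    · fun_prop
    · simp
  have hO := hdiff.isBigO_sub.comp_tendsto ht
  have h1 : (fun n => (x n ^ k)⁻¹) =O[atTop] (fun n => (x n ^ k)⁻¹) := isBigO_refl _ _
  have h2 := h1.mul hO
  have h3 : a =O[atTop] (fun _ => (1 : ℝ)) := ha.isBigO_one ℝ
  refine (h2.congr ?_ ?_).trans h3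
  · intro n
    simp only [Function.comp_apply, add_zero, one_pow, inv_one]
    rw [hrec n, mul_pow, mul_inv]
    ring
  · intro n
    have := pow_ne_zero k (hx n)
    simp only [Function.comp_apply, sub_zero]
    field_simp

/-- If `F(x,y) = (x + p_{k+1}(x,y), y + q_{k+1}(x,y)) + O(‖(x,y)‖^{k+2})` and the orbit
`(xₙ,yₙ) = F^[n](x₀,y₀)` tends to `0` with `xₙ, yₙ ≠ 0` and `yₙ/xₙ → v ≠ 0`, then the
limit direction is characteristic: `r(v) = q_{k+1}(1,v) − v·p_{k+1}(1,v) = 0`. -/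
theorem limit_direction_is_characteristic (k : ℕ) (hk : 1 ≤ k)
    (F : ℂ × ℂ → ℂ × ℂ) (p q : MvPolynomial (Fin 2) ℂ)
    (hp : p.IsHomogeneous (k + 1)) (hq : q.IsHomogeneous (k + 1))
    (hFa : AnalyticAt ℂ F 0)
    (hexp : (fun z => F z - (z.1 + MvPolynomial.eval ![z.1, z.2] p,
                             z.2 + MvPolynomial.eval ![z.1, z.2] q))
        =O[𝓝 (0 : ℂ × ℂ)] fun z => ‖z‖ ^ (k + 2))
    (z₀ : ℂ × ℂ) (v : ℂ) (hvne : v ≠ 0)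
    (hx : ∀ n : ℕ, (F^[n] z₀).1 ≠ 0)
    (hy : ∀ n : ℕ, (F^[n] z₀).2 ≠ 0)
    (hlim : Tendsto (fun n : ℕ => F^[n] z₀) atTop (𝓝 0))
    (hv : Tendsto (fun n : ℕ => (F^[n] z₀).2 / (F^[n] z₀).1) atTop (𝓝 v)) :
    MvPolynomial.eval ![1, v] q - v * MvPolynomial.eval ![1, v] p = 0 := by
  set x : ℕ → ℂ := fun n => (F^[n] z₀).1 with hxdef
  set y : ℕ → ℂ := fun n => (F^[n] z₀).2 with hydef
  have hx0 : Tendsto x atTop (𝓝 0) := (continuous_fst.tendsto (0 : ℂ × ℂ)).comp hlim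
  have hzx : (fun n => F^[n] z₀) =O[atTop] x := by
    have hyx : y =O[atTop] x := by
      have h := (hv.isBigO_one ℂ).mul (isBigO_refl x atTop)
      refine h.congr (fun n => ?_) (fun n => one_mul _)
      exact div_mul_cancel₀ _ (hx n)
    exact (isBigO_refl x atTop).prod_left hyx
  have herr := hexp.comp_tendsto hlim
  have hpow : (fun n => ‖F^[n] z₀‖ ^ (k + 2)) =O[atTop] fun n => x n ^ (k + 2) :=
    hzx.norm_left.pow (k + 2)
  have hlit : (fun n => x n ^ (k + 2)) =o[atTop] fun n => x n ^ (k + 1) := by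
    have h := ((isLittleO_one_iff ℂ).2 hx0).mul_isBigO (isBigO_refl (fun n => x n ^ (k + 1)) atTop)
    exact h.congr (fun n => by ring) (fun n => one_mul _)
  have herr2 := (herr.trans hpow).trans_isLittleO hlit
  have he1 := (isBigO_fst_prod.trans_isLittleO herr2).tendsto_div_nhds_zero
  have he2 := (isBigO_snd_prod.trans_isLittleO herr2).tendsto_div_nhds_zero
  have hpoly : ∀ P : MvPolynomial (Fin 2) ℂ,
      Tendsto (fun n => MvPolynomial.eval ![1, y n / x n] P) atTop
        (𝓝 (MvPolynomial.eval ![1, v] P)) := by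
    intro P
    have hc : Continuous fun s : ℂ => MvPolynomial.eval ![1, s] P :=
      (MvPolynomial.continuous_eval P).comp (by fun_prop)
    exact (hc.tendsto v).comp hv
  set a : ℕ → ℂ := fun n => (x (n + 1) - x n) / x n ^ (k + 1) with hadef
  set b : ℕ → ℂ := fun n => (y (n + 1) - y n) / x n ^ (k + 1) with hbdef
  have ha : Tendsto a atTop (𝓝 (MvPolynomial.eval ![1, v] p)) := by
    have h := he1.add (hpoly p)
    rw [zero_add] at h
    refine h.congr fun n => ?_
    have hne := pow_ne_zero (k + 1) (hx n)
    have hh := aux_hom_eval (k + 1) p hp (x n) (y n) (hx n)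
    simp only [hadef, hxdef, hydef, Function.comp_apply, Function.iterate_succ_apply',
      Prod.fst_sub] at hh hne ⊢
    rw [hh]
    field_simp
    ring
  have hb : Tendsto b atTop (𝓝 (MvPolynomial.eval ![1, v] q)) := by
    have h := he2.add (hpoly q)
    rw [zero_add] at h
    refine h.congr fun n => ?_
    have hne := pow_ne_zero (k + 1) (hx n)
    have hh := aux_hom_eval (k + 1) q hq (x n) (y n) (hx n)
    simp only [hbdef, hxdef, hydef, Function.comp_apply, Function.iterate_succ_apply',
      Prod.snd_sub] at hh hne ⊢
    rw [hh]
    field_simp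
    ring
  have hxn : ∀ n, x n ≠ 0 := hx
  have ht : Tendsto (fun n => x n ^ k * a n) atTop (𝓝 0) := by
    have h := (hx0.pow k).mul ha
    rwa [zero_pow (by omega), zero_mul] at h
  have hrec : ∀ n, x (n + 1) = x n * (1 + x n ^ k * a n) := by
    intro n
    have := hxn n
    simp only [hadef]
    field_simp
    ring
  have hrecy : ∀ n, y (n + 1) = y n + x n ^ (k + 1) * b n := by
    intro n
    have := hxn n
    simp only [hbdef]
    field_simp
    ring
  have hinc := aux_incr k x a _ hxn ha ht hrec
  refine aux_cesaro (fun n => (x n ^ k)⁻¹) (fun n => y n / x n) _ v _ hinc (fun n => rfl) hv ?_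
  have hfin : Tendsto (fun n => (b n - y n / x n * a n) / (1 + x n ^ k * a n)) atTop
      (𝓝 ((MvPolynomial.eval ![1, v] q - v * MvPolynomial.eval ![1, v] p) / (1 + 0))) :=
    (hb.sub (hv.mul ha)).div (ht.const_add 1) (by simp)
  rw [add_zero, div_one] at hfin
  refine hfin.congr fun n => ?_
  have h0 := hxn n
  have h1 : 1 + x n ^ k * a n ≠ 0 := fun h => hxn (n + 1) (by rw [hrec n, h, mul_zero])
  rw [hrec n, hrecy n]
  obtain ⟨c, hc⟩ : ∃ c, c = 1 + x n ^ k * a n := ⟨_, rfl⟩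
  rw [← hc] at h1 ⊢
  clear_value a b x y
  field_simp
  rw [hc]
  ring
end

section
/- Let k ≥ 1 and let F : ℂ² → ℂ² be a dicritic diffeomorphism analytic at 0: F(x,y) = (x + x·p_k(x,y) + O(‖(x,y)‖^{k+2}), y + y·p_k(x,y) + O(‖(x,y)‖^{k+2})) as (x,y) → 0, where p_k is a homogeneous polynomial of degree k, and F has a local analytic inverse F^{-1} fixing 0. Then for every v₀ ∈ ℂ with p_k(1,v₀) ≠ 0 there exist r > 0 and open sets V⁺, V⁻ ⊆ { (x,y) ∈ ℂ² : x ≠ 0, |y/x − v₀| < r } such that: (1) for every v ∈ ℂ with |v − v₀| < r/2 and every ε > 0 there exists x with 0 < |x| < ε and (x, v·x) ∈ V⁺, and likewise for V⁻ (so the closures of V⁺ and V⁻ contain the origin together with all directions near v₀); (2) for every (x,y) ∈ V⁺ all forward iterates (xₙ,yₙ) = F^{[n]}(x,y) are defined, (xₙ,yₙ) → (0,0), and the sequence yₙ/xₙ converges in ℂ; (3) for every (x,y) ∈ V⁻ all backward iterates (F^{-1})^{[n]}(x,y) are defined, converge to (0,0), and their coordinate ratios converge in ℂ. -/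
open Filter Topology Asymptotics

lemma petal_dyn (k : ℕ) (hk : 1 ≤ k) (G : ℂ × ℂ → ℂ × ℂ) (c v₀ : ℂ) (hc : c ≠ 0)
    (ρ r C : ℝ) (hρ : 0 < ρ) (hr : 0 < r) (hC : 0 ≤ C)
    (hstep : ∀ x v : ℂ, x ≠ 0 → ‖x‖ < ρ → ‖v - v₀‖ < r →
      (G (x, v * x)).1 ≠ 0 ∧ ‖(G (x, v * x)).2 / (G (x, v * x)).1 - v‖ ≤ C * ‖x‖ ^ (k + 1) ∧
      ‖c / (G (x, v * x)).1 ^ k - c / x ^ k - 1‖ ≤ 1 / 2) :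
    ∃ V : Set (ℂ × ℂ), IsOpen V ∧ V ⊆ {z : ℂ × ℂ | z.1 ≠ 0 ∧ ‖z.2 / z.1 - v₀‖ < r} ∧
      (∀ v : ℂ, ‖v - v₀‖ < r / 2 → ∀ ε > (0 : ℝ),
          (∃ x : ℂ, 0 < ‖x‖ ∧ ‖x‖ < ε ∧ (x, v * x) ∈ V)) ∧
      (∀ z ∈ V, (∀ n : ℕ, (G^[n] z).1 ≠ 0) ∧
          Tendsto (fun n : ℕ => G^[n] z) atTop (𝓝 0) ∧
          ∃ w : ℂ, Tendsto (fun n : ℕ => (G^[n] z).2 / (G^[n] z).1) atTop (𝓝 w)) := by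
  have hk0 : k ≠ 0 := by omega
  have hkR : (0:ℝ) < k := by positivity
  have hcn : 0 < ‖c‖ := norm_pos_iff.mpr hc
  set q : ℝ := 1 + 1 / (k : ℝ) with hq
  have hq1 : 1 < q := by rw [hq]; have : 0 < 1 / (k:ℝ) := by positivity
                         linarith
  set b : ℕ → ℝ := fun m => C * ((2 * ‖c‖) ^ q * (1 / (m : ℝ) ^ q)) with hb
  have hbs : Summable b :=
    ((Real.summable_one_div_nat_rpow.mpr hq1).mul_left _).mul_left _
  have hb0 : ∀ m, 0 ≤ b m := fun m => by simp only [hb]; positivity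
  set T : ℕ → ℝ := fun m => ∑' j, b (j + m) with hT
  have hTs : ∀ m, T m = b m + T (m + 1) := by
    intro m
    have h := ((summable_nat_add_iff m).mpr hbs).tsum_eq_zero_add
    simp only [hT]
    rw [h]
    simp only [zero_add]
    congr 1
    refine tsum_congr fun j => ?_
    congr 1; omega
  have hT0 : ∀ m, 0 ≤ T m := fun m => tsum_nonneg fun j => hb0 _
  have hTt : Tendsto T atTop (𝓝 0) := tendsto_sum_nat_add b
  -- bound on x
  have hx : ∀ (m : ℕ) (x : ℂ), 1 ≤ m → x ≠ 0 → (m : ℝ) / 2 < (c / x ^ k).re →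
      ‖x‖ ^ k < 2 * ‖c‖ / m := by
    intro m x hm hx0 h
    have hm' : (0:ℝ) < m := by positivity
    have hxp : 0 < ‖x‖ ^ k := pow_pos (norm_pos_iff.mpr hx0) k
    have h1 : (m:ℝ) / 2 < ‖c‖ / ‖x‖ ^ k := by
      have := h.trans_le (Complex.re_le_norm _)
      rwa [norm_div, norm_pow] at this
    rw [lt_div_iff₀ hxp] at h1
    rw [lt_div_iff₀ hm']
    linarith
  have hxb : ∀ (m : ℕ) (x : ℂ), 1 ≤ m → x ≠ 0 → (m : ℝ) / 2 < (c / x ^ k).re →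
      C * ‖x‖ ^ (k + 1) ≤ b m := by
    intro m x hm hx0 h
    have hm' : (0:ℝ) < m := by positivity
    have h1 := hx m x hm hx0 h
    have h2 : ‖x‖ ^ (k + 1) = (‖x‖ ^ k) ^ q := by
      rw [← Real.rpow_natCast, ← Real.rpow_natCast, ← Real.rpow_mul (norm_nonneg _)]
      congr 1
      rw [hq]; push_cast; field_simp
    simp only [hb]
    refine mul_le_mul_of_nonneg_left ?_ hC
    rw [h2]
    refine (Real.rpow_le_rpow (by positivity) h1.le (by linarith)).trans ?_
    rw [Real.div_rpow (by positivity) hm'.le]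
    apply le_of_eq; ring
  obtain ⟨N, hN1, hNT, hNρ⟩ : ∃ N : ℕ, 1 ≤ N ∧ T N ≤ r / 2 ∧ 2 * ‖c‖ / N < ρ ^ k := by
    have e1 : ∀ᶠ n : ℕ in atTop, T n < r / 2 := hTt.eventually (gt_mem_nhds (by positivity))
    have e2 : ∀ᶠ n : ℕ in atTop, 2 * ‖c‖ / n < ρ ^ k :=
      (tendsto_const_div_atTop_nhds_zero_nat (2 * ‖c‖)).eventually (gt_mem_nhds (by positivity))
    obtain ⟨N, h1, h2, h3⟩ := ((eventually_ge_atTop 1).and (e1.and e2)).exists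
    exact ⟨N, h1, h2.le, h3⟩
  set S : ℕ → Set (ℂ × ℂ) := fun m => {z | z.1 ≠ 0 ∧ (m : ℝ) / 2 < (c / z.1 ^ k).re ∧
    ‖z.2 / z.1 - v₀‖ < r - T m} with hS
  have hmap : ∀ m, N ≤ m → ∀ z ∈ S m, G z ∈ S (m + 1) ∧
      ‖(G z).2 / (G z).1 - z.2 / z.1‖ ≤ b m := by
    rintro m hm ⟨x, y⟩ ⟨h0, h1, h2⟩
    simp only at h0 h1 h2
    have hm1 : 1 ≤ m := hN1.trans hm
    have hxr : ‖x‖ < ρ := by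
      refine lt_of_pow_lt_pow_left₀ k hρ.le ((hx m x hm1 h0 h1).trans (lt_of_le_of_lt ?_ hNρ))
      gcongr
    have hy : (y / x) * x = y := div_mul_cancel₀ _ h0
    have := hstep x (y / x) h0 hxr (h2.trans_le (by linarith [hT0 m]))
    rw [hy] at this
    obtain ⟨g0, g1, g2⟩ := this
    have g3 := g1.trans (hxb m x hm1 h0 h1)
    refine ⟨⟨g0, ?_, ?_⟩, g3⟩
    · have := (Complex.abs_re_le_norm _).trans g2
      rw [abs_le] at this
      simp only [Complex.sub_re, Complex.one_re] at this
      push_cast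
      linarith [this.1]
    · have h4 : (G (x, y)).2 / (G (x, y)).1 - v₀ =
        ((G (x, y)).2 / (G (x, y)).1 - y / x) + (y / x - v₀) := by ring
      rw [h4]
      refine (norm_add_le _ _).trans_lt ?_
      linarith [hTs m]
  refine ⟨S N, ?_, ?_, ?_, ?_⟩
  · have ho : IsOpen {z : ℂ × ℂ | z.1 ≠ 0} := isOpen_ne_fun continuous_fst continuous_const
    have hc1 : ContinuousOn (fun z : ℂ × ℂ => (c / z.1 ^ k).re) {z : ℂ × ℂ | z.1 ≠ 0} := by
      refine Complex.continuous_re.comp_continuousOn ?_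
      exact continuousOn_const.div (by fun_prop) (fun z hz => pow_ne_zero k hz)
    have hc2 : ContinuousOn (fun z : ℂ × ℂ => ‖z.2 / z.1 - v₀‖) {z : ℂ × ℂ | z.1 ≠ 0} := by
      refine ((ContinuousOn.div (by fun_prop) (by fun_prop) (fun z hz => hz)).sub
        continuousOn_const).norm
    have := (hc1.isOpen_inter_preimage ho (isOpen_Ioi (a := (N:ℝ)/2))).inter
      (hc2.isOpen_inter_preimage ho (isOpen_Iio (a := r - T N)))
    convert this using 1
    ext z
    simp only [hS, Set.mem_ofPred_eq, Set.mem_inter_iff, Set.mem_preimage, Set.mem_Ioi, Set.mem_Iio]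
    tauto
  · rintro z ⟨h0, -, h2⟩
    exact ⟨h0, h2.trans_le (by linarith [hT0 N])⟩
  · intro v hv ε hε
    obtain ⟨t, ht1, ht2⟩ : ∃ t : ℕ, N < t ∧ ‖c‖ / t < ε ^ k := by
      have e2 : ∀ᶠ n : ℕ in atTop, ‖c‖ / n < ε ^ k :=
        (tendsto_const_div_atTop_nhds_zero_nat (‖c‖)).eventually (gt_mem_nhds (by positivity))
      exact ((eventually_gt_atTop N).and e2).exists
    have ht0 : (t : ℂ) ≠ 0 := by
      have : t ≠ 0 := by omega
      exact_mod_cast this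
    obtain ⟨x, hxk⟩ := IsAlgClosed.exists_pow_nat_eq (c / t) (n := k) (by omega)
    have hx0 : x ≠ 0 := by
      rintro rfl
      rw [zero_pow hk0] at hxk
      exact (div_ne_zero hc ht0) hxk.symm
    refine ⟨x, norm_pos_iff.mpr hx0, ?_, hx0, ?_, ?_⟩
    · refine lt_of_pow_lt_pow_left₀ k hε.le ?_
      rw [← norm_pow, hxk, norm_div]
      simpa using ht2
    · simp only
      rw [hxk, div_div_cancel₀ hc, Complex.natCast_re]
      have : (N:ℝ) < t := by exact_mod_cast ht1
      have : (0:ℝ) ≤ N := by positivity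
      linarith
    · simp only
      rw [mul_div_cancel_right₀ _ hx0]
      linarith
  · intro z hz
    have hit : ∀ n, G^[n] z ∈ S (N + n) := by
      intro n
      induction n with
      | zero => simpa using hz
      | succ n ih =>
        rw [Function.iterate_succ_apply']
        exact (hmap (N + n) (by omega) _ ih).1
    have hcauchy : CauchySeq (fun n : ℕ => (G^[n] z).2 / (G^[n] z).1) := by
      refine cauchySeq_of_dist_le_of_summable (fun n => b (n + N)) (fun n => ?_)
        ((summable_nat_add_iff N).mpr hbs)
      have := (hmap (N + n) (by omega) _ (hit n)).2
      rw [Function.iterate_succ_apply', dist_comm, dist_eq_norm, add_comm n N]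
      exact this
    obtain ⟨w, hw⟩ := cauchySeq_tendsto_of_complete hcauchy
    have hx0 : Tendsto (fun n => (G^[n] z).1) atTop (𝓝 0) := by
      have h1 : Tendsto (fun n => ‖(G^[n] z).1‖ ^ k) atTop (𝓝 0) := by
        refine squeeze_zero (fun n => by positivity)
          (fun n => (hx (N + n) _ (by omega) (hit n).1 (hit n).2.1).le) ?_
        have := (tendsto_const_div_atTop_nhds_zero_nat (2 * ‖c‖)).comp
          (tendsto_add_atTop_nat N)
        refine this.congr fun n => ?_
        simp [add_comm]
      rw [tendsto_zero_iff_norm_tendsto_zero, Metric.tendsto_atTop]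
      intro ε hε
      obtain ⟨n0, hn0⟩ := eventually_atTop.mp
        (h1.eventually (gt_mem_nhds (show (0:ℝ) < ε ^ k by positivity)))
      refine ⟨n0, fun n hn => ?_⟩
      rw [Real.dist_eq, sub_zero, abs_norm]
      exact lt_of_pow_lt_pow_left₀ k hε.le (hn0 n hn)
    refine ⟨fun n => (hit n).1, ?_, w, hw⟩
    have hy0 : Tendsto (fun n => (G^[n] z).2) atTop (𝓝 0) := by
      have := hw.mul hx0
      rw [mul_zero] at this
      refine this.congr fun n => div_mul_cancel₀ _ (hit n).1
    exact hx0.prodMk_nhds hy0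

lemma petal_step (k : ℕ) (hk : 1 ≤ k) (G : ℂ × ℂ → ℂ × ℂ) (P : ℂ × ℂ → ℂ) (a : ℂ → ℂ)
    (v₀ : ℂ) (hP : ∀ x v, P (x, v * x) = x ^ k * a v) (ha : ContinuousAt a v₀) (ha0 : a v₀ ≠ 0)
    (hexp : (fun z => G z - (z.1 + z.1 * P z, z.2 + z.2 * P z))
        =O[𝓝 (0 : ℂ × ℂ)] fun z => ‖z‖ ^ (k + 2)) :
    ∃ c : ℂ, c ≠ 0 ∧ ∃ ρ > (0:ℝ), ∃ r > (0:ℝ), ∃ C : ℝ, 0 ≤ C ∧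
     ∀ x v : ℂ, x ≠ 0 → ‖x‖ < ρ → ‖v - v₀‖ < r →
      (G (x, v * x)).1 ≠ 0 ∧ ‖(G (x, v * x)).2 / (G (x, v * x)).1 - v‖ ≤ C * ‖x‖ ^ (k + 1) ∧
      ‖c / (G (x, v * x)).1 ^ k - c / x ^ k - 1‖ ≤ 1 / 2 := by
  have hk0 : k ≠ 0 := by omega
  have hkC : (k:ℂ) ≠ 0 := by exact_mod_cast hk0
  set L : Filter (ℂ × ℂ) := 𝓝[≠] (0:ℂ) ×ˢ 𝓝 v₀ with hL
  have hx : Tendsto (fun w : ℂ × ℂ => w.1) L (𝓝 0) :=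
    tendsto_fst.mono_right nhdsWithin_le_nhds
  have hv : Tendsto (fun w : ℂ × ℂ => w.2) L (𝓝 v₀) := tendsto_snd
  have hne : ∀ᶠ w : ℂ × ℂ in L, w.1 ≠ 0 :=
    (tendsto_fst : Tendsto Prod.fst L (𝓝[≠] (0:ℂ))).eventually self_mem_nhdsWithin
  have hz : Tendsto (fun w : ℂ × ℂ => (w.1, w.2 * w.1)) L (𝓝 0) := by
    have := hx.prodMk_nhds (hv.mul hx)
    rwa [mul_zero] at this
  set E : ℂ × ℂ → ℂ × ℂ := fun w => G (w.1, w.2 * w.1) -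
    (w.1 + w.1 * (w.1 ^ k * a w.2), w.2 * w.1 + w.2 * w.1 * (w.1 ^ k * a w.2)) with hE
  have hEO : E =O[L] fun w => w.1 ^ (k + 2) := by
    have h1 := hexp.comp_tendsto hz
    have h2 : (fun w : ℂ × ℂ => ((w.1, w.2 * w.1) : ℂ × ℂ)) =O[L] fun w => w.1 := by
      refine IsBigO.prod_left (isBigO_refl _ _) ?_
      have := (hv.isBigO_one ℂ).mul (isBigO_refl (fun w : ℂ × ℂ => w.1) L)
      simpa using this
    have h3 := h2.norm_left.pow (k + 2)
    refine IsBigO.trans ?_ h3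
    refine h1.congr_left fun w => ?_
    simp only [Function.comp, hP, hE]
  have hE1 : (fun w => (E w).1) =O[L] fun w => w.1 ^ (k + 2) :=
    (isBigO_of_le _ fun w => norm_fst_le _).trans hEO
  have hE2 : (fun w => (E w).2) =O[L] fun w => w.1 ^ (k + 2) :=
    (isBigO_of_le _ fun w => norm_snd_le _).trans hEO
  -- e w = E1 / x^(k+1) → 0
  have he : Tendsto (fun w => (E w).1 / w.1 ^ (k + 1)) L (𝓝 0) := by
    have h1 : (fun w => (E w).1 / w.1 ^ (k + 1)) =O[L] fun w => w.1 := by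
      have := hE1.mul (isBigO_refl (fun w : ℂ × ℂ => (w.1 ^ (k + 1))⁻¹) L)
      refine (this.congr' (Eventually.of_forall fun w => (div_eq_mul_inv _ _).symm) ?_)
      filter_upwards [hne] with w hw
      field_simp
      ring
    exact h1.trans_tendsto hx
  set q : ℂ × ℂ → ℂ := fun w => a w.2 + (E w).1 / w.1 ^ (k + 1) with hq
  have hqt : Tendsto q L (𝓝 (a v₀)) := by
    have := (ha.tendsto.comp hv).add he
    simpa using this
  set δ : ℂ × ℂ → ℂ := fun w => w.1 ^ k * q w with hδ
  have hδt : Tendsto δ L (𝓝 0) := by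
    have := (hx.pow k).mul hqt
    rwa [zero_pow hk0, zero_mul] at this
  have hG1 : ∀ᶠ w in L, (G (w.1, w.2 * w.1)).1 = w.1 * (1 + δ w) := by
    filter_upwards [hne] with w hw
    have : (E w).1 = (G (w.1, w.2 * w.1)).1 - (w.1 + w.1 * (w.1 ^ k * a w.2)) := rfl
    simp only [hδ, hq, this]
    field_simp
    ring
  have hhalf : ∀ᶠ w in L, 1 / 2 < ‖1 + δ w‖ := by
    have : Tendsto (fun w => ‖1 + δ w‖) L (𝓝 ‖(1:ℂ) + 0‖) := (hδt.const_add 1).norm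
    refine this.eventually (lt_mem_nhds ?_)
    norm_num
  set c : ℂ := -1 / (k * a v₀) with hc
  have hc0 : c ≠ 0 := div_ne_zero (by norm_num) (mul_ne_zero hkC ha0)
  set φ : ℂ → ℂ := fun t => ((1 + t) ^ k)⁻¹ with hφ
  have hφd : HasDerivAt φ (-k) 0 := by
    have h1 : HasDerivAt (fun t : ℂ => (1 + t) ^ k) (k : ℂ) 0 := by
      have := ((hasDerivAt_id' (0:ℂ)).const_add 1).fun_pow k
      simp only [add_zero, one_pow, mul_one] at this
      exact this
    have := h1.fun_inv (by simp)
    simp only [add_zero, one_pow, div_one] at this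
    exact this
  have hds : Tendsto (fun w => dslope φ 0 (δ w)) L (𝓝 (-k)) := by
    have h1 : ContinuousAt (dslope φ 0) 0 := continuousAt_dslope_same.mpr hφd.differentiableAt
    have h2 := h1.tendsto.comp hδt
    rwa [dslope_same, hφd.deriv] at h2
  have hs : Tendsto (fun w : ℂ × ℂ => c / (G (w.1, w.2 * w.1)).1 ^ k - c / w.1 ^ k) L (𝓝 1) := by
    have h1 : Tendsto (fun w => c * dslope φ 0 (δ w) * q w) L (𝓝 (c * (-k) * a v₀)) :=
      (hds.const_mul c).mul hqt
    have h2 : c * (-k) * a v₀ = 1 := by rw [hc]; field_simp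
    rw [h2] at h1
    refine h1.congr' ?_
    filter_upwards [hne, hG1, hhalf] with w hw hg hh
    have h3 : φ (δ w) = 1 + δ w * dslope φ 0 (δ w) := by
      have := sub_smul_dslope φ 0 (δ w)
      simp only [sub_zero, smul_eq_mul] at this
      rw [this]; simp [hφ]
    have h4 : c / (w.1 * (1 + δ w)) ^ k = c / w.1 ^ k * φ (δ w) := by
      simp only [hφ, mul_pow]; rw [div_mul_eq_div_mul_one_div, one_div]
    rw [hg, h4, h3]
    have : δ w = w.1 ^ k * q w := rfl
    have h5 : c / w.1 ^ k * (1 + δ w * dslope φ 0 (δ w)) - c / w.1 ^ k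
      = c / w.1 ^ k * (w.1 ^ k * q w) * dslope φ 0 (δ w) := by rw [← this]; ring
    rw [h5]
    field_simp
  have hs' : ∀ᶠ w in L, ‖c / (G (w.1, w.2 * w.1)).1 ^ k - c / w.1 ^ k - 1‖ ≤ 1 / 2 := by
    have := Metric.tendsto_nhds.mp hs (1/2) (by norm_num)
    filter_upwards [this] with w hw
    rw [dist_eq_norm] at hw
    exact hw.le
  have hvO : (fun w => (E w).2 - w.2 * (E w).1) =O[L] fun w => w.1 ^ (k + 2) := by
    refine hE2.sub ?_
    simpa using (hv.isBigO_one ℂ).mul hE1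
  obtain ⟨C, hCpos, hCb⟩ := hvO.exists_pos
  rw [isBigOWith_iff] at hCb
  have hall : ∀ᶠ w in L, (G (w.1, w.2 * w.1)).1 ≠ 0 ∧
      ‖(G (w.1, w.2 * w.1)).2 / (G (w.1, w.2 * w.1)).1 - w.2‖ ≤ (2 * C) * ‖w.1‖ ^ (k + 1) ∧
      ‖c / (G (w.1, w.2 * w.1)).1 ^ k - c / w.1 ^ k - 1‖ ≤ 1 / 2 := by
    filter_upwards [hne, hG1, hhalf, hs', hCb] with w hw hg hh h1 h2
    have hw' : 0 < ‖w.1‖ := norm_pos_iff.mpr hw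
    have hgn : ‖w.1‖ / 2 ≤ ‖(G (w.1, w.2 * w.1)).1‖ := by
      rw [hg, norm_mul]
      nlinarith
    have hg0 : (G (w.1, w.2 * w.1)).1 ≠ 0 := norm_pos_iff.mp (by linarith)
    refine ⟨hg0, ?_, h1⟩
    have e1 : (E w).1 = (G (w.1, w.2 * w.1)).1 - (w.1 + w.1 * (w.1 ^ k * a w.2)) := rfl
    have e2 : (E w).2 = (G (w.1, w.2 * w.1)).2 -
      (w.2 * w.1 + w.2 * w.1 * (w.1 ^ k * a w.2)) := rfl
    have e3 : (G (w.1, w.2 * w.1)).2 / (G (w.1, w.2 * w.1)).1 - w.2 =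
        ((E w).2 - w.2 * (E w).1) / (G (w.1, w.2 * w.1)).1 := by
      rw [e1, e2]; field_simp; ring
    rw [e3, norm_div, div_le_iff₀ (norm_pos_iff.mpr hg0)]
    refine h2.trans ?_
    rw [norm_pow]
    calc C * ‖w.1‖ ^ (k + 2) = 2 * C * ‖w.1‖ ^ (k + 1) * (‖w.1‖ / 2) := by ring
      _ ≤ _ := by gcongr
  rw [hL, eventually_prod_iff] at hall
  obtain ⟨pa, hpa, pb, hpb, hab⟩ := hall
  rw [eventually_nhdsWithin_iff] at hpa
  obtain ⟨ρ, hρ, h1⟩ := Metric.eventually_nhds_iff.mp hpa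
  obtain ⟨r, hr, h2⟩ := Metric.eventually_nhds_iff.mp hpb
  refine ⟨c, hc0, ρ, hρ, r, hr, 2 * C, by positivity, fun x v hx0 hxρ hvr => ?_⟩
  exact hab (h1 (by simpa using hxρ) hx0) (h2 (by rwa [dist_eq_norm]))

lemma inverse_expansion (k : ℕ) (hk : 1 ≤ k) (F F' : ℂ × ℂ → ℂ × ℂ) (P : ℂ × ℂ → ℂ)
    (hPd : ContDiff ℂ 1 P) (hPO : P =O[𝓝 (0 : ℂ × ℂ)] fun z => ‖z‖ ^ k)
    (hexp : (fun z => F z - (z.1 + z.1 * P z, z.2 + z.2 * P z))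
        =O[𝓝 (0 : ℂ × ℂ)] fun z => ‖z‖ ^ (k + 2))
    (hF'a : AnalyticAt ℂ F' 0) (hF'0 : F' 0 = 0)
    (hFF' : F ∘ F' =ᶠ[𝓝 (0 : ℂ × ℂ)] id) :
    (fun z => F' z - (z.1 + z.1 * (-P z), z.2 + z.2 * (-P z)))
        =O[𝓝 (0 : ℂ × ℂ)] fun z => ‖z‖ ^ (k + 2) := by
  have hpow : ∀ {m n : ℕ}, n ≤ m → (fun z : ℂ × ℂ => ‖z‖ ^ m) =O[𝓝 0] fun z => ‖z‖ ^ n := by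
    intro m n h
    refine IsBigO.of_bound 1 ?_
    filter_upwards [Metric.ball_mem_nhds (0 : ℂ × ℂ) one_pos] with z hz
    rw [mem_ball_zero_iff] at hz
    simp only [norm_pow, norm_norm, one_mul]
    exact pow_le_pow_of_le_one (norm_nonneg _) hz.le h
  have hF't : Tendsto F' (𝓝 0) (𝓝 0) := by
    have := hF'a.continuousAt.tendsto
    rwa [hF'0] at this
  have hF'O : F' =O[𝓝 0] fun z => ‖z‖ := by
    have := hF'a.differentiableAt.isBigO_sub
    simp only [hF'0, sub_zero] at this
    exact this.norm_right
  have hPF' : (fun w => P (F' w)) =O[𝓝 0] fun z => ‖z‖ ^ k :=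
    (hPO.comp_tendsto hF't).trans (hF'O.norm_left.pow k)
  have hid : (fun w : ℂ × ℂ => w) =O[𝓝 0] fun z => ‖z‖ := (isBigO_refl _ _).norm_right
  -- w - z - P z • z
  have h1 : (fun w => w - (F' w + P (F' w) • F' w)) =O[𝓝 0] fun z => ‖z‖ ^ (k + 2) := by
    refine ((hexp.comp_tendsto hF't).trans (hF'O.norm_left.pow (k + 2))).congr' ?_ EventuallyEq.rfl
    filter_upwards [hFF'] with w hw
    simp only [Function.comp, id] at hw ⊢
    rw [hw]
    ext <;> simp <;> ring
  have h2 : (fun w => P (F' w) • F' w) =O[𝓝 0] fun z => ‖z‖ ^ (k + 1) := by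
    refine (hPF'.smul hF'O).congr_right fun z => ?_
    simp [pow_succ]
  have h3 : (fun w => F' w - w) =O[𝓝 0] fun z => ‖z‖ ^ (k + 1) := by
    have := ((h1.trans (hpow (by omega : k + 1 ≤ k + 2))).add h2).neg_left
    refine this.congr_left fun w => ?_
    abel
  have h4 : (fun w => P (F' w) - P w) =O[𝓝 0] fun z => ‖z‖ ^ (k + 1) := by
    have hst := (hPd.contDiffAt (x := (0 : ℂ × ℂ))).hasStrictFDerivAt (by norm_num)
    have hb := hst.isBigO_sub
    have ht : Tendsto (fun w : ℂ × ℂ => (F' w, w)) (𝓝 0) (𝓝 ((0, 0) : (ℂ × ℂ) × (ℂ × ℂ))) :=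
      hF't.prodMk_nhds tendsto_id
    exact (hb.comp_tendsto ht).trans h3
  have h5 : (fun w => P (F' w) • (F' w - w)) =O[𝓝 0] fun z => ‖z‖ ^ (k + 2) := by
    have := hPF'.smul h3
    refine IsBigO.trans (this.congr_right fun z => ?_) (hpow (by omega : k + 2 ≤ k + (k + 1)))
    simp [pow_add]
  have h6 : (fun w => (P (F' w) - P w) • w) =O[𝓝 0] fun z => ‖z‖ ^ (k + 2) := by
    refine (h4.smul hid).congr_right fun z => ?_
    simp [pow_succ]
  refine ((h1.add h5).add h6).neg_left.congr_left fun w => ?_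
  ext <;> simp <;> ring

lemma petal (k : ℕ) (hk : 1 ≤ k) (G : ℂ × ℂ → ℂ × ℂ) (P : ℂ × ℂ → ℂ) (a : ℂ → ℂ)
    (v₀ : ℂ) (hP : ∀ x v, P (x, v * x) = x ^ k * a v) (ha : ContinuousAt a v₀) (ha0 : a v₀ ≠ 0)
    (hexp : (fun z => G z - (z.1 + z.1 * P z, z.2 + z.2 * P z))
        =O[𝓝 (0 : ℂ × ℂ)] fun z => ‖z‖ ^ (k + 2)) :
    ∃ r₀ > (0:ℝ), ∀ r > (0:ℝ), r ≤ r₀ →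
    ∃ V : Set (ℂ × ℂ), IsOpen V ∧ V ⊆ {z : ℂ × ℂ | z.1 ≠ 0 ∧ ‖z.2 / z.1 - v₀‖ < r} ∧
      (∀ v : ℂ, ‖v - v₀‖ < r / 2 → ∀ ε > (0 : ℝ),
          (∃ x : ℂ, 0 < ‖x‖ ∧ ‖x‖ < ε ∧ (x, v * x) ∈ V)) ∧
      (∀ z ∈ V, (∀ n : ℕ, (G^[n] z).1 ≠ 0) ∧
          Tendsto (fun n : ℕ => G^[n] z) atTop (𝓝 0) ∧
          ∃ w : ℂ, Tendsto (fun n : ℕ => (G^[n] z).2 / (G^[n] z).1) atTop (𝓝 w)) := by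
  obtain ⟨c, hc, ρ, hρ, r₀, hr₀, C, hC, h⟩ := petal_step k hk G P a v₀ hP ha ha0 hexp
  exact ⟨r₀, hr₀, fun r hr hrr => petal_dyn k hk G c v₀ hc ρ r C hρ hr hC
    fun x v h0 h1 h2 => h x v h0 h1 (h2.trans_le hrr)⟩

lemma eval_contDiff (p : MvPolynomial (Fin 2) ℂ) :
    ContDiff ℂ 1 (fun z : ℂ × ℂ => MvPolynomial.eval ![z.1, z.2] p) := by
  induction p using MvPolynomial.induction_on with
  | C a => simpa using contDiff_const
  | add p q hp hq => simpa using hp.add hq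
  | mul_X p i hp =>
    simp only [map_mul, MvPolynomial.eval_X]
    refine hp.mul ?_
    fin_cases i
    · exact contDiff_fst
    · exact contDiff_snd

lemma eval_isBigO (k : ℕ) (p : MvPolynomial (Fin 2) ℂ) (hp : p.IsHomogeneous k) :
    (fun z : ℂ × ℂ => MvPolynomial.eval ![z.1, z.2] p) =O[𝓝 0] fun z => ‖z‖ ^ k := by
  simp only [MvPolynomial.eval_eq']
  refine IsBigO.fun_sum fun d hd => ?_
  refine IsBigO.const_mul_left ?_ _
  have hdk : d 0 + d 1 = k := by
    have := hp (MvPolynomial.mem_support_iff.mp hd)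
    rw [Finsupp.weight_apply, Finsupp.sum_fintype _ _ (by simp)] at this
    simpa using this
  refine IsBigO.of_bound 1 (Eventually.of_forall fun z => ?_)
  simp only [Fin.prod_univ_two, norm_mul, norm_pow, one_mul, norm_norm, ← hdk, pow_add,
    Matrix.cons_val_zero, Matrix.cons_val_one]
  gcongr
  · exact norm_fst_le z
  · exact norm_snd_le z

lemma eval_hom_s14 (k : ℕ) (p : MvPolynomial (Fin 2) ℂ) (hp : p.IsHomogeneous k) (x v : ℂ) :
    MvPolynomial.eval ![x, v * x] p = x ^ k * MvPolynomial.eval ![1, v] p := by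
  simp only [MvPolynomial.eval_eq', Finset.mul_sum]
  refine Finset.sum_congr rfl fun d hd => ?_
  have hdk : d 0 + d 1 = k := by
    have := hp (MvPolynomial.mem_support_iff.mp hd)
    rw [Finsupp.weight_apply, Finsupp.sum_fintype _ _ (by simp)] at this
    simpa using this
  simp only [Fin.prod_univ_two, ← hdk, pow_add, Matrix.cons_val_zero, Matrix.cons_val_one,
    mul_pow, one_pow]
  ring

lemma eval_continuous (p : MvPolynomial (Fin 2) ℂ) :
    Continuous (fun v : ℂ => MvPolynomial.eval ![1, v] p) := by
  refine (MvPolynomial.continuous_eval p).comp (continuous_pi fun i => ?_)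
  fin_cases i
  · exact continuous_const
  · exact continuous_id

/-- Two-dimensional flower theorem for dicritic diffeomorphisms
`F(x,y) = (x + x·p_k(x,y), y + y·p_k(x,y)) + O(‖(x,y)‖^{k+2})`: near every
non-degenerate direction `v₀` (i.e. `p_k(1,v₀) ≠ 0`) there are attracting and
repelling open petals `V⁺, V⁻` inside the cone `{|y/x − v₀| < r}`, whose closures
contain the origin in all directions `v` with `|v − v₀| < r/2`, on which the forward
(resp. backward) orbits converge to `0` with converging direction ratios. -/
theorem dicritic_flower (k : ℕ) (hk : 1 ≤ k)
    (F F' : ℂ × ℂ → ℂ × ℂ) (p : MvPolynomial (Fin 2) ℂ)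
    (hp : p.IsHomogeneous k)
    (hFa : AnalyticAt ℂ F 0)
    (hexp : (fun z => F z - (z.1 + z.1 * MvPolynomial.eval ![z.1, z.2] p,
                             z.2 + z.2 * MvPolynomial.eval ![z.1, z.2] p))
        =O[𝓝 (0 : ℂ × ℂ)] fun z => ‖z‖ ^ (k + 2))
    (hF'a : AnalyticAt ℂ F' 0) (hF'0 : F' 0 = 0)
    (hFF' : F ∘ F' =ᶠ[𝓝 (0 : ℂ × ℂ)] id) (hF'F : F' ∘ F =ᶠ[𝓝 (0 : ℂ × ℂ)] id) :
    ∀ v₀ : ℂ, MvPolynomial.eval ![1, v₀] p ≠ 0 →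
      ∃ r > (0 : ℝ), ∃ Vp Vm : Set (ℂ × ℂ), IsOpen Vp ∧ IsOpen Vm ∧
        Vp ⊆ {z : ℂ × ℂ | z.1 ≠ 0 ∧ ‖z.2 / z.1 - v₀‖ < r} ∧
        Vm ⊆ {z : ℂ × ℂ | z.1 ≠ 0 ∧ ‖z.2 / z.1 - v₀‖ < r} ∧
        (∀ v : ℂ, ‖v - v₀‖ < r / 2 → ∀ ε > (0 : ℝ),
          (∃ x : ℂ, 0 < ‖x‖ ∧ ‖x‖ < ε ∧ (x, v * x) ∈ Vp) ∧
          (∃ x : ℂ, 0 < ‖x‖ ∧ ‖x‖ < ε ∧ (x, v * x) ∈ Vm)) ∧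
        (∀ z ∈ Vp, (∀ n : ℕ, (F^[n] z).1 ≠ 0) ∧
          Tendsto (fun n : ℕ => F^[n] z) atTop (𝓝 0) ∧
          ∃ w : ℂ, Tendsto (fun n : ℕ => (F^[n] z).2 / (F^[n] z).1) atTop (𝓝 w)) ∧
        (∀ z ∈ Vm, (∀ n : ℕ, (F'^[n] z).1 ≠ 0) ∧
          Tendsto (fun n : ℕ => F'^[n] z) atTop (𝓝 0) ∧
          ∃ w : ℂ, Tendsto (fun n : ℕ => (F'^[n] z).2 / (F'^[n] z).1) atTop (𝓝 w)) := by
  intro v₀ hv₀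
  have hcont : Continuous (fun v : ℂ => MvPolynomial.eval ![1, v] p) :=
    eval_continuous p
  have hinv := inverse_expansion k hk F F' (fun z => MvPolynomial.eval ![z.1, z.2] p)
    (eval_contDiff p) (eval_isBigO k p hp) hexp hF'a hF'0 hFF'
  have hhom := eval_hom_s14 k p hp
  have hhom' : ∀ x v : ℂ, -MvPolynomial.eval ![x, v * x] p
      = x ^ k * (-MvPolynomial.eval ![1, v] p) := by
    intro x v
    rw [hhom, mul_neg]
  obtain ⟨r₁, hr₁, h₁⟩ := petal k hk F (fun z => MvPolynomial.eval ![z.1, z.2] p)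
    (fun v => MvPolynomial.eval ![1, v] p) v₀ hhom hcont.continuousAt hv₀ hexp
  obtain ⟨r₂, hr₂, h₂⟩ := petal k hk F' (fun z => -MvPolynomial.eval ![z.1, z.2] p)
    (fun v => -MvPolynomial.eval ![1, v] p) v₀ hhom'
    hcont.neg.continuousAt (neg_ne_zero.mpr hv₀) hinv
  have hr : 0 < min r₁ r₂ := lt_min hr₁ hr₂
  obtain ⟨Vp, a1, a2, a3, a4⟩ := h₁ _ hr (min_le_left _ _)
  obtain ⟨Vm, b1, b2, b3, b4⟩ := h₂ _ hr (min_le_right _ _)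
  exact ⟨min r₁ r₂, hr, Vp, Vm, a1, b1, a2, b2,
    fun v hv ε hε => ⟨a3 v hv ε hε, b3 v hv ε hε⟩, a4, b4⟩
end

section
/- Let k ≥ 1 and l ≥ 1 be integers, let p, r ∈ ℂ[v] be polynomials with r not identically zero, let φ₁, φ₂ : ℂ → ℂ be entire functions, and let U ⊆ ℂ \ {v : r(v) = 0} be a nonempty open simply connected set. Then there exist functions h₁, h₂ holomorphic on U satisfying the linear system of ordinary differential equations r(v)·h₁'(v) − ( (k−l)·p(v)·h₁(v) + p'(v)·h₂(v) ) = φ₁(v) and r(v)·h₂'(v) − ( k·r(v)·h₁(v) + (r'(v) − l·p(v))·h₂(v) ) = φ₂(v) for all v ∈ U. -/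
open Filter Topology

/-- A copy of `ℂ` that carries the discrete topology. -/
@[ext] structure DiscC where
  val : ℂ

instance : TopologicalSpace DiscC := ⊥
instance : DiscreteTopology DiscC := ⟨rfl⟩

lemma locconst_diff {f G₁ G₂ : ℂ → ℂ} {V : Set ℂ} (hV : IsOpen V)
    (h₁ : ∀ z ∈ V, HasDerivAt G₁ (f z) z) (h₂ : ∀ z ∈ V, HasDerivAt G₂ (f z) z)
    {x : ℂ} (hx : x ∈ V) : ∀ᶠ y in 𝓝 x, G₁ y - G₂ y = G₁ x - G₂ x := by
  obtain ⟨ε, hε, hb⟩ := Metric.isOpen_iff.mp hV x hx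
  filter_upwards [Metric.ball_mem_nhds x hε] with y hy
  have hd : ∀ z ∈ Metric.ball x ε, HasDerivAt (fun z => G₁ z - G₂ z) 0 z := fun z hz => by
    have h := (h₁ z (hb hz)).sub (h₂ z (hb hz))
    rw [sub_self] at h
    exact h
  exact Metric.isOpen_ball.is_const_of_deriv_eq_zero (convex_ball x ε).isPreconnected
    (fun z hz => (hd z hz).differentiableAt.differentiableWithinAt)
    (fun z hz => (hd z hz).deriv) hy (Metric.mem_ball_self hε)

/-- The covering space of local primitives of `f`. -/
noncomputable def primCore (U : Set ℂ) (f : ℂ → ℂ) (G : U → ℂ → ℂ) (R : U → ℝ)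
    (hR : ∀ x, 0 < R x)
    (hG : ∀ x : U, ∀ z ∈ Metric.ball (x : ℂ) (R x), HasDerivAt (G x) (f z) z) :
    FiberBundleCore U U DiscC where
  baseSet x := (Subtype.val : U → ℂ) ⁻¹' Metric.ball (x : ℂ) (R x)
  isOpen_baseSet x := Metric.isOpen_ball.preimage continuous_subtype_val
  indexAt x := x
  mem_baseSet_at x := Metric.mem_ball_self (hR x)
  coordChange i j x v := ⟨v.val + (G i x - G j x)⟩
  coordChange_self i x _ v := by
    ext
    simp
  continuousOn_coordChange i j := by
    rintro ⟨x, v⟩ ⟨⟨hi, hj⟩, -⟩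
    apply ContinuousAt.continuousWithinAt
    unfold ContinuousAt
    rw [nhds_discrete DiscC, tendsto_pure, nhds_prod_eq, nhds_discrete DiscC]
    have h := locconst_diff (f := f) (G₁ := G i) (G₂ := G j)
      (Metric.isOpen_ball.inter Metric.isOpen_ball)
      (fun z hz => hG i z hz.1) (fun z hz => hG j z hz.2) (x := x) ⟨hi, hj⟩
    have h' : ∀ᶠ y : U in 𝓝 x, G i y - G j y = G i x - G j x :=
      continuous_subtype_val.continuousAt.eventually h
    have hv : ∀ᶠ w in (pure v : Filter DiscC), w = v := by simp
    filter_upwards [h'.prod_mk hv] with ⟨y, w⟩ ⟨hy, hw⟩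
    simp only at hy hw ⊢
    rw [hy, hw]
  coordChange_comp i j k x _ v := by
    ext
    simp only
    ring

/-- Holomorphic functions on simply connected open sets have primitives. -/
theorem exists_primitive (U : Set ℂ) (hUo : IsOpen U) (hUsc : SimplyConnectedSpace U)
    (f : ℂ → ℂ) (hf : DifferentiableOn ℂ f U) :
    ∃ g : ℂ → ℂ, ∀ z ∈ U, HasDerivAt g (f z) z := by
  classical
  have key : ∀ x : U, ∃ R : ℝ, ∃ G : ℂ → ℂ, 0 < R ∧
      ∀ z ∈ Metric.ball (x : ℂ) R, HasDerivAt G (f z) z := by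
    intro x
    obtain ⟨ε, hε, hb⟩ := Metric.isOpen_iff.mp hUo x x.2
    obtain ⟨G, hG⟩ := (hf.mono hb).isExactOn_ball
    exact ⟨ε, G, hε, hG⟩
  choose R G hR hG using key
  let Z := primCore U f G R hR hG
  have cov : IsCoveringMap (Bundle.TotalSpace.proj : Bundle.TotalSpace DiscC Z.Fiber → U) :=
    FiberBundle.isCoveringMap
  have := hUo.locallyPathConnectedSpace
  have x₀ : U := Classical.choice inferInstance
  obtain ⟨F, ⟨-, hF⟩, -⟩ := cov.existsUnique_continuousMap_lifts (ContinuousMap.id U) x₀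
    ⟨x₀, (⟨0⟩ : DiscC)⟩ rfl
  have hproj : ∀ x, (F x).proj = x := fun x => congrFun hF x
  let c : U → ℂ := fun x => DiscC.val (F x).snd + G (F x).proj x
  refine ⟨fun z => if h : z ∈ U then c ⟨z, h⟩ else 0, fun z hz => ?_⟩
  set x : U := ⟨z, hz⟩ with hx
  -- local constancy in the chart at `x`
  have hcont : ContinuousAt (fun y : U => (Z.localTriv x (F y)).2) x := by
    have h1 : ContinuousAt (Z.localTriv x) (F x) := by
      apply (Z.localTriv x).continuousAt
      rw [FiberBundleCore.mem_localTriv_source, hproj]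
      exact Z.mem_baseSet_at x
    exact continuous_snd.continuousAt.comp (h1.comp F.continuous.continuousAt)
  rw [ContinuousAt, nhds_discrete DiscC, tendsto_pure] at hcont
  set C : ℂ := DiscC.val (Z.localTriv x (F x)).2 with hC
  have hcC : ∀ᶠ y : U in 𝓝 x, c y = G x y + C := by
    filter_upwards [hcont] with y hy
    have h2 : DiscC.val (F y).snd + (G (F y).proj (F y).proj - G x (F y).proj) = C :=
      congrArg DiscC.val hy
    rw [hproj y] at h2
    simp only [c]
    rw [hproj y, ← h2]
    ring
  have hc' : ∀ᶠ y : ℂ in 𝓝 z, (if h : y ∈ U then c ⟨y, h⟩ else 0) = G x y + C := by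
    have : 𝓝 z = map (Subtype.val : U → ℂ) (𝓝 x) := (hUo.isOpenEmbedding_subtypeVal.map_nhds_eq x).symm
    rw [this, eventually_map]
    filter_upwards [hcC] with y hy
    rw [dif_pos y.2]
    exact hy
  exact ((hG x z (Metric.mem_ball_self (hR x))).add_const C).congr_of_eventuallyEq hc'

/-- The linear ODE system governing semiformal conjugations has holomorphic solutions on
any nonempty simply connected open set avoiding the zeros of `r`. -/
theorem ode_system_solvable_on_simply_connected (k l : ℕ) (hk : 1 ≤ k) (hl : 1 ≤ l)
    (p r : Polynomial ℂ) (hr : r ≠ 0)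
    (φ₁ φ₂ : ℂ → ℂ) (hφ₁ : Differentiable ℂ φ₁) (hφ₂ : Differentiable ℂ φ₂)
    (U : Set ℂ) (hUne : U.Nonempty) (hUopen : IsOpen U)
    (hUsub : ∀ v ∈ U, r.eval v ≠ 0)
    (hUsc : SimplyConnectedSpace U) :
    ∃ h₁ h₂ : ℂ → ℂ, DifferentiableOn ℂ h₁ U ∧ DifferentiableOn ℂ h₂ U ∧
      ∀ v ∈ U,
        r.eval v * deriv h₁ v -
            (((k : ℂ) - (l : ℂ)) * p.eval v * h₁ v + p.derivative.eval v * h₂ v) = φ₁ v ∧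
        r.eval v * deriv h₂ v -
            ((k : ℂ) * r.eval v * h₁ v +
              (r.derivative.eval v - (l : ℂ) * p.eval v) * h₂ v) = φ₂ v := by
  obtain ⟨L, hL⟩ := exists_primitive U hUopen hUsc (fun v => p.eval v / r.eval v)
    (p.differentiable.differentiableOn.div r.differentiable.differentiableOn hUsub)
  have hLd : DifferentiableOn ℂ L U := fun z hz =>
    (hL z hz).differentiableAt.differentiableWithinAt
  have hp : DifferentiableOn ℂ (fun v => p.eval v) U := p.differentiable.differentiableOn
  have hr' : DifferentiableOn ℂ (fun v => r.eval v) U := r.differentiable.differentiableOn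
  have h1 := hφ₁.differentiableOn (s := U)
  have h2 := hφ₂.differentiableOn (s := U)
  obtain ⟨A, hA⟩ := exists_primitive U hUopen hUsc
    (fun v => Complex.exp (l * L v) * ((φ₁ v - p.eval v * φ₂ v / r.eval v) / r.eval v))
    ((hLd.const_mul _).cexp.mul ((h1.sub ((hp.mul h2).div hr' hUsub)).div hr' hUsub))
  have hAd : DifferentiableOn ℂ A U := fun z hz =>
    (hA z hz).differentiableAt.differentiableWithinAt
  obtain ⟨u, hu⟩ := exists_primitive U hUopen hUsc
    (fun v => Complex.exp (-((k - l) * L v)) *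
      (((k : ℂ) * (Complex.exp (-(l * L v)) * A v) + φ₂ v / r.eval v) / r.eval v))
    ((hLd.const_mul _).neg.cexp.mul
      (((((hLd.const_mul _).neg.cexp.mul hAd).const_mul _).add (h2.div hr' hUsub)).div hr' hUsub))
  have H1 : ∀ v ∈ U, HasDerivAt (fun v => u v * Complex.exp ((k - l) * L v) * p.eval v +
      Complex.exp (-(l * L v)) * A v) _ v := fun v hv =>
    (((hu v hv).mul ((hL v hv).const_mul ((k : ℂ) - l)).cexp).mul (p.hasDerivAt v)).add
      ((((hL v hv).const_mul (l : ℂ)).neg.cexp).mul (hA v hv))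
  have H2 : ∀ v ∈ U, HasDerivAt (fun v => u v * Complex.exp ((k - l) * L v) * r.eval v) _ v :=
    fun v hv =>
    (((hu v hv).mul ((hL v hv).const_mul ((k : ℂ) - l)).cexp).mul (r.hasDerivAt v))
  refine ⟨_, _, fun v hv => (H1 v hv).differentiableAt.differentiableWithinAt,
    fun v hv => (H2 v hv).differentiableAt.differentiableWithinAt, fun v hv => ?_⟩
  have hrv := hUsub v hv
  rw [(H1 v hv).deriv, (H2 v hv).deriv]
  simp only [Pi.mul_apply, Pi.neg_apply, Complex.exp_neg]
  have e1 := Complex.exp_ne_zero ((k - l) * L v)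
  have e2 := Complex.exp_ne_zero (l * L v)
  generalize Complex.exp ((k - l) * L v) = E1 at *
  generalize Complex.exp (l * L v) = E2 at *
  constructor
  · field_simp
    ring
  · field_simp
    ring
end

section
/- Let k ≥ 1 and l ≥ 1 be integers, let p, r ∈ ℂ[v] be polynomials, and let v₀ ∈ ℂ satisfy r(v₀) = 0 and r'(v₀) ≠ 0 with p(v₀)/r'(v₀) ∉ ℚ. Let φ₁, φ₂ be holomorphic on a neighborhood of v₀. Then there exist functions h₁, h₂ holomorphic on some neighborhood of v₀ satisfying r(v)·h₁'(v) − ( (k−l)·p(v)·h₁(v) + p'(v)·h₂(v) ) = φ₁(v) and r(v)·h₂'(v) − ( k·r(v)·h₁(v) + (r'(v) − l·p(v))·h₂(v) ) = φ₂(v) on that neighborhood, if and only if l ≠ k, or l = k and p'(v₀)·φ₂(v₀) = ( r'(v₀) − k·p(v₀) )·φ₁(v₀). -/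
open Filter Topology

/-- Geometric growth bound. -/
def GB {E : Type*} [NormedAddCommGroup E] (c : ℕ → E) : Prop :=
  ∃ M ρ : ℝ, 0 < M ∧ 0 < ρ ∧ ∀ n, ‖c n‖ ≤ M * ρ ^ n

lemma GB.uniform {E F : Type*} [NormedAddCommGroup E] [NormedAddCommGroup F]
    {c : ℕ → E} {d : ℕ → F} (hc : GB c) (hd : GB d) :
    GB (fun n => (c n, d n)) := by
  obtain ⟨M, ρ, hM, hρ, h⟩ := hc
  obtain ⟨M', ρ', hM', hρ', h'⟩ := hd
  refine ⟨max M M', max ρ ρ', by positivity, by positivity, fun n => ?_⟩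
  rw [Prod.norm_def]
  apply max_le
  · refine (h n).trans ?_
    gcongr
    · exact le_max_left _ _
    · exact le_max_left _ _
  · refine (h' n).trans ?_
    gcongr
    · exact le_max_right _ _
    · exact le_max_right _ _

lemma GB.summable {c : ℕ → ℂ} (hc : GB c) :
    ∀ᶠ z in 𝓝 (0 : ℂ), Summable (fun n => ‖c n * z ^ n‖) := by
  obtain ⟨M, ρ, hM, hρ, h⟩ := hc
  filter_upwards [Metric.ball_mem_nhds (0 : ℂ) (inv_pos.2 hρ)] with z hz
  have hz : ‖z‖ < ρ⁻¹ := by simpa using hz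
  have h1 : ρ * ‖z‖ < 1 := by
    calc ρ * ‖z‖ < ρ * ρ⁻¹ := by gcongr
      _ = 1 := by field_simp
  refine Summable.of_nonneg_of_le (fun _ => norm_nonneg _) (fun n => ?_)
    ((summable_geometric_of_lt_one (by positivity) h1).mul_left M)
  rw [norm_mul, norm_pow, mul_pow, ← mul_assoc]
  gcongr
  exact h n

lemma analytic_repr {f : ℂ → ℂ} (hf : AnalyticAt ℂ f 0) :
    ∃ c : ℕ → ℂ, GB c ∧ c 0 = f 0 ∧ ∀ᶠ z in 𝓝 (0 : ℂ), HasSum (fun n => c n * z ^ n) (f z) := by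
  obtain ⟨p, hp⟩ := hf
  refine ⟨p.coeff, ?_, ?_, ?_⟩
  · obtain ⟨C, r, hC, hr, h⟩ := p.le_mul_pow_of_radius_pos hp.radius_pos
    exact ⟨C, r, hC, hr, fun n => by
      rw [← FormalMultilinearSeries.norm_apply_eq_norm_coef]; exact h n⟩
  · exact hp.coeff_zero _
  · filter_upwards [hp.eventually_hasSum] with z hz
    simpa [mul_comm] using hz

lemma hasSum_of_eq {f g : ℕ → ℂ} {a : ℂ} (h : HasSum f a) (hg : ∀ n, g n = f n) :
    HasSum g a := by
  rwa [show g = f from funext hg]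

lemma GB.hasSum_deriv {c : ℕ → ℂ} (hc : GB c) :
    ∀ᶠ z in 𝓝 (0 : ℂ), DifferentiableAt ℂ (fun w => ∑' n, c n * w ^ n) z ∧
      HasSum (fun n : ℕ => (n : ℂ) * c n * z ^ n) (z * deriv (fun w => ∑' n, c n * w ^ n) z) := by
  obtain ⟨M, ρ, hM, hρ, h⟩ := hc
  have hb := Metric.ball_mem_nhds (0 : ℂ) (inv_pos.2 (mul_pos two_pos hρ))
  filter_upwards [hb] with z hz
  have hu : Summable (fun n : ℕ => M * (1 / 2 : ℝ) ^ n) :=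
    (summable_geometric_of_lt_one (by norm_num) (by norm_num)).mul_left M
  have hd : ∀ n : ℕ, DifferentiableOn ℂ (fun w : ℂ => c n * w ^ n)
      (Metric.ball 0 (2 * ρ)⁻¹) := fun n => by fun_prop
  have hle : ∀ n : ℕ, ∀ w ∈ Metric.ball (0 : ℂ) (2 * ρ)⁻¹,
      ‖c n * w ^ n‖ ≤ M * (1 / 2 : ℝ) ^ n := by
    intro n w hw
    have hw : ‖w‖ < (2 * ρ)⁻¹ := by simpa using hw
    have h1 : ρ * ‖w‖ ≤ 1 / 2 := by
      calc ρ * ‖w‖ ≤ ρ * (2 * ρ)⁻¹ := by gcongr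
        _ = 1 / 2 := by field_simp
    calc ‖c n * w ^ n‖ = ‖c n‖ * ‖w‖ ^ n := by rw [norm_mul, norm_pow]
      _ ≤ M * ρ ^ n * ‖w‖ ^ n := by gcongr; exact h n
      _ = M * (ρ * ‖w‖) ^ n := by rw [mul_pow, mul_assoc]
      _ ≤ _ := by gcongr
  refine ⟨(Complex.differentiableOn_tsum_of_summable_norm hu hd Metric.isOpen_ball
    hle).differentiableAt (Metric.isOpen_ball.mem_nhds hz), ?_⟩
  have := (Complex.hasSum_deriv_of_summable_norm hu hd Metric.isOpen_ball hle hz).mul_left z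
  refine hasSum_of_eq this fun n => ?_
  rcases n with _ | n
  · simp
  · simp; ring

lemma rec_bound {E : Type*} [NormedAddCommGroup E] (B T : ℕ → E → E) (ψ : ℕ → E) (x₀ : E)
    (M ρ C : ℝ) (hM : 0 < M) (hρ : 0 < ρ) (hC : 0 < C)
    (hB : ∀ n v, ‖B n v‖ ≤ M * ρ ^ n * ‖v‖) (hψ : ∀ n, ‖ψ n‖ ≤ M * ρ ^ n)
    (hT : ∀ n v, 1 ≤ n → ‖T n v‖ ≤ C * ‖v‖) :
    ∃ x : ℕ → E, GB x ∧ x 0 = x₀ ∧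
      ∀ n, 1 ≤ n → x n = T n (∑ j ∈ Finset.range n, B (n - j) (x j) + ψ n) := by
  classical
  let x : ℕ → E := fun n => Nat.strongRec (motive := fun _ => E)
    (fun n ih => if n = 0 then x₀ else
      T n (∑ j : Fin n, B (n - j) (ih j j.2) + ψ n)) n
  have hx : ∀ n, x n = if n = 0 then x₀ else
      T n (∑ j ∈ Finset.range n, B (n - j) (x j) + ψ n) := by
    intro n
    rw [Finset.sum_range]
    show Nat.strongRec (motive := fun _ => E) _ n = _
    rw [Nat.strongRec]
  have hx1 : ∀ n, 1 ≤ n → x n = T n (∑ j ∈ Finset.range n, B (n - j) (x j) + ψ n) := by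
    intro n hn
    rw [hx n, if_neg (by omega)]
  have hx0 : x 0 = x₀ := by rw [hx]; simp
  refine ⟨x, ?_, hx0, hx1⟩
  set R := ρ * (1 + 2 * C * M) with hR
  have hRpos : 0 < R := by positivity
  have hρR : ρ ≤ R := by
    rw [hR]; nlinarith [mul_pos hρ (mul_pos hC hM)]
  have hS : ∀ n, 2 * C * M * ∑ j ∈ Finset.range n, ρ ^ (n - j) * R ^ j ≤ R ^ n := by
    intro n
    induction n with
    | zero => simp
    | succ n ih =>
      have : ∑ j ∈ Finset.range (n + 1), ρ ^ (n + 1 - j) * R ^ j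
          = ρ * ∑ j ∈ Finset.range n, ρ ^ (n - j) * R ^ j + ρ * R ^ n := by
        rw [Finset.sum_range_succ, Finset.mul_sum]
        congr 1
        · refine Finset.sum_congr rfl fun j hj => ?_
          have := Finset.mem_range.1 hj
          rw [show n + 1 - j = (n - j) + 1 by omega, pow_succ]; ring
        · simp
      rw [this, pow_succ]
      have h2 := mul_le_mul_of_nonneg_left ih hρ.le
      have h3 : R ^ n * R = ρ * R ^ n + 2 * C * M * (ρ * R ^ n) := by
        rw [hR]; ring
      rw [h3]; linarith
  set K := max ‖x₀‖ (2 * C * M) with hK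
  have hKpos : 0 < K := lt_of_lt_of_le (by positivity) (le_max_right _ _)
  refine ⟨K, R, hKpos, hRpos, fun n => ?_⟩
  induction n using Nat.strong_induction_on with
  | _ n ih =>
    rcases Nat.eq_zero_or_pos n with rfl | hn
    · rw [hx0]; simp [hK]
    · rw [hx1 n hn]
      have h1 : ‖∑ j ∈ Finset.range n, B (n - j) (x j)‖ ≤
          M * K * ∑ j ∈ Finset.range n, ρ ^ (n - j) * R ^ j := by
        rw [Finset.mul_sum]
        refine norm_sum_le_of_le _ fun j hj => ?_
        refine (hB _ _).trans ?_
        calc M * ρ ^ (n - j) * ‖x j‖ ≤ M * ρ ^ (n - j) * (K * R ^ j) := by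
              gcongr; exact ih j (Finset.mem_range.1 hj)
          _ = _ := by ring
      have h2 : ρ ^ n ≤ R ^ n := by gcongr
      have h3 : 2 * C * M ≤ K := le_max_right _ _
      have h4 := mul_le_mul_of_nonneg_left (hS n) hKpos.le
      calc _ ≤ C * ‖_‖ := hT n _ hn
        _ ≤ C * (M * K * ∑ j ∈ Finset.range n, ρ ^ (n - j) * R ^ j + M * ρ ^ n) := by
            gcongr
            exact (norm_add_le _ _).trans (add_le_add h1 (hψ n))
        _ ≤ K * R ^ n := by
            have h5 : 2 * C * M * ρ ^ n ≤ K * R ^ n := by gcongr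
            linarith

lemma inv_bound (b : ℂ) : ∃ C : ℝ, 0 < C ∧ ∀ n : ℕ, ‖((n : ℂ) - b)⁻¹‖ ≤ C := by
  have h : Tendsto (fun n : ℕ => ((n : ℂ) - b)⁻¹) atTop (𝓝 0) := by
    refine Filter.tendsto_inv₀_cobounded.comp ?_
    rw [← tendsto_norm_atTop_iff_cobounded]
    refine tendsto_atTop_mono (f := fun n : ℕ => (n : ℝ) - ‖b‖) (fun n => ?_) ?_
    · simpa using norm_sub_norm_le (n : ℂ) b
    · exact tendsto_atTop_add_const_right _ _ tendsto_natCast_atTop_atTop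
  obtain ⟨C, hC⟩ := (Metric.isBounded_range_of_tendsto _ h).exists_norm_le
  exact ⟨max C 1, by positivity, fun n => (hC _ ⟨n, rfl⟩).trans (le_max_left _ _)⟩

lemma hasSum_mul_series {c d : ℕ → ℂ} {z f g : ℂ}
    (hc : Summable fun n => ‖c n * z ^ n‖) (hd : Summable fun n => ‖d n * z ^ n‖)
    (hf : HasSum (fun n => c n * z ^ n) f) (hg : HasSum (fun n => d n * z ^ n) g) :
    HasSum (fun n => (∑ j ∈ Finset.range n, c (n - j) * d j + c 0 * d n) * z ^ n) (f * g) := by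
  have := hasSum_sum_range_mul_of_summable_norm hd hc
  rw [hf.tsum_eq, hg.tsum_eq, mul_comm] at this
  refine hasSum_of_eq this fun n => ?_
  rw [Finset.sum_range_succ, add_mul, Finset.sum_mul]
  congr 1
  · refine Finset.sum_congr rfl fun j hj => ?_
    have := Finset.mem_range.1 hj
    have h2 : z ^ n = z ^ j * z ^ (n - j) := by rw [← pow_add]; congr 1; omega
    rw [h2]; ring
  · simp; ring

lemma core (b₁₁ b₁₂ b₂₁ b₂₂ ψ₁ ψ₂ : ℂ → ℂ) (h11 : AnalyticAt ℂ b₁₁ 0) (h12 : AnalyticAt ℂ b₁₂ 0)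
    (h21 : AnalyticAt ℂ b₂₁ 0) (h22 : AnalyticAt ℂ b₂₂ 0) (hψ1 : AnalyticAt ℂ ψ₁ 0)
    (hψ2 : AnalyticAt ℂ ψ₂ 0) (h0 : b₂₁ 0 = 0) (hn1 : ∀ n : ℕ, 1 ≤ n → (n : ℂ) ≠ b₁₁ 0)
    (hn2 : ∀ n : ℕ, 1 ≤ n → (n : ℂ) ≠ b₂₂ 0) (x₀ y₀ : ℂ)
    (hx : b₁₁ 0 * x₀ + b₁₂ 0 * y₀ + ψ₁ 0 = 0) (hy : b₂₂ 0 * y₀ + ψ₂ 0 = 0) :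
    ∃ h₁ h₂ : ℂ → ℂ, ∀ᶠ z in 𝓝 (0 : ℂ), DifferentiableAt ℂ h₁ z ∧ DifferentiableAt ℂ h₂ z ∧
      z * deriv h₁ z = b₁₁ z * h₁ z + b₁₂ z * h₂ z + ψ₁ z ∧
      z * deriv h₂ z = b₂₁ z * h₁ z + b₂₂ z * h₂ z + ψ₂ z := by
  obtain ⟨c11, g11, z11, s11⟩ := analytic_repr h11
  obtain ⟨c12, g12, z12, s12⟩ := analytic_repr h12
  obtain ⟨c21, g21, z21, s21⟩ := analytic_repr h21
  obtain ⟨c22, g22, z22, s22⟩ := analytic_repr h22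
  obtain ⟨p1, gp1, zp1, sp1⟩ := analytic_repr hψ1
  obtain ⟨p2, gp2, zp2, sp2⟩ := analytic_repr hψ2
  rw [← z11] at hn1 hx
  rw [← z22] at hn2 hy
  rw [← z12, ← zp1] at hx
  rw [← zp2] at hy
  rw [← z21] at h0
  obtain ⟨M, ρ, hM, hρ, hb⟩ := (((g11.uniform g12).uniform (g21.uniform g22)).uniform
    (gp1.uniform gp2))
  simp only [Prod.norm_def, max_le_iff] at hb
  obtain ⟨C1, hC1, hi1⟩ := inv_bound (c11 0)
  obtain ⟨C2, hC2, hi2⟩ := inv_bound (c22 0)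
  let B : ℕ → ℂ × ℂ → ℂ × ℂ := fun n v =>
    (c11 n * v.1 + c12 n * v.2, c21 n * v.1 + c22 n * v.2)
  let T : ℕ → ℂ × ℂ → ℂ × ℂ := fun n v =>
    (((n : ℂ) - c11 0)⁻¹ * (v.1 + c12 0 * (((n : ℂ) - c22 0)⁻¹ * v.2)),
      ((n : ℂ) - c22 0)⁻¹ * v.2)
  have lin : ∀ (a b : ℂ) (D : ℝ) (v : ℂ × ℂ), ‖a‖ ≤ D → ‖b‖ ≤ D →
      ‖a * v.1 + b * v.2‖ ≤ 2 * D * ‖v‖ := by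
    intro a b D v ha hb
    have hD := (norm_nonneg a).trans ha
    calc _ ≤ ‖a‖ * ‖v.1‖ + ‖b‖ * ‖v.2‖ := by
          simpa only [norm_mul] using norm_add_le (a * v.1) (b * v.2)
      _ ≤ D * ‖v‖ + D * ‖v‖ := by
          gcongr
          · exact norm_fst_le v
          · exact norm_snd_le v
      _ = _ := by ring
  obtain ⟨x, gx, hx0, hxr⟩ := rec_bound B T (fun n => (p1 n, p2 n)) (x₀, y₀) (2 * M) ρ
    (C1 * (1 + ‖c12 0‖ * C2) + C2) (by positivity) hρ (by positivity)
    (by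
      intro n v
      rw [show 2 * M * ρ ^ n * ‖v‖ = 2 * (M * ρ ^ n) * ‖v‖ by ring, Prod.norm_def]
      exact max_le (lin _ _ _ _ (hb n).1.1.1 (hb n).1.1.2)
        (lin _ _ _ _ (hb n).1.2.1 (hb n).1.2.2))
    (by
      intro n
      rw [Prod.norm_def]
      have : 0 < M * ρ ^ n := by positivity
      exact max_le (by linarith [(hb n).2.1]) (by linarith [(hb n).2.2]))
    (by
      intro n v hn
      rw [Prod.norm_def]
      have hv1 := norm_fst_le v
      have hv2 := norm_snd_le v
      have e2 : ‖((n : ℂ) - c22 0)⁻¹ * v.2‖ ≤ C2 * ‖v‖ := by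
        rw [norm_mul]; gcongr; exact hi2 n
      have e1 : ‖((n : ℂ) - c11 0)⁻¹ * (v.1 + c12 0 * (((n : ℂ) - c22 0)⁻¹ * v.2))‖
          ≤ C1 * (‖v‖ + ‖c12 0‖ * (C2 * ‖v‖)) := by
        rw [norm_mul]
        gcongr
        · exact hi1 n
        · refine (norm_add_le _ _).trans ?_
          rw [norm_mul (c12 0)]
          gcongr
      refine max_le (e1.trans ?_) (e2.trans ?_)
      · have : 0 ≤ C2 * ‖v‖ := by positivity
        linarith
      · have : 0 ≤ C1 * (1 + ‖c12 0‖ * C2) * ‖v‖ := by positivity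
        linarith)
  have gx1 : GB (fun n => (x n).1) := by
    obtain ⟨K, R, hK, hR, h⟩ := gx
    exact ⟨K, R, hK, hR, fun n => (norm_fst_le _).trans (h n)⟩
  have gx2 : GB (fun n => (x n).2) := by
    obtain ⟨K, R, hK, hR, h⟩ := gx
    exact ⟨K, R, hK, hR, fun n => (norm_snd_le _).trans (h n)⟩
  have r2 : ∀ n : ℕ, (n : ℂ) * (x n).2 =
      (∑ j ∈ Finset.range n, c21 (n - j) * (x j).1 + c21 0 * (x n).1) +
      (∑ j ∈ Finset.range n, c22 (n - j) * (x j).2 + c22 0 * (x n).2) + p2 n := by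
    intro n
    rcases Nat.eq_zero_or_pos n with rfl | hn
    · simp [hx0, h0, hy]
    · have h := congrArg Prod.snd (hxr n hn)
      simp only [T, B, Prod.snd_add, Prod.snd_sum, Finset.sum_add_distrib] at h
      have hne : (n : ℂ) - c22 0 ≠ 0 := sub_ne_zero.2 (hn2 n hn)
      have h' := (eq_inv_mul_iff_mul_eq₀ hne).1 h
      rw [h0]
      linear_combination h'
  have r1 : ∀ n : ℕ, (n : ℂ) * (x n).1 =
      (∑ j ∈ Finset.range n, c11 (n - j) * (x j).1 + c11 0 * (x n).1) +
      (∑ j ∈ Finset.range n, c12 (n - j) * (x j).2 + c12 0 * (x n).2) + p1 n := by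
    intro n
    rcases Nat.eq_zero_or_pos n with rfl | hn
    · simp [hx0, hx]
    · have h2 := congrArg Prod.snd (hxr n hn)
      have h := congrArg Prod.fst (hxr n hn)
      simp only [T] at h2
      simp only [T] at h
      rw [← h2] at h
      simp only [B, Prod.fst_add, Prod.fst_sum, Finset.sum_add_distrib] at h
      have hne : (n : ℂ) - c11 0 ≠ 0 := sub_ne_zero.2 (hn1 n hn)
      have h' := (eq_inv_mul_iff_mul_eq₀ hne).1 h
      linear_combination h'
  refine ⟨fun w => ∑' n, (x n).1 * w ^ n, fun w => ∑' n, (x n).2 * w ^ n, ?_⟩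
  filter_upwards [gx1.hasSum_deriv, gx2.hasSum_deriv, gx1.summable, gx2.summable, g11.summable, g12.summable,
    g21.summable, g22.summable, s11, s12, s21, s22, sp1, sp2] with z d1 d2 u1 u2 u11 u12 u21 u22
    s11 s12 s21 s22 sp1 sp2
  have t1 := u1.of_norm.hasSum
  have t2 := u2.of_norm.hasSum
  refine ⟨d1.1, d2.1, ?_, ?_⟩
  · refine d1.2.unique ?_
    have := ((hasSum_mul_series u11 u1 s11 t1).add (hasSum_mul_series u12 u2 s12 t2)).add sp1
    refine hasSum_of_eq this fun n => ?_
    rw [r1 n]; ring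
  · refine d2.2.unique ?_
    have := ((hasSum_mul_series u21 u1 s21 t1).add (hasSum_mul_series u22 u2 s22 t2)).add sp2
    refine hasSum_of_eq this fun n => ?_
    rw [r2 n]; ring

theorem ode_system_solvable_at_singular_point_iff (k l : ℕ) (hk : 1 ≤ k) (hl : 1 ≤ l)
    (p r : Polynomial ℂ) (v₀ : ℂ)
    (hr0 : r.eval v₀ = 0) (hr' : r.derivative.eval v₀ ≠ 0)
    (hirr : ∀ a : ℚ, p.eval v₀ / r.derivative.eval v₀ ≠ (a : ℂ))
    (φ₁ φ₂ : ℂ → ℂ)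
    (hφ₁ : ∀ᶠ v in 𝓝 v₀, DifferentiableAt ℂ φ₁ v)
    (hφ₂ : ∀ᶠ v in 𝓝 v₀, DifferentiableAt ℂ φ₂ v) :
    (∃ h₁ h₂ : ℂ → ℂ, ∀ᶠ v in 𝓝 v₀,
        DifferentiableAt ℂ h₁ v ∧ DifferentiableAt ℂ h₂ v ∧
        r.eval v * deriv h₁ v -
            (((k : ℂ) - (l : ℂ)) * p.eval v * h₁ v + p.derivative.eval v * h₂ v) = φ₁ v ∧
        r.eval v * deriv h₂ v -
            ((k : ℂ) * r.eval v * h₁ v +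
              (r.derivative.eval v - (l : ℂ) * p.eval v) * h₂ v) = φ₂ v) ↔
    (l ≠ k ∨ (l = k ∧
      p.derivative.eval v₀ * φ₂ v₀
        = (r.derivative.eval v₀ - (k : ℂ) * p.eval v₀) * φ₁ v₀)) := by
  have key : ∀ (n m : ℤ), m ≠ 0 → (m : ℂ) * p.eval v₀ ≠ n * r.derivative.eval v₀ := by
    intro n m hm h
    have hm' : (m : ℂ) ≠ 0 := by exact_mod_cast hm
    apply hirr ((n : ℚ) / m)
    push_cast
    rw [div_eq_div_iff hr' hm']
    linear_combination h
  constructor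
  · rintro ⟨h₁, h₂, h⟩
    by_cases hlk : l = k
    · refine Or.inr ⟨hlk, ?_⟩
      obtain ⟨-, -, e1, e2⟩ := h.self_of_nhds
      subst hlk
      rw [hr0] at e1 e2
      rw [← e1, ← e2]; ring
    · exact Or.inl hlk
  · intro hcond
    set s := r /ₘ (Polynomial.X - Polynomial.C v₀) with hs
    have hrs : (Polynomial.X - Polynomial.C v₀) * s = r :=
      Polynomial.mul_divByMonic_eq_iff_isRoot.2 hr0
    have hs0 : s.eval v₀ = r.derivative.eval v₀ := by
      rw [← hrs]; simp
    have hsne : s.eval v₀ ≠ 0 := hs0 ▸ hr'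
    have hre : ∀ v, r.eval v = (v - v₀) * s.eval v := by
      intro v
      conv_lhs => rw [← hrs]
      simp
    have han : ∀ q : Polynomial ℂ, AnalyticAt ℂ (fun z => q.eval (z + v₀)) 0 := by
      intro q
      have : Differentiable ℂ (fun z => q.eval (z + v₀)) := by fun_prop
      exact this.analyticAt 0
    have hsh : ∀ f : ℂ → ℂ, (∀ᶠ v in 𝓝 v₀, DifferentiableAt ℂ f v) →
        AnalyticAt ℂ (fun z => f (z + v₀)) 0 := by
      intro f hf
      have h1 : AnalyticAt ℂ f v₀ := Complex.analyticAt_iff_eventually_differentiableAt.2 hf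
      have h2 : AnalyticAt ℂ (fun z : ℂ => z + v₀) 0 := by fun_prop
      exact AnalyticAt.fun_comp (by simpa using h1) h2
    have hs00 : s.eval (0 + v₀) ≠ 0 := by simpa using hsne
    have hd : ∀ f : ℂ → ℂ, AnalyticAt ℂ f 0 →
        AnalyticAt ℂ (fun z => f z / s.eval (z + v₀)) 0 := fun f hf => hf.div (han s) hs00
    have h22 : r.derivative.eval v₀ - (l : ℂ) * p.eval v₀ ≠ 0 := by
      intro h
      apply key 1 l (by omega)
      push_cast
      linear_combination -h
    obtain ⟨x₀, y₀, ex, ey⟩ : ∃ x₀ y₀ : ℂ,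
        ((k : ℂ) - l) * p.eval v₀ * x₀ + p.derivative.eval v₀ * y₀ + φ₁ v₀ = 0 ∧
        (r.derivative.eval v₀ - (l : ℂ) * p.eval v₀) * y₀ + φ₂ v₀ = 0 := by
      rcases hcond with hne | ⟨rfl, hc⟩
      · have hp : ((k : ℂ) - l) * p.eval v₀ ≠ 0 := by
          intro h
          apply key 0 ((k : ℤ) - l) (by omega)
          push_cast
          linear_combination h
        refine ⟨-(p.derivative.eval v₀ * (-φ₂ v₀ / (r.derivative.eval v₀ - (l : ℂ) * p.eval v₀))
          + φ₁ v₀) / (((k : ℂ) - l) * p.eval v₀),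
          -φ₂ v₀ / (r.derivative.eval v₀ - (l : ℂ) * p.eval v₀), ?_, ?_⟩
        · rw [mul_div_cancel₀ _ hp]; ring
        · rw [mul_div_cancel₀ _ h22]; ring
      · refine ⟨0, -φ₂ v₀ / (r.derivative.eval v₀ - (l : ℂ) * p.eval v₀), ?_, ?_⟩
        · have : p.derivative.eval v₀ * (-φ₂ v₀ / (r.derivative.eval v₀ - (l : ℂ) * p.eval v₀))
              = - φ₁ v₀ := by
            rw [← mul_div_assoc, div_eq_iff h22]
            linear_combination -hc
          rw [this]; ring
        · rw [mul_div_cancel₀ _ h22]; ring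
    obtain ⟨h₁, h₂, h⟩ := core
      (fun z => (((k : ℂ) - l) * p.eval (z + v₀)) / s.eval (z + v₀))
      (fun z => p.derivative.eval (z + v₀) / s.eval (z + v₀))
      (fun z => (k : ℂ) * z)
      (fun z => (r.derivative.eval (z + v₀) - (l : ℂ) * p.eval (z + v₀)) / s.eval (z + v₀))
      (fun z => φ₁ (z + v₀) / s.eval (z + v₀)) (fun z => φ₂ (z + v₀) / s.eval (z + v₀))
      (hd _ (analyticAt_const.mul (han p))) (hd _ (han _)) (by fun_prop)
      (hd _ ((han _).sub (analyticAt_const.mul (han p)))) (hd _ (hsh _ hφ₁)) (hd _ (hsh _ hφ₂))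
      (by simp)
      (by
        intro n hn h
        simp only [zero_add] at h
        rw [eq_div_iff hsne, hs0] at h
        by_cases hkl : (k : ℤ) - l = 0
        · have : (k : ℂ) - l = 0 := by exact_mod_cast congrArg (Int.cast : ℤ → ℂ) hkl
          rw [this, zero_mul] at h
          rcases mul_eq_zero.1 h with h | h
          · have : n = 0 := by exact_mod_cast h
            omega
          · exact hr' h
        · apply key n ((k : ℤ) - l) hkl
          push_cast
          exact h.symm)
      (by
        intro n hn h
        simp only [zero_add] at h
        rw [eq_div_iff hsne, hs0] at h
        apply key (1 - n) l (by omega)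
        push_cast
        linear_combination h)
      x₀ y₀
      (by
        simp only [zero_add]
        field_simp
        linear_combination ex)
      (by
        simp only [zero_add]
        field_simp
        linear_combination ey)
    refine ⟨fun v => h₁ (v - v₀), fun v => h₂ (v - v₀), ?_⟩
    have ht : Tendsto (fun v : ℂ => v - v₀) (𝓝 v₀) (𝓝 0) := by
      have : ContinuousAt (fun v : ℂ => v - v₀) v₀ := by fun_prop
      simpa [ContinuousAt] using this
    have hsv : ∀ᶠ v in 𝓝 v₀, s.eval v ≠ 0 :=
      (s.continuous.continuousAt (x := v₀)).eventually_ne hsne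
    filter_upwards [ht.eventually h, hsv] with v ⟨d1, d2, e1, e2⟩ hv
    simp only [sub_add_cancel] at e1 e2
    refine ⟨?_, ?_, ?_, ?_⟩
    · exact DifferentiableAt.fun_comp' v d1 (by fun_prop)
    · exact DifferentiableAt.fun_comp' v d2 (by fun_prop)
    · rw [deriv_comp_sub_const, hre]
      field_simp at e1
      linear_combination e1
    · rw [deriv_comp_sub_const, hre]
      field_simp at e2
      linear_combination e2
end
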